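/- arXiv:2504.15907 — 4 statements merged into one kernel-verified Lean document; each statement's English description precedes it below -/
import Mathlib

section
/- Let a, p₁, p₂, b be nonzero complex constants. Then there is no entire function f satisfying f(z)³ + a·(f'(z))³ = p₁·e^{bz} + p₂·e^{−bz} for all z ∈ ℂ. -/
open Complex

lemma half_mul_norm_cosh_le_norm_sinh {z : ℂ} {δ : ℝ} (h0 : 0 < δ) (h1 : δ ≤ 1)
    (hz : δ ≤ |z.re|) :
    δ / 2 * ‖cosh z‖ ≤ ‖sinh z‖ ∧ δ / 2 * ‖sinh z‖ ≤ ‖cosh z‖ := by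
  have key : ∀ x : ℝ, δ ≤ x →
      δ / 2 * (Real.exp x + Real.exp (-x)) ≤ Real.exp x - Real.exp (-x) := by
    intro x hx
    have hmul : Real.exp x = Real.exp (2 * x) * Real.exp (-x) := by
      rw [← Real.exp_add]; ring_nf
    have hge : 2 * x + 1 ≤ Real.exp (2 * x) := Real.add_one_le_exp _
    have hpos := Real.exp_pos (-x)
    rw [hmul]
    have : 0 ≤ (Real.exp (2 * x) * (1 - δ / 2) - (1 + δ / 2)) := by nlinarith
    nlinarith
  have habs : δ / 2 * (Real.exp z.re + Real.exp (-z.re))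
      ≤ |Real.exp z.re - Real.exp (-z.re)| := by
    rcases le_abs.mp hz with h | h
    · exact (key _ h).trans (le_abs_self _)
    · have := key _ h
      rw [neg_neg] at this
      rw [abs_sub_comm]
      exact (by linarith : _ ≤ Real.exp (-z.re) - Real.exp z.re).trans (le_abs_self _)
  have e1 : ‖exp z‖ = Real.exp z.re := norm_exp z
  have e2 : ‖exp (-z)‖ = Real.exp (-z.re) := by rw [norm_exp, neg_re]
  have hc : ‖cosh z‖ * 2 = ‖exp z + exp (-z)‖ := by simp [cosh]
  have hs : ‖sinh z‖ * 2 = ‖exp z - exp (-z)‖ := by simp [sinh]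
  have c1 := norm_add_le (exp z) (exp (-z))
  have s1 := norm_sub_le (exp z) (exp (-z))
  have s2 := abs_norm_sub_norm_le (exp z) (exp (-z))
  have c2 := abs_norm_sub_norm_le (exp z) (-exp (-z))
  rw [norm_neg, sub_neg_eq_add] at c2
  rw [e1, e2] at c1 s1 s2 c2
  constructor <;> nlinarith

lemma norm_le_of_quartic_ode {a : ℂ} {v G : ℂ → ℂ} {z₀ : ℂ} {η : ℝ} (h0 : 0 < η) (h1 : η ≤ 1)
    (hv : DifferentiableOn ℂ v (Metric.closedBall z₀ η))
    (hG : ∀ z ∈ Metric.closedBall z₀ η, η / 2 ≤ ‖G z‖)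
    (hode : ∀ z ∈ Metric.ball z₀ η, a * deriv v z = (v z ^ 3 + a) * (1 - G z * v z / 3)) :
    η ^ 2 * ‖v z₀‖ ≤ 13 + 98 * ‖a‖ := by
  obtain ⟨z₁, hz₁, hmax⟩ := (isCompact_closedBall z₀ η).exists_isMaxOn
    (f := fun z => (η - dist z z₀) * ‖v z‖) ⟨z₀, by simp [h0.le]⟩
    ((by fun_prop : Continuous fun z => η - dist z z₀).continuousOn.mul hv.continuousOn.norm)
  have hmax' : ∀ z ∈ Metric.closedBall z₀ η,
      (η - dist z z₀) * ‖v z‖ ≤ (η - dist z₁ z₀) * ‖v z₁‖ := fun z hz => hmax hz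
  have hcen := hmax' z₀ (by simp [h0.le])
  rw [dist_self, sub_zero] at hcen
  set ρ := η - dist z₁ z₀ with hρ
  set M := ‖v z₁‖ with hM
  have hM0 : 0 ≤ M := norm_nonneg _
  have ha := norm_nonneg a
  have hρη : ρ ≤ η := by rw [hρ]; linarith [dist_nonneg (x := z₁) (y := z₀)]
  suffices hfin : η * (ρ * M) ≤ 13 + 98 * ‖a‖ by nlinarith
  have hρ0 : 0 ≤ ρ := by rw [hρ]; linarith [Metric.mem_closedBall.mp hz₁]
  rcases hρ0.eq_or_lt with h | hρpos
  · rw [← h]; simp; positivity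
  by_cases hsmall : M ≤ max (1 + 2 * ‖a‖) (12 / η)
  · have hM1 : η * M ≤ 13 + 2 * ‖a‖ := by
      rcases le_max_iff.mp hsmall with h | h
      · nlinarith
      · rw [le_div_iff₀ h0] at h; linarith
    have : ρ * (η * M) ≤ 1 * (13 + 2 * ‖a‖) :=
      mul_le_mul (hρη.trans h1) hM1 (by positivity) zero_le_one
    linarith
  rw [not_le, max_lt_iff, div_lt_iff₀ h0] at hsmall
  obtain ⟨hMa, hMη⟩ := hsmall
  have hsub : Metric.closedBall z₁ (ρ / 2) ⊆ Metric.closedBall z₀ η :=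
    Metric.closedBall_subset_closedBall' (by linarith)
  have hcauchy : ‖deriv v z₁‖ ≤ 2 * M / (ρ / 2) := by
    apply norm_deriv_le_of_forall_mem_sphere_norm_le (by positivity)
    · refine DifferentiableOn.diffContOnCl (hv.mono ?_)
      exact Metric.closure_ball_subset_closedBall.trans hsub
    · intro z hz
      have hzc := Metric.sphere_subset_closedBall hz
      have h2 := hmax' z (hsub hzc)
      have h3 : dist z z₀ ≤ ρ / 2 + dist z₁ z₀ := by
        have := dist_triangle z z₁ z₀
        rw [Metric.mem_sphere.mp hz] at this
        exact this
      have h4 : ρ / 2 * ‖v z‖ ≤ ρ * M :=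
        (mul_le_mul_of_nonneg_right (by linarith) (norm_nonneg _)).trans h2
      nlinarith
  have hode1 := congrArg norm (hode z₁ (by rw [Metric.mem_ball]; linarith))
  rw [norm_mul, norm_mul] at hode1
  have hf1 : M ^ 3 / 2 ≤ ‖v z₁ ^ 3 + a‖ := by
    have h5 : ‖v z₁ ^ 3‖ - ‖a‖ ≤ ‖v z₁ ^ 3 + a‖ := by
      have := norm_sub_norm_le (v z₁ ^ 3) (-a)
      rwa [norm_neg, sub_neg_eq_add] at this
    rw [norm_pow, ← hM] at h5
    nlinarith [mul_pos (by linarith : 0 < M) (by linarith : 0 < M)]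
  have hf2 : η * M / 12 ≤ ‖1 - G z₁ * v z₁ / 3‖ := by
    have h6 : ‖G z₁ * v z₁ / 3‖ - ‖(1 : ℂ)‖ ≤ ‖1 - G z₁ * v z₁ / 3‖ := by
      rw [norm_sub_rev]; exact norm_sub_norm_le _ _
    rw [norm_div, norm_mul, ← hM, norm_one] at h6
    have h7 := mul_le_mul_of_nonneg_right (hG z₁ hz₁) hM0
    have h8 : ‖(3 : ℂ)‖ = 3 := by simp
    rw [h8] at h6
    linarith
  have hlow : M ^ 3 / 2 * (η * M / 12) ≤ ‖a‖ * (2 * M / (ρ / 2)) := by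
    calc _ ≤ ‖v z₁ ^ 3 + a‖ * ‖1 - G z₁ * v z₁ / 3‖ :=
          mul_le_mul hf1 hf2 (by positivity) (norm_nonneg _)
      _ = ‖a‖ * ‖deriv v z₁‖ := hode1.symm
      _ ≤ _ := mul_le_mul_of_nonneg_left hcauchy ha
  have hMpos : 0 < M := by linarith
  have h9 : η * (ρ * M) * M ^ 2 ≤ 96 * ‖a‖ := by
    have h10 : ‖a‖ * (2 * M / (ρ / 2)) = 4 * ‖a‖ * M / ρ := by field_simp; ring
    rw [h10, le_div_iff₀ hρpos] at hlow
    refine le_of_mul_le_mul_right ?_ hMpos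
    linarith
  have h11 : 1 ≤ M ^ 2 := by nlinarith
  nlinarith [mul_nonneg h0.le (mul_nonneg hρ0 hM0)]

lemma norm_le_of_mul_pow_dist_imaginary_axis_le {q : ℂ → ℂ} (hq : Differentiable ℂ q) {C : ℝ}
    {n : ℕ} (hn : n ≠ 0) (hC : ∀ z : ℂ, z.re ≠ 0 → min |z.re| 1 ^ n * ‖q z‖ ≤ C) (z : ℂ) :
    ‖q z‖ ≤ 2 ^ n * C := by
  have hC0 : 0 ≤ C := le_trans (by positivity) (hC 1 (by simp))
  rcases le_total |z.re| 1 with hx | hx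
  swap
  · have := hC z (fun h => by rw [h] at hx; norm_num at hx)
    rw [min_eq_right hx, one_pow, one_mul] at this
    exact this.trans (le_mul_of_one_le_left hC0 (one_le_pow₀ one_le_two))
  set t : ℂ := z.im * I with ht
  have hzt : z - t = z.re := by
    rw [ht]; nth_rewrite 1 [← re_add_im z]; ring
  have hbound : ‖q z * ((z - t) ^ 2 + 1) ^ n‖ ≤ 2 ^ n * C := by
    refine norm_le_of_forall_mem_frontier_norm_le
      (f := fun w => q w * ((w - t) ^ 2 + 1) ^ n) (U := Metric.ball t 1)
      Metric.isBounded_ball ?_ ?_ ?_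
    · exact Differentiable.diffContOnCl (by fun_prop)
    · intro w hw
      rw [frontier_ball t one_ne_zero, mem_sphere_iff_norm] at hw
      have hre : (w - t).re = w.re := by simp [ht]
      have hsq : ‖(w - t) ^ 2 + 1‖ = 2 * |w.re| := by
        have h1 : (w - t) ^ 2 + 1 = (w - t) * ((2 * w.re : ℝ) : ℂ) := by
          have h2 : (w - t) * (starRingEnd ℂ) (w - t) = 1 := by
            rw [mul_conj, normSq_eq_norm_sq, hw]; simp
          have h3 := add_conj (w - t)
          rw [hre] at h3
          rw [← h3, mul_add, h2]; ring
        rw [h1, norm_mul, hw, one_mul, norm_real, Real.norm_eq_abs, abs_mul, abs_two]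
      have hle : |w.re| ≤ 1 := by
        rw [← hre, ← hw]; exact abs_re_le_norm _
      rw [norm_mul, norm_pow, hsq, mul_pow]
      by_cases hw0 : w.re = 0
      · simp only [hw0, abs_zero, zero_pow hn, mul_zero]; positivity
      · have := hC w hw0
        rw [min_eq_left hle] at this
        calc _ = 2 ^ n * (|w.re| ^ n * ‖q w‖) := by ring
          _ ≤ _ := by gcongr
    · rw [closure_ball t one_ne_zero, mem_closedBall_iff_norm, hzt, norm_real]
      exact hx
  rw [norm_mul, norm_pow, hzt] at hbound
  refine le_trans (le_mul_of_one_le_right (norm_nonneg _) (one_le_pow₀ ?_)) hbound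
  have : ((z.re : ℂ) ^ 2 + 1) = ((z.re ^ 2 + 1 : ℝ) : ℂ) := by push_cast; ring
  rw [this, norm_real, Real.norm_eq_abs]
  exact le_trans (by nlinarith [sq_nonneg z.re]) (le_abs_self _)

/-- An entire function with a bound by a power of the distance to the imaginary axis is constant. -/
lemma apply_eq_apply_of_mul_pow_dist_imaginary_axis_le {q : ℂ → ℂ} (hq : Differentiable ℂ q)
    {C : ℝ} {n : ℕ} (hn : n ≠ 0) (hC : ∀ z : ℂ, z.re ≠ 0 → min |z.re| 1 ^ n * ‖q z‖ ≤ C)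
    (z w : ℂ) : q z = q w := by
  refine hq.apply_eq_apply_of_bounded ?_ z w
  rw [isBounded_iff_forall_norm_le]
  refine ⟨2 ^ n * C, ?_⟩
  rintro _ ⟨x, rfl⟩
  exact norm_le_of_mul_pow_dist_imaginary_axis_le hq hn hC x

lemma sinh_ne_zero_of_re_ne_zero {z : ℂ} (hz : z.re ≠ 0) : sinh z ≠ 0 := by
  intro hs
  have hδ : 0 < min |z.re| 1 := lt_min (abs_pos.mpr hz) one_pos
  have h1 := (half_mul_norm_cosh_le_norm_sinh hδ (min_le_right _ _) (min_le_left _ _)).1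
  rw [hs, norm_zero] at h1
  have h2 : ‖cosh z‖ ≤ 0 := by
    by_contra! h3
    nlinarith
  have h3 := cosh_sq_sub_sinh_sq z
  simp [norm_le_zero_iff.mp h2, hs] at h3

lemma cosh_ne_zero_of_re_ne_zero {z : ℂ} (hz : z.re ≠ 0) : cosh z ≠ 0 := by
  intro hs
  have hδ : 0 < min |z.re| 1 := lt_min (abs_pos.mpr hz) one_pos
  have h1 := (half_mul_norm_cosh_le_norm_sinh hδ (min_le_right _ _) (min_le_left _ _)).2
  rw [hs, norm_zero] at h1
  have h2 : ‖sinh z‖ ≤ 0 := by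
    by_contra! h3
    nlinarith
  exact sinh_ne_zero_of_re_ne_zero hz (norm_le_zero_iff.mp h2)

section CubicEquation

variable {a p : ℂ} {f : ℂ → ℂ}

lemma cubic_equation_deriv (hf : Differentiable ℂ f)
    (h : ∀ z, f z ^ 3 + a * deriv f z ^ 3 = p * cosh z) (z : ℂ) :
    3 * f z ^ 2 * deriv f z + 3 * a * deriv f z ^ 2 * deriv (deriv f) z = p * sinh z := by
  have h0 := (hf z).hasDerivAt
  have h1 := (hf.deriv z).hasDerivAt
  have hl := (h0.pow 3).add ((h1.pow 3).const_mul a)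
  have hr := (hasDerivAt_cosh z).const_mul p
  have := (hl.congr_of_eventuallyEq (.of_forall fun w => (h w).symm)).unique hr
  rw [← this]
  push_cast
  ring

lemma cubic_equation_deriv_deriv (hf : Differentiable ℂ f)
    (h : ∀ z, f z ^ 3 + a * deriv f z ^ 3 = p * cosh z) (z : ℂ) :
    6 * f z * deriv f z ^ 2 + 3 * f z ^ 2 * deriv (deriv f) z
      + 6 * a * deriv f z * deriv (deriv f) z ^ 2
      + 3 * a * deriv f z ^ 2 * deriv (deriv (deriv f)) z
      = f z ^ 3 + a * deriv f z ^ 3 := by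
  have h0 := (hf z).hasDerivAt
  have h1 := (hf.deriv z).hasDerivAt
  have h2 := (hf.deriv.deriv z).hasDerivAt
  have hl := (((h0.pow 2).const_mul 3).mul h1).add (((h1.pow 2).const_mul (3 * a)).mul h2)
  have hr := (hasDerivAt_sinh z).const_mul p
  have := (hl.congr_of_eventuallyEq
    (.of_forall fun w => (cubic_equation_deriv hf h w).symm)).unique hr
  rw [h z, ← this]
  push_cast
  simp only [Pi.pow_apply]
  ring

lemma not_deriv_eq_const_mul_of_cubic_equation (hp : p ≠ 0) (hf : Differentiable ℂ f)
    (h : ∀ z, f z ^ 3 + a * deriv f z ^ 3 = p * cosh z) (c : ℂ) :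
    ¬ ∀ z, deriv f z = c * f z := by
  intro hc
  have h2 : ∀ z, deriv (deriv f) z = c ^ 2 * f z := by
    intro z
    rw [funext hc, deriv_const_mul_field, hc z]; ring
  have key : ∀ z, sinh z = 3 * c * cosh z := by
    intro z
    apply mul_left_cancel₀ hp
    rw [← cubic_equation_deriv hf h z, mul_left_comm, ← h z, h2, hc]; ring
  have hc0 : c = 0 := by simpa using (key 0).symm
  exact sinh_ne_zero_of_re_ne_zero (z := 1) (by simp) (by rw [key 1, hc0]; ring)

lemma not_linear_ode_of_cubic_equation (ha : a ≠ 0) (hp : p ≠ 0) (hf : Differentiable ℂ f)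
    (h : ∀ z, f z ^ 3 + a * deriv f z ^ 3 = p * cosh z) (q : ℂ) :
    ¬ ∀ z, deriv (deriv f) z = q * deriv f z + f z / 3 := by
  intro hq
  have mul_eq_zero_cases : ∀ {u v : ℂ → ℂ}, Differentiable ℂ u → Differentiable ℂ v →
      (∀ z, u z * v z = 0) → (∀ z, u z = 0) ∨ ∀ z, v z = 0 := by
    intro u v hu hv huv
    simpa using AnalyticOnNhd.eq_zero_or_eq_zero_of_mul_eq_zero
      (fun z _ => hu.analyticAt z) (fun z _ => hv.analyticAt z) (fun z _ => huv z)
      isPreconnected_univ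
  have hf1 := hf.deriv
  have not_deriv_zero : ¬ ∀ z, deriv f z = 0 := fun h0 =>
    not_deriv_eq_const_mul_of_cubic_equation hp hf h 0 (by simpa using h0)
  have not_zero : ¬ ∀ z, f z = 0 := by
    intro h0
    exact not_deriv_zero fun z => by rw [funext h0]; simp
  have not_prop : ∀ r : ℂ, ¬ ∀ z, f z - r * deriv f z = 0 := by
    intro r hr
    by_cases hr0 : r = 0
    · exact not_zero (by simpa [hr0] using hr)
    · refine not_deriv_eq_const_mul_of_cubic_equation hp hf h r⁻¹ fun z => ?_
      rw [sub_eq_zero.mp (hr z), inv_mul_cancel_left₀ hr0]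
  have h3 : ∀ z, deriv (deriv (deriv f)) z = q * deriv (deriv f) z + deriv f z / 3 := by
    intro z
    have := (((hf1 z).hasDerivAt.const_mul q).add ((hf z).hasDerivAt.div_const 3)).deriv
    rw [← this]
    exact Filter.EventuallyEq.deriv_eq (.of_forall hq)
  set α := 3 * q + 2 * a / 3 with hα
  set β := 6 + 5 * a * q with hβ
  set γ := 9 * a * q ^ 2 with hγ
  have hprod : ∀ z, deriv f z *
      (α * f z ^ 2 + β * f z * deriv f z + γ * deriv f z ^ 2) = 0 := by
    intro z
    have := cubic_equation_deriv_deriv hf h z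
    rw [h3, hq] at this
    rw [hα, hβ, hγ]
    linear_combination this
  have hquad := (mul_eq_zero_cases hf1 (by fun_prop) hprod).resolve_left not_deriv_zero
  by_cases hα0 : α = 0
  · have hq0 : q ≠ 0 := by
      rintro rfl
      apply ha
      linear_combination (3 / 2) * hα0
    have hγ0 : γ ≠ 0 := by simp [hγ, ha, hq0]
    have := (mul_eq_zero_cases (v := fun z => β * f z + γ * deriv f z) hf1 (by fun_prop)
      (fun z => by linear_combination hquad z - f z ^ 2 * hα0)).resolve_left not_deriv_zero
    refine not_deriv_eq_const_mul_of_cubic_equation hp hf h (-β / γ) fun z => ?_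
    field_simp
    linear_combination this z
  · obtain ⟨r, hr⟩ := exists_quadratic_eq_zero (b := β) (c := γ) hα0
      ((IsAlgClosed.exists_pow_nat_eq (discrim α β γ) two_pos).imp fun _ hs => by rw [← hs, sq])
    have hfac : ∀ z, (f z - r * deriv f z) * (f z - (-β / α - r) * deriv f z) = 0 := by
      intro z
      apply mul_left_cancel₀ hα0
      have hβα : α * (-β / α) = -β := by field_simp
      linear_combination hquad z - (f z * deriv f z - r * deriv f z ^ 2) * hβα
        - deriv f z ^ 2 * hr
    rcases mul_eq_zero_cases (by fun_prop) (by fun_prop) hfac with h1 | h1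
    · exact not_prop _ h1
    · exact not_prop _ h1

lemma ne_zero_of_deriv_eq_zero (hp : p ≠ 0) (hf : Differentiable ℂ f)
    (h : ∀ z, f z ^ 3 + a * deriv f z ^ 3 = p * cosh z) {z : ℂ} (hz : deriv f z = 0) :
    f z ≠ 0 := by
  intro h0
  have e0 := h z
  have e1 := cubic_equation_deriv hf h z
  have e2 := cosh_sq_sub_sinh_sq z
  simp only [hz, h0, ne_eq, OfNat.ofNat_ne_zero, not_false_eq_true, zero_pow, mul_zero, add_zero,
    zero_mul, zero_eq_mul, hp, false_or] at e0 e1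
  simp [e0, e1] at e2

lemma exists_differentiable_quotient (hp : p ≠ 0) (hf : Differentiable ℂ f)
    (h : ∀ z, f z ^ 3 + a * deriv f z ^ 3 = p * cosh z) :
    ∃ q : ℂ → ℂ, Differentiable ℂ q ∧
      ∀ z, deriv (deriv f) z = q z * deriv f z + f z / 3 := by
  have hf1 := hf.deriv
  have hf2 := hf1.deriv
  have hf3 := hf2.deriv
  set N : ℂ → ℂ := fun z => a * deriv f z ^ 2 - 6 * f z * deriv f z
    - 6 * a * deriv (deriv f) z ^ 2 - 3 * a * deriv f z * deriv (deriv (deriv f)) z with hN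
  have hNd : Differentiable ℂ N := by fun_prop
  have hrel : ∀ z, f z ^ 2 * (3 * deriv (deriv f) z - f z) = deriv f z * N z := by
    intro z
    simp only [hN]
    linear_combination cubic_equation_deriv_deriv hf h z
  set q : ℂ → ℂ := fun z => if f z = 0 then (deriv (deriv f) z - f z / 3) / deriv f z
    else N z / (3 * f z ^ 2) with hqdef
  have hq : ∀ z, deriv (deriv f) z = q z * deriv f z + f z / 3 := by
    intro z
    simp only [hqdef]
    split_ifs with h0
    · have : deriv f z ≠ 0 := fun h1 => ne_zero_of_deriv_eq_zero hp hf h h1 h0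
      field_simp
      ring
    · field_simp
      linear_combination hrel z
  refine ⟨q, fun z => ?_, hq⟩
  by_cases h0 : f z = 0
  · have h1 : deriv f z ≠ 0 := fun h1 => ne_zero_of_deriv_eq_zero hp hf h h1 h0
    have hd : DifferentiableAt ℂ (fun w => (deriv (deriv f) w - f w / 3) / deriv f w) z :=
      ((hf2 z).sub ((hf z).div_const 3)).div (hf1 z) h1
    refine hd.congr_of_eventuallyEq ?_
    filter_upwards [(hf1 z).continuousAt.eventually_ne h1] with w hw
    rw [hq w]
    field_simp
    ring
  · have hd : DifferentiableAt ℂ (fun w => N w / (3 * f w ^ 2)) z :=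
      (hNd z).div (((hf z).pow 2).const_mul 3) (by simp [h0])
    refine hd.congr_of_eventuallyEq ?_
    filter_upwards [(hf z).continuousAt.eventually_ne h0] with w hw
    simp [hqdef, hw]

lemma deriv_ne_zero_of_re_ne_zero (hp : p ≠ 0) (hf : Differentiable ℂ f)
    (h : ∀ z, f z ^ 3 + a * deriv f z ^ 3 = p * cosh z) {z : ℂ} (hz : z.re ≠ 0) :
    deriv f z ≠ 0 := by
  intro h1
  have e1 := cubic_equation_deriv hf h z
  simp only [h1, ne_eq, OfNat.ofNat_ne_zero, not_false_eq_true, zero_pow, mul_zero, add_zero,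
    zero_mul, zero_eq_mul, hp, false_or] at e1
  exact sinh_ne_zero_of_re_ne_zero hz e1

lemma quartic_ode_of_cubic_equation (hp : p ≠ 0) (hf : Differentiable ℂ f)
    (h : ∀ z, f z ^ 3 + a * deriv f z ^ 3 = p * cosh z) {z : ℂ} (hz : z.re ≠ 0) :
    a * deriv (fun w => f w / deriv f w) z
      = ((f z / deriv f z) ^ 3 + a) * (1 - sinh z / cosh z * (f z / deriv f z) / 3) := by
  have h1 := deriv_ne_zero_of_re_ne_zero hp hf h hz
  have hc := cosh_ne_zero_of_re_ne_zero hz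
  rw [((hf z).hasDerivAt.fun_div (hf.deriv z).hasDerivAt h1).deriv]
  have e : sinh z / cosh z * (f z ^ 3 + a * deriv f z ^ 3)
      = 3 * f z ^ 2 * deriv f z + 3 * a * deriv f z ^ 2 * deriv (deriv f) z := by
    rw [h, cubic_equation_deriv hf h]; field_simp
  generalize sinh z / cosh z = G at e ⊢
  field_simp
  linear_combination f z * e

lemma three_mul_quotient_eq (hp : p ≠ 0) (hf : Differentiable ℂ f)
    (h : ∀ z, f z ^ 3 + a * deriv f z ^ 3 = p * cosh z) {q : ℂ → ℂ}
    (hq : ∀ z, deriv (deriv f) z = q z * deriv f z + f z / 3) {z : ℂ} (hz : z.re ≠ 0) :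
    3 * a * q z = sinh z / cosh z * ((f z / deriv f z) ^ 3 + a) - 3 * (f z / deriv f z) ^ 2
      - a * (f z / deriv f z) := by
  have h1 := deriv_ne_zero_of_re_ne_zero hp hf h hz
  have hc := cosh_ne_zero_of_re_ne_zero hz
  have e : sinh z / cosh z * (f z ^ 3 + a * deriv f z ^ 3)
      = 3 * f z ^ 2 * deriv f z + 3 * a * deriv f z ^ 2 * deriv (deriv f) z := by
    rw [h, cubic_equation_deriv hf h]; field_simp
  rw [hq] at e
  generalize sinh z / cosh z = G at e ⊢
  field_simp
  linear_combination -e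

lemma sq_mul_norm_div_deriv_le (hp : p ≠ 0) (hf : Differentiable ℂ f)
    (h : ∀ z, f z ^ 3 + a * deriv f z ^ 3 = p * cosh z) {z : ℂ} {η : ℝ} (h0 : 0 < η)
    (h1 : η ≤ 1) (hz : 2 * η ≤ |z.re|) :
    η ^ 2 * ‖f z / deriv f z‖ ≤ 13 + 98 * ‖a‖ := by
  have hre : ∀ w ∈ Metric.closedBall z η, η ≤ |w.re| := by
    intro w hw
    have := (abs_re_le_norm (z - w)).trans (mem_closedBall_iff_norm'.mp hw)
    rw [sub_re] at this
    linarith [abs_sub_abs_le_abs_sub z.re w.re]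
  have hne : ∀ w ∈ Metric.closedBall z η, w.re ≠ 0 := fun w hw =>
    abs_pos.mp (h0.trans_le (hre w hw))
  refine norm_le_of_quartic_ode (v := fun w => f w / deriv f w)
    (G := fun w => sinh w / cosh w) h0 h1 ?_ ?_ ?_
  · intro w hw
    exact ((hf w).div (hf.deriv w)
      (deriv_ne_zero_of_re_ne_zero hp hf h (hne w hw))).differentiableWithinAt
  · intro w hw
    rw [norm_div, le_div_iff₀ (norm_pos_iff.mpr (cosh_ne_zero_of_re_ne_zero (hne w hw)))]
    exact (half_mul_norm_cosh_le_norm_sinh h0 h1 (hre w hw)).1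
  · intro w hw
    exact quartic_ode_of_cubic_equation hp hf h (hne w (Metric.ball_subset_closedBall hw))

lemma exists_pow_mul_norm_quotient_le (ha : a ≠ 0) (hp : p ≠ 0) (hf : Differentiable ℂ f)
    (h : ∀ z, f z ^ 3 + a * deriv f z ^ 3 = p * cosh z) {q : ℂ → ℂ}
    (hq : ∀ z, deriv (deriv f) z = q z * deriv f z + f z / 3) :
    ∃ C : ℝ, ∀ z : ℂ, z.re ≠ 0 → min |z.re| 1 ^ 7 * ‖q z‖ ≤ C := by
  have ha0 : 0 < ‖a‖ := norm_pos_iff.mpr ha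
  set K := 13 + 98 * ‖a‖ with hK
  have hK0 : 0 < K := by positivity
  refine ⟨2 ^ 7 * ((2 * (K ^ 3 + ‖a‖) + 3 * K ^ 2 + ‖a‖ * K) / (3 * ‖a‖)), fun z hz => ?_⟩
  have hδ0 : 0 < min |z.re| 1 := lt_min (abs_pos.mpr hz) one_pos
  have hδ1 : min |z.re| 1 ≤ 1 := min_le_right _ _
  have hδz : min |z.re| 1 ≤ |z.re| := min_le_left _ _
  obtain ⟨η, hη⟩ : ∃ η, min |z.re| 1 = 2 * η := ⟨min |z.re| 1 / 2, by ring⟩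
  rw [hη] at hδ0 hδ1 hδz ⊢
  have hη0 : 0 < η := by linarith
  have hη1 : η ≤ 1 := by linarith
  have hv := sq_mul_norm_div_deriv_le hp hf h hη0 hη1 hδz
  rw [← hK] at hv
  have hG : η * ‖sinh z / cosh z‖ ≤ 2 := by
    have := (half_mul_norm_cosh_le_norm_sinh hη0 hη1 (by linarith : η ≤ |z.re|)).2
    have hc := norm_pos_iff.mpr (cosh_ne_zero_of_re_ne_zero hz)
    rw [norm_div, ← mul_div_assoc, div_le_iff₀ hc]
    linarith
  have hq' := congrArg norm (three_mul_quotient_eq hp hf h hq hz)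
  generalize sinh z / cosh z = G at hG hq'
  generalize f z / deriv f z = v at hv hq'
  have hle : 3 * ‖a‖ * ‖q z‖ ≤ ‖G‖ * (‖v‖ ^ 3 + ‖a‖) + 3 * ‖v‖ ^ 2 + ‖a‖ * ‖v‖ := by
    have h3 : ‖(3 : ℂ)‖ = 3 := by simp
    calc 3 * ‖a‖ * ‖q z‖ = ‖3 * a * q z‖ := by rw [norm_mul, norm_mul, h3]
      _ ≤ ‖G * (v ^ 3 + a)‖ + ‖3 * v ^ 2‖ + ‖a * v‖ := by
        rw [hq']
        exact (norm_sub_le _ _).trans (add_le_add_left (norm_sub_le _ _) _)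
      _ ≤ _ := by
        rw [norm_mul, norm_mul, norm_mul, norm_pow, h3, ← norm_pow v 3]
        gcongr
        exact norm_add_le _ _
  rw [mul_pow, mul_assoc]
  refine mul_le_mul_of_nonneg_left ?_ (by positivity)
  rw [le_div_iff₀ (by positivity)]
  have hvn := norm_nonneg v
  have hη' : ∀ n : ℕ, η ^ n ≤ 1 := fun n => pow_le_one₀ hη0.le hη1
  have t1 : (η * ‖G‖) * ((η ^ 2 * ‖v‖) ^ 3 + η ^ 6 * ‖a‖) ≤ 2 * (K ^ 3 + 1 * ‖a‖) := by
    gcongr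
    exact hη' 6
  have t2 : η ^ 3 * (3 * (η ^ 2 * ‖v‖) ^ 2) ≤ 1 * (3 * K ^ 2) := by
    gcongr
    exact hη' 3
  have t3 : η ^ 5 * (‖a‖ * (η ^ 2 * ‖v‖)) ≤ 1 * (‖a‖ * K) := by
    gcongr
    exact hη' 5
  have := mul_le_mul_of_nonneg_left hle (by positivity : 0 ≤ η ^ 7)
  linarith

/-- The equation `f ^ 3 + a * f' ^ 3 = p * cosh` has no entire solution. -/
lemma not_cubic_equation (ha : a ≠ 0) (hp : p ≠ 0) (hf : Differentiable ℂ f) :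
    ¬ ∀ z, f z ^ 3 + a * deriv f z ^ 3 = p * cosh z := by
  intro h
  obtain ⟨q, hqd, hq⟩ := exists_differentiable_quotient hp hf h
  obtain ⟨C, hC⟩ := exists_pow_mul_norm_quotient_le ha hp hf h hq
  refine not_linear_ode_of_cubic_equation ha hp hf h (q 0) fun z => ?_
  rw [hq z, apply_eq_apply_of_mul_pow_dist_imaginary_axis_le hqd (by norm_num) hC z 0]

end CubicEquation

theorem stmt_1 (a p₁ p₂ b : ℂ) (ha : a ≠ 0) (hp₁ : p₁ ≠ 0) (hp₂ : p₂ ≠ 0) (hb : b ≠ 0) :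
    ¬ ∃ f : ℂ → ℂ, Differentiable ℂ f ∧
      ∀ z : ℂ, f z ^ 3 + a * (deriv f z) ^ 3
        = p₁ * Complex.exp (b * z) + p₂ * Complex.exp (-b * z) := by
  rintro ⟨f, hf, h⟩
  obtain ⟨c, hc⟩ := IsAlgClosed.exists_pow_nat_eq (p₁ / p₂) two_pos
  have hc0 : c ≠ 0 := by
    rintro rfl
    exact div_ne_zero hp₁ hp₂ (by rw [← hc]; simp)
  obtain ⟨d, rfl⟩ : ∃ d, exp d = c := ⟨log c, exp_log hc0⟩
  have hg : ∀ z, HasDerivAt (fun w => f ((w - d) / b)) (deriv f ((z - d) / b) * (1 / b)) z :=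
    fun z => (hf ((z - d) / b)).hasDerivAt.comp z (((hasDerivAt_id z).sub_const d).div_const b)
  refine not_cubic_equation (a := a * b ^ 3) (p := 2 * (p₁ / exp d))
    (mul_ne_zero ha (pow_ne_zero 3 hb)) (mul_ne_zero two_ne_zero (div_ne_zero hp₁ hc0))
    (fun z => (hg z).differentiableAt) fun z => ?_
  have e1 : b * ((z - d) / b) = z - d := by field_simp
  have e2 : -b * ((z - d) / b) = d - z := by field_simp; ring
  have e3 : p₂ * exp d = p₁ / exp d := by
    rw [eq_div_iff hc0, mul_assoc, ← sq, hc]; field_simp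
  have := h ((z - d) / b)
  rw [e1, e2, exp_sub, exp_sub] at this
  rw [(hg z).deriv, cosh, exp_neg]
  calc _ = f ((z - d) / b) ^ 3 + a * deriv f ((z - d) / b) ^ 3 := by field_simp
    _ = p₁ / exp d * exp z + p₂ * exp d * (exp z)⁻¹ := by rw [this]; ring
    _ = _ := by rw [e3]; ring
end

section
/- Let a, p₁, p₂, b be nonzero complex constants. If f is an entire function satisfying f(z)⁴ + a·(f'(z))⁴ = p₁·e^{bz} + p₂·e^{−bz} for all z ∈ ℂ, then a·(b/2)⁴ = −1 and there exist complex constants k₁, k₂ with 8k₁³k₂ = p₁ and 8k₂³k₁ = p₂ such that f(z) = k₁e^{(b/2)z} + k₂e^{−(b/2)z} for all z ∈ ℂ. -/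
open Complex
open Filter Topology Metric

theorem hasDerivAt_exp_const_mul (c z : ℂ) :
    HasDerivAt (fun z => exp (c * z)) (c * exp (c * z)) z := by
  simpa [mul_comm] using ((hasDerivAt_id z).const_mul c).cexp

theorem Ultrafilter.exists_tendsto_of_norm_le {ι : Type*} (U : Ultrafilter ι) {u : ι → ℂ} {M : ℝ}
    (hu : ∀ i, ‖u i‖ ≤ M) : ∃ w, Tendsto u U (𝓝 w) := by
  obtain ⟨w, -, hw⟩ := (isCompact_closedBall (0 : ℂ) M).ultrafilter_le_nhds (U.map u) (by
    simp only [le_principal_iff]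
    exact (Filter.Eventually.of_forall fun i => by simpa using hu i :
      ∀ᶠ i in (U : Filter ι), u i ∈ closedBall (0 : ℂ) M))
  exact ⟨w, hw⟩

theorem tendstoUniformlyOn_of_lipschitzOnWith_of_bounded {ι : Type*} (U : Ultrafilter ι)
    {F : ι → ℂ → ℂ} {s : Set ℂ} (hs : IsCompact s) {B : ℝ} {L : NNReal}
    (hB : ∀ i, ∀ z ∈ s, ‖F i z‖ ≤ B) (hL : ∀ i, LipschitzOnWith L (F i) s) :
    ∃ g : ℂ → ℂ, TendstoUniformlyOn F g U s := by
  have hlim : ∀ z : ℂ, ∃ w : ℂ, z ∈ s → Tendsto (fun i => F i z) U (𝓝 w) := by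
    intro z
    by_cases hz : z ∈ s
    · exact (U.exists_tendsto_of_norm_le fun i => hB i z hz).imp fun _ hw _ => hw
    · exact ⟨0, fun h => absurd h hz⟩
  choose g hg using hlim
  refine ⟨g, ?_⟩
  have : CompactSpace s := isCompact_iff_compactSpace.mp hs
  rw [tendstoUniformlyOn_iff_tendstoUniformly_comp_coe]
  have heqc : Equicontinuous (fun i (x : s) => F i x) :=
    (LipschitzWith.uniformEquicontinuous _ L
      fun i => lipschitzOnWith_iff_restrict.mp (hL i)).equicontinuous
  have := (heqc.tendsto_uniformFun_iff_pi U (fun x : s => g x)).mpr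
    (tendsto_pi_nhds.mpr fun x => hg x x.2)
  exact UniformFun.tendsto_iff_tendstoUniformly.mp this

theorem norm_le_of_norm_deriv_le_affine {g : ℂ → ℂ} (hg : Differentiable ℂ g) {C : ℝ}
    (hC : 0 < C) (h : ∀ z ∈ closedBall (0 : ℂ) 1, ‖deriv g z‖ ≤ C * ‖g z‖ + C)
    {z : ℂ} (hz : z ∈ closedBall (0 : ℂ) 1) :
    ‖g z‖ ≤ (‖g 0‖ + 1) * Real.exp C := by
  have hz1 : ‖z‖ ≤ 1 := by simpa using hz
  have hd : ∀ t : ℝ, HasDerivAt (fun t : ℝ => g (t * z)) (deriv g (t * z) * z) t := by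
    intro t
    have h1 : HasDerivAt (fun t : ℝ => (t : ℂ) * z) z t := by
      simpa using (Complex.ofRealCLM.hasDerivAt (x := t)).mul_const z
    exact (hg _).hasDerivAt.comp t h1
  have key := norm_le_gronwallBound_of_norm_deriv_right_le (f := fun t : ℝ => g (t * z))
    (f' := fun t : ℝ => deriv g (t * z) * z) (δ := ‖g 0‖) (K := C) (ε := C) (a := 0) (b := 1)
    (fun t _ => (hd t).continuousAt.continuousWithinAt) (fun t _ => (hd t).hasDerivWithinAt)
    (by simp) (by
      intro t ht
      have htz : (t : ℂ) * z ∈ closedBall (0 : ℂ) 1 := by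
        simp only [mem_closedBall, dist_zero_right, norm_mul, norm_real, Real.norm_eq_abs,
          abs_of_nonneg ht.1]
        nlinarith [ht.1, ht.2, norm_nonneg z]
      rw [norm_mul]
      have := h _ htz
      nlinarith [norm_nonneg (deriv g (t * z)), norm_nonneg z])
    1 (by simp)
  rw [gronwallBound_of_K_ne_0 hC.ne'] at key
  simp only [ofReal_one, one_mul, sub_zero, mul_one, div_self hC.ne'] at key
  nlinarith

theorem eq_zero_of_pow_four_eventuallyEq {b P Q : ℂ} (hb : b ≠ 0) {g : ℂ → ℂ}
    (hg : ∀ᶠ z in 𝓝 (0 : ℂ), DifferentiableAt ℂ g z) (hg' : ∀ᶠ z in 𝓝 (0 : ℂ), deriv g z = 0)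
    (h : ∀ᶠ z in 𝓝 (0 : ℂ), g z ^ 4 = P * exp (b * z) + Q * exp (-b * z)) :
    g 0 = 0 ∧ P = 0 ∧ Q = 0 := by
  have h1 : ∀ᶠ z in 𝓝 (0 : ℂ), (0 : ℂ) = P * (b * exp (b * z)) + Q * (-b * exp (-b * z)) := by
    filter_upwards [h.eventually_nhds, hg, hg'] with z hz hgz hgz'
    have e1 := hgz.hasDerivAt.pow 4
    have e2 := ((hasDerivAt_exp_const_mul b z).const_mul P).add
      ((hasDerivAt_exp_const_mul (-b) z).const_mul Q)
    have := (e2.congr_of_eventuallyEq hz).unique e1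
    rw [this, hgz']; simp
  have e2 := (((hasDerivAt_exp_const_mul b 0).const_mul b).const_mul P).add
    (((hasDerivAt_exp_const_mul (-b) 0).const_mul (-b)).const_mul Q)
  have h2 := (e2.congr_of_eventuallyEq h1).unique (hasDerivAt_const (0 : ℂ) (0 : ℂ))
  have h0 := h.self_of_nhds
  have h1 := h1.self_of_nhds
  simp only [mul_zero, exp_zero, mul_one] at h0 h1 h2
  have hPQ : P - Q = 0 := by
    apply mul_left_cancel₀ hb; linear_combination -h1
  have hPQ' : P + Q = 0 := by
    apply mul_left_cancel₀ (mul_ne_zero hb hb); linear_combination h2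
  refine ⟨?_, by linear_combination (hPQ + hPQ') / 2, by linear_combination (hPQ' - hPQ) / 2⟩
  exact pow_eq_zero_iff (n := 4) (by norm_num) |>.mp (h0.trans hPQ')

/-- The quotient `(f'' - (b / 2) ^ 2 f) / f' ^ 2` extends to an entire function. -/
theorem exists_entire_quotient {a p₁ p₂ b : ℂ} (hp₁ : p₁ ≠ 0)
    (hb : b ≠ 0) {f : ℂ → ℂ} (hf : Differentiable ℂ f)
    (heq : ∀ z : ℂ, f z ^ 4 + a * (deriv f z) ^ 4 = p₁ * exp (b * z) + p₂ * exp (-b * z)) :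
    ∃ k : ℂ → ℂ, Differentiable ℂ k ∧
      ∀ z, k z * deriv f z ^ 2 = deriv (deriv f) z - (b / 2) ^ 2 * f z := by
  have hf1 : Differentiable ℂ (deriv f) := hf.deriv
  have hf2 : Differentiable ℂ (deriv (deriv f)) := hf1.deriv
  have hf3 : Differentiable ℂ (deriv (deriv (deriv f))) := hf2.deriv
  have e1 : ∀ z, 4 * f z ^ 3 * deriv f z + 4 * a * deriv f z ^ 3 * deriv (deriv f) z
      = p₁ * (b * exp (b * z)) + p₂ * (-b * exp (-b * z)) := by
    intro z
    have l := ((hf z).hasDerivAt.pow 4).add (((hf1 z).hasDerivAt.pow 4).const_mul a)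
    have r := ((hasDerivAt_exp_const_mul b z).const_mul p₁).add
      ((hasDerivAt_exp_const_mul (-b) z).const_mul p₂)
    have := (r.congr_of_eventuallyEq (Eventually.of_forall heq)).unique l
    rw [this]; push_cast; ring
  have e2 : ∀ z, 12 * f z ^ 2 * deriv f z ^ 2 + 4 * f z ^ 3 * deriv (deriv f) z
      + 12 * a * deriv f z ^ 2 * deriv (deriv f) z ^ 2
      + 4 * a * deriv f z ^ 3 * deriv (deriv (deriv f)) z
      = b ^ 2 * (f z ^ 4 + a * deriv f z ^ 4) := by
    intro z
    have l := ((((hf z).hasDerivAt.pow 3).const_mul 4).mul (hf1 z).hasDerivAt).add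
      ((((hf1 z).hasDerivAt.pow 3).const_mul (4 * a)).mul (hf2 z).hasDerivAt)
    have r := (((hasDerivAt_exp_const_mul b z).const_mul b).const_mul p₁).add
      (((hasDerivAt_exp_const_mul (-b) z).const_mul (-b)).const_mul p₂)
    have := (r.congr_of_eventuallyEq (Eventually.of_forall e1)).unique l
    simp only [Pi.pow_apply] at this
    push_cast at this
    rw [heq]
    linear_combination -this
  let T : ℂ → ℂ := fun z => (a * b ^ 2 * deriv f z ^ 2 - 12 * f z ^ 2
    - 12 * a * deriv (deriv f) z ^ 2 - 4 * a * deriv f z * deriv (deriv (deriv f)) z) / 4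
  have hT : Differentiable ℂ T := by fun_prop
  let S : ℂ → ℂ := fun z => deriv (deriv f) z - (b / 2) ^ 2 * f z
  have hS : Differentiable ℂ S := by fun_prop
  have hST : ∀ z, f z ^ 3 * S z = deriv f z ^ 2 * T z := by
    intro z
    simp only [S, T]
    linear_combination (e2 z) / 4
  have hne : ∀ z, deriv f z = 0 → f z ≠ 0 := by
    intro z h1 h0
    have E0 := heq z
    have E1 := e1 z
    simp only [h1, h0] at E0 E1
    have : 2 * b * p₁ * exp (b * z) = 0 := by linear_combination -b * E0 - E1
    simp [hb, hp₁, exp_ne_zero] at this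
  refine ⟨fun z => if deriv f z = 0 then T z / f z ^ 3 else S z / deriv f z ^ 2, ?_, ?_⟩
  · intro z
    by_cases h1 : deriv f z = 0
    · have h0 := hne z h1
      have : DifferentiableAt ℂ (fun z => T z / f z ^ 3) z :=
        (hT z).div ((hf z).pow 3) (pow_ne_zero _ h0)
      refine this.congr_of_eventuallyEq ?_
      filter_upwards [hf.continuous.continuousAt.eventually_ne h0] with w hw
      split_ifs with h
      · rfl
      · rw [div_eq_div_iff (pow_ne_zero _ h) (pow_ne_zero _ hw)]
        linear_combination hST w
    · have : DifferentiableAt ℂ (fun z => S z / deriv f z ^ 2) z :=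
        (hS z).div ((hf1 z).pow 2) (pow_ne_zero _ h1)
      refine this.congr_of_eventuallyEq ?_
      filter_upwards [hf1.continuous.continuousAt.eventually_ne h1] with w hw
      rw [if_neg hw]
  · intro z
    by_cases h1 : deriv f z = 0
    · have h := hST z
      simp only [h1] at h
      simp [hne z h1] at h
      simpa [h1, S] using h.symm
    · simp only [if_neg h1, S]
      field_simp

theorem eq_exp_add_exp_of_deriv_deriv {β : ℂ} (hβ : β ≠ 0) {f : ℂ → ℂ} (hf : Differentiable ℂ f)
    (h : ∀ z, deriv (deriv f) z = β ^ 2 * f z) :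
    ∃ k₁ k₂ : ℂ, ∀ z, f z = k₁ * exp (β * z) + k₂ * exp (-β * z) := by
  have hf1 : Differentiable ℂ (deriv f) := hf.deriv
  have key : ∀ c : ℂ, c ^ 2 = β ^ 2 → ∃ u : ℂ, ∀ z, deriv f z + c * f z = u * exp (c * z) := by
    intro c hc
    have hd : ∀ z, HasDerivAt (fun z => (deriv f z + c * f z) * exp (-c * z)) 0 z := by
      intro z
      have := ((hf1 z).hasDerivAt.add ((hf z).hasDerivAt.const_mul c)).mul
        (hasDerivAt_exp_const_mul (-c) z)
      refine this.congr_deriv ?_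
      simp only [Pi.add_apply]
      rw [h z]
      linear_combination -exp (-c * z) * f z * hc
    refine ⟨deriv f 0 + c * f 0, fun z => ?_⟩
    have := is_const_of_deriv_eq_zero (fun z => (hd z).differentiableAt) (fun z => (hd z).deriv) z 0
    simp only [mul_zero, exp_zero, mul_one] at this
    rw [← this, mul_assoc, ← exp_add]
    simp
  obtain ⟨u, hu⟩ := key β rfl
  obtain ⟨v, hv⟩ := key (-β) (by ring)
  refine ⟨u / (2 * β), -v / (2 * β), fun z => ?_⟩
  have hu := hu z
  have hv := hv z
  field_simp
  simp only [neg_mul] at hv ⊢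
  linear_combination hu - hv

theorem coeff_of_exp_solution {a p₁ p₂ b k₁ k₂ : ℂ} (hp₁ : p₁ ≠ 0) (hb : b ≠ 0) {f : ℂ → ℂ}
    (heq : ∀ z : ℂ, f z ^ 4 + a * (deriv f z) ^ 4 = p₁ * exp (b * z) + p₂ * exp (-b * z))
    (h : ∀ z, f z = k₁ * exp (b / 2 * z) + k₂ * exp (-(b / 2) * z)) :
    a * (b / 2) ^ 4 = -1 ∧ 8 * k₁ ^ 3 * k₂ = p₁ ∧ 8 * k₂ ^ 3 * k₁ = p₂ := by
  have hd : ∀ z, deriv f z = b / 2 * (k₁ * exp (b / 2 * z) - k₂ * exp (-(b / 2) * z)) := by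
    intro z
    have := ((hasDerivAt_exp_const_mul (b / 2) z).const_mul k₁).add
      ((hasDerivAt_exp_const_mul (-(b / 2)) z).const_mul k₂)
    rw [(this.congr_of_eventuallyEq (Eventually.of_forall h)).deriv]
    ring
  set m := a * (b / 2) ^ 4 with hm
  have poly : ∀ t : ℂ, t ≠ 0 → (1 + m) * k₁ ^ 4 * t ^ 4 + (4 * (1 - m) * k₁ ^ 3 * k₂ - p₁) * t ^ 3
      + 6 * (1 + m) * k₁ ^ 2 * k₂ ^ 2 * t ^ 2 + (4 * (1 - m) * k₂ ^ 3 * k₁ - p₂) * t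
      + (1 + m) * k₂ ^ 4 = 0 := by
    intro t ht
    have H := heq (log t / b)
    rw [hd, h] at H
    set X := exp (b / 2 * (log t / b)) with hX
    set Y := exp (-(b / 2) * (log t / b)) with hY
    have hXY : X * Y = 1 := by rw [hX, hY, ← exp_add]; ring_nf; simp
    have hXt : X ^ 2 = t := by
      rw [hX, ← exp_nat_mul]
      convert exp_log ht using 2
      push_cast; field_simp
    have h1 : exp (b * (log t / b)) = X ^ 2 := by
      rw [hX, ← exp_nat_mul]; congr 1; push_cast; ring
    have h2 : exp (-b * (log t / b)) = Y ^ 2 := by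
      rw [hY, ← exp_nat_mul]; congr 1; push_cast; ring
    rw [h1, h2] at H
    have hX0 : X ≠ 0 := exp_ne_zero _
    have hY' : Y = X⁻¹ := eq_inv_of_mul_eq_one_right hXY
    rw [hY'] at H
    rw [← hXt, hm]
    clear_value X
    have h3 := congrArg (fun w => X ^ 4 * w) (sub_eq_zero.mpr H)
    simp only [mul_zero] at h3
    rw [← h3]
    field_simp
    ring
  have q1 := poly 1 (by norm_num)
  have q2 := poly (-1) (by norm_num)
  have q3 := poly 2 (by norm_num)
  have q4 := poly (-2) (by norm_num)
  have q5 := poly 3 (by norm_num)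
  have c1 : 4 * (1 - m) * k₂ ^ 3 * k₁ - p₂ = 0 := by
    linear_combination (4 * (q1 - q2) - (q3 - q4) / 2) / 6
  have c3 : 4 * (1 - m) * k₁ ^ 3 * k₂ - p₁ = 0 := by
    linear_combination ((q3 - q4) / 2 - (q1 - q2)) / 6
  have c4 : (1 + m) * k₁ ^ 4 = 0 := by
    linear_combination (q1 + q2) / 48 - (q3 + q4) / 30 + (q5 - 3 * c1 - 27 * c3) / 40
  have hk₁ : k₁ ≠ 0 := by
    rintro rfl
    exact hp₁ (by linear_combination -c3)
  have hm1 : m = -1 := by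
    have := (mul_eq_zero.mp c4).resolve_right (pow_ne_zero _ hk₁)
    linear_combination this
  rw [hm1] at c1 c3
  exact ⟨hm1, by linear_combination c3, by linear_combination c1⟩

theorem norm_deriv_le_of_pow_four_eq {a b P Q : ℂ} (ha : a ≠ 0) {M C : ℝ}
    (hC : 1 + ‖a‖⁻¹ + 2 * M * Real.exp ‖b‖ * ‖a‖⁻¹ ≤ C) (hM : 0 ≤ M)
    (hP : ‖P‖ ≤ M) (hQ : ‖Q‖ ≤ M) {x y z : ℂ} (hz : z ∈ closedBall (0 : ℂ) 1)
    (h : x ^ 4 + a * y ^ 4 = P * exp (b * z) + Q * exp (-b * z)) :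
    ‖y‖ ≤ C * ‖x‖ + C := by
  have hz1 : ‖z‖ ≤ 1 := by simpa using hz
  have hexp : ∀ w : ℂ, ‖w‖ = ‖b‖ → ‖exp (w * z)‖ ≤ Real.exp ‖b‖ := by
    intro w hw
    refine (norm_exp_le_exp_norm _).trans (Real.exp_le_exp.mpr ?_)
    rw [norm_mul, hw]
    exact mul_le_of_le_one_right (norm_nonneg _) hz1
  have ha' : 0 < ‖a‖ := norm_pos_iff.mpr ha
  have hy : y ^ 4 = a⁻¹ * (P * exp (b * z) + Q * exp (-b * z) - x ^ 4) := by
    rw [eq_inv_mul_iff_mul_eq₀ ha]; linear_combination h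
  have hy' : ‖y‖ ^ 4 ≤ ‖a‖⁻¹ * (2 * M * Real.exp ‖b‖ + ‖x‖ ^ 4) := by
    rw [← norm_pow, hy, norm_mul, norm_inv]
    gcongr
    calc _ ≤ ‖P * exp (b * z)‖ + ‖Q * exp (-b * z)‖ + ‖x ^ 4‖ :=
          (norm_sub_le _ _).trans (by gcongr; exact norm_add_le _ _)
      _ ≤ M * Real.exp ‖b‖ + M * Real.exp ‖b‖ + ‖x‖ ^ 4 := by
          rw [norm_mul, norm_mul, norm_pow]
          gcongr
          · exact hexp b rfl
          · exact hexp (-b) (norm_neg b)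
      _ = _ := by ring
  have h1 : 0 ≤ ‖a‖⁻¹ := by positivity
  have h2 : 0 ≤ 2 * M * Real.exp ‖b‖ * ‖a‖⁻¹ := by positivity
  have hC1 : 1 ≤ C := by linarith
  have hC4 : C ≤ C ^ 4 := le_self_pow₀ hC1 (by norm_num)
  have hx1 : 1 + ‖x‖ ^ 4 ≤ (‖x‖ + 1) ^ 4 := by
    have := norm_nonneg x
    have : 0 ≤ 4 * ‖x‖ ^ 3 + 6 * ‖x‖ ^ 2 + 4 * ‖x‖ := by positivity
    linarith [this,
      show (‖x‖ + 1) ^ 4 = 1 + ‖x‖ ^ 4 + (4 * ‖x‖ ^ 3 + 6 * ‖x‖ ^ 2 + 4 * ‖x‖) by ring]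
  have : ‖y‖ ^ 4 ≤ (C * (‖x‖ + 1)) ^ 4 := by
    rw [mul_pow]
    calc _ ≤ _ := hy'
      _ = 2 * M * Real.exp ‖b‖ * ‖a‖⁻¹ + ‖a‖⁻¹ * ‖x‖ ^ 4 := by ring
      _ ≤ C + C * ‖x‖ ^ 4 := by gcongr <;> linarith
      _ = C * (1 + ‖x‖ ^ 4) := by ring
      _ ≤ _ := by gcongr
  have := le_of_pow_le_pow_left₀ (by norm_num) (by positivity) this
  linarith

/-- A normal-families bound: solutions `φ` of `φ ^ 4 + a φ' ^ 4 = P e ^ (b z) + Q e ^ (-b z)` with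
bounded data, bounded away from the zero solution, admit a uniform bound at the origin for every
entire function `k` with `k φ' ^ 2 = φ'' - c φ`. -/
theorem exists_bound_quotient {a b : ℂ} (ha : a ≠ 0) (hb : b ≠ 0) (c : ℂ) {M δ : ℝ} (hM : 0 ≤ M)
    (hδ : 0 < δ) :
    ∃ K : ℝ, ∀ (P Q : ℂ) (φ k : ℂ → ℂ), Differentiable ℂ φ → Differentiable ℂ k →
      (∀ z, φ z ^ 4 + a * deriv φ z ^ 4 = P * exp (b * z) + Q * exp (-b * z)) →
      ‖P‖ ≤ M → ‖Q‖ ≤ M → ‖φ 0‖ ≤ 1 → δ ≤ ‖φ 0‖ ^ 4 + ‖P‖ + ‖Q‖ →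
      (∀ z, k z * deriv φ z ^ 2 = deriv (deriv φ) z - c * φ z) → ‖k 0‖ ≤ K := by
  by_contra! hcon
  choose P Q φ k hφ hk hode hP hQ hφ0 hnd hkφ hbig using fun n : ℕ => hcon n
  set U : Ultrafilter ℕ := hyperfilter ℕ
  set C : ℝ := 1 + ‖a‖⁻¹ + 2 * M * Real.exp ‖b‖ * ‖a‖⁻¹
  have hC : 0 < C := by positivity
  have hd1 : ∀ n, ∀ z ∈ closedBall (0 : ℂ) 1, ‖deriv (φ n) z‖ ≤ C * ‖φ n z‖ + C :=
    fun n z hz => norm_deriv_le_of_pow_four_eq ha le_rfl hM (hP n) (hQ n) hz (hode n z)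
  set B : ℝ := 2 * Real.exp C
  have hB : ∀ n, ∀ z ∈ closedBall (0 : ℂ) 1, ‖φ n z‖ ≤ B := by
    intro n z hz
    refine (norm_le_of_norm_deriv_le_affine (hφ n) hC (hd1 n) hz).trans ?_
    exact mul_le_mul_of_nonneg_right (by linarith [hφ0 n]) (Real.exp_pos C).le
  have hB0 : 0 < B := by positivity
  set L : ℝ := C * B + C
  have hL0 : 0 < L := by positivity
  have hL : ∀ n, ∀ z ∈ closedBall (0 : ℂ) 1, ‖deriv (φ n) z‖ ≤ L := by
    intro n z hz
    exact (hd1 n z hz).trans (by have := mul_le_mul_of_nonneg_left (hB n z hz) hC.le; linarith)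
  obtain ⟨g, hg⟩ := tendstoUniformlyOn_of_lipschitzOnWith_of_bounded U
    (isCompact_closedBall (0 : ℂ) 1) hB (L := L.toNNReal) fun n =>
      (convex_closedBall (0 : ℂ) 1).lipschitzOnWith_of_nnnorm_deriv_le
        (fun z _ => hφ n z) fun z hz => by
          rw [← NNReal.coe_le_coe, coe_nnnorm, Real.coe_toNNReal _ hL0.le]
          exact hL n z hz
  have hloc : TendstoLocallyUniformlyOn φ g U (ball 0 1) :=
    (hg.mono ball_subset_closedBall).tendstoLocallyUniformlyOn
  have hdiff : ∀ᶠ n in (U : Filter ℕ), DifferentiableOn ℂ (φ n) (ball 0 1) :=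
    Eventually.of_forall fun n => (hφ n).differentiableOn
  have hgd : DifferentiableOn ℂ g (ball 0 1) := hloc.differentiableOn hdiff isOpen_ball
  have hloc' : TendstoLocallyUniformlyOn (deriv ∘ φ) (deriv g) U (ball 0 1) :=
    hloc.deriv hdiff isOpen_ball
  obtain ⟨P', hP'⟩ := U.exists_tendsto_of_norm_le hP
  obtain ⟨Q', hQ'⟩ := U.exists_tendsto_of_norm_le hQ
  have hgode : ∀ z ∈ ball (0 : ℂ) 1,
      g z ^ 4 + a * deriv g z ^ 4 = P' * exp (b * z) + Q' * exp (-b * z) := by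
    intro z hz
    have l := ((hloc.tendsto_at hz).pow 4).add (((hloc'.tendsto_at hz).pow 4).const_mul a)
    have r := (hP'.mul_const (exp (b * z))).add (hQ'.mul_const (exp (-b * z)))
    refine tendsto_nhds_unique l (r.congr fun n => (hode n z).symm)
  have h0mem : (0 : ℂ) ∈ ball (0 : ℂ) 1 := by simp
  have hball : ball (0 : ℂ) 1 ∈ 𝓝 (0 : ℂ) := isOpen_ball.mem_nhds h0mem
  have hnd' : δ ≤ ‖g 0‖ ^ 4 + ‖P'‖ + ‖Q'‖ :=
    ge_of_tendsto' ((((hloc.tendsto_at h0mem).norm.pow 4).add hP'.norm).add hQ'.norm) hnd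
  have hg'an : AnalyticAt ℂ (deriv g) 0 := (hgd.analyticAt hball).deriv
  rcases hg'an.eventually_eq_zero_or_eventually_ne_zero with hz | hnz
  · obtain ⟨h1, h2, h3⟩ := eq_zero_of_pow_four_eventuallyEq hb (g := g) (P := P') (Q := Q')
      (by filter_upwards [hball] with z hz
          exact hgd.differentiableAt (isOpen_ball.mem_nhds hz)) hz
      (by filter_upwards [hball, hz] with z hz hz'
          rw [← hgode z hz, hz']; simp)
    rw [h1, h2, h3] at hnd'
    simp at hnd'
    linarith
  · rw [eventually_nhdsWithin_iff, Metric.eventually_nhds_iff] at hnz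
    obtain ⟨ε, hε, hnz⟩ := hnz
    obtain ⟨r, hr0, hr⟩ : ∃ r : ℝ, 0 < r ∧ r < min ε 1 := exists_between (by positivity)
    have hr1 : r < 1 := hr.trans_le (min_le_right _ _)
    have hS : sphere (0 : ℂ) r ⊆ ball 0 1 := fun z hz => by
      rw [mem_sphere] at hz; rw [mem_ball, hz]; exact hr1
    have hne : ∀ z ∈ sphere (0 : ℂ) r, deriv g z ≠ 0 := by
      intro z hz
      rw [mem_sphere] at hz
      refine hnz (by rw [hz]; exact hr.trans_le (min_le_left _ _)) ?_
      rintro rfl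
      simp at hz
      exact hr0.ne hz
    have hcompact : IsCompact (sphere (0 : ℂ) r) := isCompact_sphere _ _
    have hcont : ContinuousOn (fun z => ‖deriv g z‖) (sphere (0 : ℂ) r) :=
      ((hgd.deriv isOpen_ball).continuousOn.mono hS).norm
    obtain ⟨z₀, hz₀, hmin⟩ := hcompact.exists_isMinOn
      (NormedSpace.sphere_nonempty.mpr hr0.le) hcont
    set η := ‖deriv g z₀‖
    have hη : 0 < η := norm_pos_iff.mpr (hne z₀ hz₀)
    have hunif : TendstoUniformlyOn (deriv ∘ φ) (deriv g) U (sphere (0 : ℂ) r) :=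
      (tendstoLocallyUniformlyOn_iff_forall_isCompact isOpen_ball).mp hloc' _ hS hcompact
    have hclose := Metric.tendstoUniformlyOn_iff.mp hunif (η / 2) (by positivity)
    set K : ℝ := (L / (1 - r) + ‖c‖ * B) / (η / 2) ^ 2
    have hlarge : ∀ᶠ n : ℕ in (U : Filter ℕ), K ≤ n :=
      Nat.hyperfilter_le_atTop (tendsto_natCast_atTop_atTop.eventually_ge_atTop K)
    obtain ⟨n, hn, hKn⟩ := (hclose.and hlarge).exists
    have hbound : ∀ z ∈ frontier (ball (0 : ℂ) r), ‖k n z‖ ≤ K := by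
      intro z hz
      rw [frontier_ball _ hr0.ne'] at hz
      have h1 : η / 2 ≤ ‖deriv (φ n) z‖ := by
        have h2 := hn z hz
        rw [dist_eq_norm] at h2
        have h3 : η ≤ ‖deriv g z‖ := hmin hz
        have h4 := norm_sub_norm_le (deriv g z) (deriv (φ n) z)
        simp only [Function.comp_apply] at h2
        linarith
      have hz1 : z ∈ closedBall (0 : ℂ) 1 := ball_subset_closedBall (hS hz)
      have h2 : ‖deriv (deriv (φ n)) z‖ ≤ L / (1 - r) := by
        refine norm_deriv_le_of_forall_mem_sphere_norm_le (by linarith)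
          (hφ n).deriv.diffContOnCl fun w hw => hL n w ?_
        rw [mem_sphere, dist_eq_norm] at hw
        rw [mem_sphere, dist_zero_right] at hz
        rw [mem_closedBall, dist_zero_right]
        have := norm_add_le (w - z) z
        rw [sub_add_cancel] at this
        linarith
      rw [le_div_iff₀ (by positivity)]
      calc ‖k n z‖ * (η / 2) ^ 2 ≤ ‖k n z‖ * ‖deriv (φ n) z‖ ^ 2 := by gcongr
        _ = ‖deriv (deriv (φ n)) z - c * φ n z‖ := by rw [← norm_pow, ← norm_mul, hkφ]
        _ ≤ ‖deriv (deriv (φ n)) z‖ + ‖c‖ * ‖φ n z‖ := by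
            rw [← norm_mul]; exact norm_sub_le _ _
        _ ≤ _ := by
            have := hB n z hz1
            gcongr
    have := norm_le_of_forall_mem_frontier_norm_le isBounded_ball (hk n).diffContOnCl hbound
      (subset_closure (mem_ball_self hr0))
    exact absurd (hbig n) (not_lt.mpr (this.trans hKn))

theorem eq_zero_of_entire_quotient {a p₁ p₂ b c : ℂ} (ha : a ≠ 0) (hp₁ : p₁ ≠ 0) (hp₂ : p₂ ≠ 0)
    (hb : b ≠ 0) {f k : ℂ → ℂ} (hf : Differentiable ℂ f) (hk : Differentiable ℂ k)
    (heq : ∀ z : ℂ, f z ^ 4 + a * (deriv f z) ^ 4 = p₁ * exp (b * z) + p₂ * exp (-b * z))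
    (hkf : ∀ z, k z * deriv f z ^ 2 = deriv (deriv f) z - c * f z) (z : ℂ) : k z = 0 := by
  set m := min ‖p₁‖ ‖p₂‖
  have hm : 0 < m := lt_min (norm_pos_iff.mpr hp₁) (norm_pos_iff.mpr hp₂)
  obtain ⟨K, hK⟩ := exists_bound_quotient ha hb c (M := ‖p₁‖ + ‖p₂‖) (δ := min 1 m / 16)
    (by positivity) (by positivity)
  have hbd : ∀ ζ, Real.exp (|(b * ζ).re| / 4) * ‖k ζ‖ ≤ K := by
    intro ζ
    set E := Real.exp (|(b * ζ).re| / 4) with hE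
    have hE0 : 0 < E := Real.exp_pos _
    have hE4 : E ^ 4 = Real.exp |(b * ζ).re| := by
      rw [hE, ← Real.exp_nat_mul]; congr 1; push_cast; ring
    set l : ℝ := ‖f ζ‖ + E
    have hl : 0 < l := by positivity
    have hl0 : (l : ℂ) ≠ 0 := by exact_mod_cast hl.ne'
    have hEl : E ≤ l := by simp [l]
    have hd : ∀ z, deriv (fun z => f (z + ζ) / l) z = deriv f (z + ζ) / l := by
      intro z
      rw [deriv_div_const, deriv_comp_add_const]
    have hd2 : ∀ z, deriv (deriv fun z => f (z + ζ) / l) z = deriv (deriv f) (z + ζ) / l := by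
      intro z
      rw [funext hd, deriv_div_const, deriv_comp_add_const]
    have hnorm : ∀ p w : ℂ, ‖p * exp w / l ^ 4‖ = ‖p‖ * Real.exp w.re / l ^ 4 := by
      intro p w
      rw [norm_div, norm_mul, norm_exp, norm_pow, norm_real, Real.norm_of_nonneg hl.le]
    have hle : ∀ p w : ℂ, w.re ≤ |(b * ζ).re| → ‖p * exp w / l ^ 4‖ ≤ ‖p‖ := by
      intro p w hw
      rw [hnorm, div_le_iff₀ (by positivity)]
      gcongr
      calc Real.exp w.re ≤ E ^ 4 := by rw [hE4]; exact Real.exp_le_exp.mpr hw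
        _ ≤ l ^ 4 := by gcongr
    have main := hK (p₁ * exp (b * ζ) / l ^ 4) (p₂ * exp (-b * ζ) / l ^ 4)
      (fun z => f (z + ζ) / l) (fun z => l * k (z + ζ)) (by fun_prop) (by fun_prop) ?_ ?_ ?_ ?_ ?_ ?_
    · simp only [zero_add, norm_mul, norm_real, Real.norm_of_nonneg hl.le] at main
      exact le_trans (by gcongr) main
    · intro z
      rw [hd]
      have := heq (z + ζ)
      rw [mul_add, mul_add, exp_add, exp_add] at this
      rw [div_pow, div_pow]
      linear_combination this / (l : ℂ) ^ 4
    · have := hle p₁ (b * ζ) (le_abs_self _)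
      linarith [norm_nonneg p₂]
    · have := hle p₂ (-b * ζ) (by rw [neg_mul, neg_re]; exact neg_le_abs _)
      linarith [norm_nonneg p₁]
    · simp only [zero_add, norm_div, norm_real, Real.norm_of_nonneg hl.le]
      rw [div_le_one hl]
      simp [l, hE0.le]
    · have hsum : ‖f ζ‖ / l + E / l = 1 := by
        rw [← add_div]; exact div_self hl.ne'
      have hPQ : m * (E / l) ^ 4 ≤
          ‖p₁ * exp (b * ζ) / l ^ 4‖ + ‖p₂ * exp (-b * ζ) / l ^ 4‖ := by
        rw [hnorm, hnorm, ← add_div, div_pow, ← mul_div_assoc, hE4, neg_mul, neg_re]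
        gcongr
        have i1 : m ≤ ‖p₁‖ := min_le_left _ _
        have i2 : m ≤ ‖p₂‖ := min_le_right _ _
        rcases abs_choice (b * ζ).re with h | h <;> rw [h]
        · exact le_add_of_le_of_nonneg (by gcongr) (by positivity)
        · exact le_add_of_nonneg_of_le (by positivity) (by gcongr)
      simp only [zero_add, norm_div, norm_real, Real.norm_of_nonneg hl.le] at hPQ ⊢
      have hfl : 0 ≤ ‖f ζ‖ / l := by positivity
      have hEl : 0 ≤ E / l := by positivity
      have j1 : min 1 m ≤ 1 := min_le_left _ _
      have j2 : min 1 m ≤ m := min_le_right _ _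
      rcases le_total (1 / 2) (E / l) with h | h
      · have : (1 / 2 : ℝ) ^ 4 ≤ (E / l) ^ 4 := by gcongr
        have : 0 ≤ (‖f ζ‖ / l) ^ 4 := by positivity
        nlinarith
      · have : (1 / 2 : ℝ) ^ 4 ≤ (‖f ζ‖ / l) ^ 4 :=
          pow_le_pow_left₀ (by norm_num) (by linarith) 4
        have : 0 ≤ m * (E / l) ^ 4 := by positivity
        nlinarith
    · intro z
      rw [hd, hd2]
      have := hkf (z + ζ)
      field_simp
      linear_combination this
  obtain ⟨κ, hκ⟩ := hk.exists_const_forall_eq_of_bounded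
    (isBounded_iff_forall_norm_le.mpr ⟨K, by
      rintro _ ⟨ζ, rfl⟩
      have h1 : 1 ≤ Real.exp (|(b * ζ).re| / 4) := Real.one_le_exp (by positivity)
      nlinarith [hbd ζ, norm_nonneg (k ζ)]⟩)
  rw [hκ]
  by_contra hκ0
  have hpos : 0 < ‖κ‖ := norm_pos_iff.mpr hκ0
  have hK0 : 0 ≤ K := le_trans (by positivity) (hbd 0)
  have h := hbd ((4 * (K / ‖κ‖) : ℝ) / b)
  rw [hκ, mul_div_cancel₀ _ hb, ofReal_re, abs_of_nonneg (by positivity),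
    mul_div_cancel_left₀ _ (by norm_num : (4 : ℝ) ≠ 0), ← le_div_iff₀ hpos] at h
  linarith [Real.add_one_le_exp (K / ‖κ‖)]

theorem stmt_2 (a p₁ p₂ b : ℂ) (ha : a ≠ 0) (hp₁ : p₁ ≠ 0) (hp₂ : p₂ ≠ 0) (hb : b ≠ 0)
    (f : ℂ → ℂ) (hf : Differentiable ℂ f)
    (heq : ∀ z : ℂ, f z ^ 4 + a * (deriv f z) ^ 4
        = p₁ * Complex.exp (b * z) + p₂ * Complex.exp (-b * z)) :
    a * (b / 2) ^ 4 = -1 ∧ ∃ k₁ k₂ : ℂ, 8 * k₁ ^ 3 * k₂ = p₁ ∧ 8 * k₂ ^ 3 * k₁ = p₂ ∧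
      ∀ z : ℂ, f z = k₁ * Complex.exp (b / 2 * z) + k₂ * Complex.exp (-(b / 2) * z) := by
  obtain ⟨k, hk, hkf⟩ := exists_entire_quotient hp₁ hb hf heq
  have hk0 := eq_zero_of_entire_quotient ha hp₁ hp₂ hb hf hk heq hkf
  obtain ⟨k₁, k₂, h⟩ := eq_exp_add_exp_of_deriv_deriv (div_ne_zero hb two_ne_zero) hf fun z => by
    have := hkf z
    rw [hk0, zero_mul] at this
    linear_combination -this
  obtain ⟨h1, h2, h3⟩ := coeff_of_exp_solution hp₁ hb heq h
  exact ⟨h1, k₁, k₂, h2, h3, h⟩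
end

section
/- Let l ≥ 1 and n > 4 be integers, and let p₁, p₂, a, a₁, a₂ be nonzero complex constants with a₁ ≠ a₂. Then there is no entire function f satisfying f(z)ⁿ + a·(f^{(l)}(z))ⁿ = p₁·e^{a₁z} + p₂·e^{a₂z} for all z ∈ ℂ. -/
open Complex

/-- An entire function with polynomial growth along circles of arbitrarily large radius is a
polynomial. -/
theorem exists_polynomial_of_circle_bound {H : ℂ → ℂ} (hH : Differentiable ℂ H) (C : ℝ) (k : ℕ)
    (h : ∀ R : ℝ, 1 ≤ R → ∃ r, R ≤ r ∧ ∀ z : ℂ, ‖z‖ = r → ‖H z‖ ≤ C * R ^ k) :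
    ∃ p : Polynomial ℂ, ∀ z, H z = p.eval z := by
  have hzero : ∀ n, k < n → iteratedDeriv n H 0 = 0 := by
    intro n hn
    have hC : 0 ≤ C := by
      obtain ⟨r, hr, hb⟩ := h 1 le_rfl
      have := hb (r : ℂ) (by simp [abs_of_nonneg (zero_le_one.trans hr)])
      simpa using (norm_nonneg _).trans this
    have hbound : ∀ R : ℝ, 1 ≤ R → ‖iteratedDeriv n H 0‖ ≤ (n.factorial * C) / R := by
      intro R hR
      have hR0 : 0 < R := by linarith
      obtain ⟨r, hr, hb⟩ := h R hR
      have hr0 : 0 < r := by linarith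
      refine (norm_iteratedDeriv_le_of_forall_mem_sphere_norm_le n hr0 hH.diffContOnCl
        (fun z hz => hb z (by simpa using hz))).trans ?_
      rw [div_le_div_iff₀ (by positivity) hR0]
      have h1 : R ^ k * R ≤ r ^ n := by
        rw [← pow_succ]
        exact (pow_le_pow_right₀ hR hn).trans (by gcongr)
      calc n.factorial * (C * R ^ k) * R = n.factorial * C * (R ^ k * R) := by ring
        _ ≤ _ := by gcongr
    have hlim : Filter.Tendsto (fun R : ℝ => (n.factorial * C) / R) Filter.atTop (nhds 0) :=
      Filter.Tendsto.const_div_atTop Filter.tendsto_id _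
    have := ge_of_tendsto hlim ((Filter.eventually_ge_atTop 1).mono hbound)
    simpa using this
  refine ⟨∑ i ∈ Finset.range (k + 1),
    Polynomial.C ((i.factorial : ℂ)⁻¹ * iteratedDeriv i H 0) * Polynomial.X ^ i, fun z => ?_⟩
  have h1 := (hasSum_taylorSeries_of_entire hH 0 z).unique
    (hasSum_sum_of_ne_finset_zero (s := Finset.range (k + 1)) (fun b hb => by
      rw [hzero b (by simpa using hb)]; simp))
  rw [h1, Polynomial.eval_finsetSum]
  refine Finset.sum_congr rfl fun i _ => ?_
  simp
  ring

/-- A nonvanishing holomorphic function on a disc has a holomorphic logarithm there. -/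
theorem exists_log_on_ball {k : ℂ → ℂ} {ρ : ℝ} (hρ : 0 < ρ) (hk : Differentiable ℂ k)
    (h0 : ∀ z ∈ Metric.ball (0 : ℂ) ρ, k z ≠ 0) :
    ∃ ψ : ℂ → ℂ, DifferentiableOn ℂ ψ (Metric.ball 0 ρ) ∧ ψ 0 = 0 ∧
      ∀ z ∈ Metric.ball (0 : ℂ) ρ, k z = k 0 * exp (ψ z) := by
  have hd : DifferentiableOn ℂ (fun z => deriv k z / k z) (Metric.ball 0 ρ) :=
    (hk.deriv.differentiableOn).div hk.differentiableOn h0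
  obtain ⟨ψ, hψ0, hψ⟩ := hd.isExactOn_ball.with_val_at 0 0
  refine ⟨ψ, fun z hz => (hψ z hz).differentiableAt.differentiableWithinAt, hψ0, ?_⟩
  have hder : ∀ z ∈ Metric.ball (0 : ℂ) ρ, HasDerivAt (fun z => k z * exp (-ψ z)) 0 z := by
    intro z hz
    have hkz := h0 z hz
    refine ((hk z).hasDerivAt.mul (hψ z hz).neg.cexp).congr_deriv ?_
    simp only [Pi.neg_apply]
    field_simp
    ring
  intro z hz
  have hc := Metric.isOpen_ball.is_const_of_deriv_eq_zero (convex_ball (0 : ℂ) ρ).isPreconnected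
    (fun z hz => (hder z hz).differentiableAt.differentiableWithinAt)
    (fun z hz => (hder z hz).deriv) hz (Metric.mem_ball_self hρ)
  simp only [hψ0, neg_zero, exp_zero, mul_one] at hc
  rw [← hc, mul_assoc, ← exp_add]
  simp

/-- A Harnack type inequality: a nonvanishing function of controlled growth on a disc of radius
`4 * R` oscillates little near points of the disc of radius `2 * R`. -/
theorem norm_le_exp_mul_norm_of_ne_zero {k : ℂ → ℂ} {R M : ℝ} (hR : 0 < R) (hM : 0 < M)
    (hk : Differentiable ℂ k) (h0 : ∀ z ∈ Metric.ball (0 : ℂ) (4 * R), k z ≠ 0)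
    (hb : ∀ z ∈ Metric.ball (0 : ℂ) (4 * R), ‖k z‖ ≤ Real.exp M * ‖k 0‖)
    {z ζ : ℂ} (hz : ‖z‖ ≤ 2 * R) (hζ : ‖ζ - z‖ < R) :
    ‖k ζ‖ ≤ Real.exp (12 * M / R * ‖ζ - z‖) * ‖k z‖ := by
  obtain ⟨ψ, hψd, hψ0, hψ⟩ := exists_log_on_ball (by positivity) hk h0
  have hk0 : 0 < ‖k 0‖ := norm_pos_iff.2 (h0 0 (Metric.mem_ball_self (by positivity)))
  have hre : Set.MapsTo ψ (Metric.ball 0 (4 * R)) {z | z.re ≤ M} := by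
    intro w hw
    have h1 := hb w hw
    rw [hψ w hw, norm_mul, norm_exp, mul_comm] at h1
    exact Real.exp_le_exp.1 (le_of_mul_le_mul_right h1 hk0)
  have hψb : ∀ w : ℂ, ‖w‖ < 3 * R → ‖ψ w‖ ≤ 6 * M := by
    intro w hw
    refine (borelCaratheodory_zero hM hψd hre (by positivity)
      (by simpa using hw.trans (by linarith)) hψ0).trans ?_
    rw [div_le_iff₀ (by linarith)]
    nlinarith
  have hsub : ∀ w ∈ Metric.ball z R, ‖w‖ < 3 * R := by
    intro w hw
    have h1 : ‖w - z‖ < R := by simpa [dist_eq_norm] using hw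
    have h2 : ‖w‖ ≤ ‖w - z‖ + ‖z‖ := by simpa using norm_add_le (w - z) z
    linarith
  have hsub' : Metric.ball z R ⊆ Metric.ball 0 (4 * R) := fun w hw => by
    have := hsub w hw
    simp
    linarith
  have hzR : z ∈ Metric.ball z R := Metric.mem_ball_self hR
  have hζR : ζ ∈ Metric.ball z R := by simpa [dist_eq_norm] using hζ
  have hS := dist_le_div_mul_dist_of_mapsTo_ball (R₂ := 12 * M) (hψd.mono hsub') (fun w hw => by
    rw [Metric.mem_closedBall, dist_eq_norm]
    have h1 := hψb w (hsub w hw)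
    have h2 := hψb z (hsub z hzR)
    linarith [norm_sub_le (ψ w) (ψ z)]) hζR
  rw [dist_eq_norm, dist_eq_norm] at hS
  have h3 : (ψ ζ).re ≤ 12 * M / R * ‖ζ - z‖ + (ψ z).re := by
    have := (re_le_norm (ψ ζ - ψ z)).trans hS
    rw [sub_re] at this
    linarith
  rw [hψ ζ (hsub' hζR), hψ z (hsub' hzR), norm_mul, norm_mul, norm_exp, norm_exp]
  calc ‖k 0‖ * Real.exp (ψ ζ).re ≤ ‖k 0‖ * Real.exp (12 * M / R * ‖ζ - z‖ + (ψ z).re) := by gcongr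
    _ = _ := by rw [Real.exp_add]; ring

/-- Growth bounds for the cofactor in a factorization of an entire function of exponential type
which splits off zeros in a disc. -/
theorem cofactor_bounds {f k : ℂ → ℂ} {A B ρ : ℝ} (hρ : 0 < ρ)
    (hf : ∀ z, ‖f z‖ ≤ A * Real.exp (B * ‖z‖)) {N : ℕ} {s : Fin N → ℂ}
    (hs : ∀ i, ‖s i‖ ≤ ρ) (hk : Differentiable ℂ k) (hfk : ∀ z, f z = (∏ i, (z - s i)) * k z) :
    Real.exp N * ‖f 0‖ ≤ A * Real.exp (8 * B * ρ) ∧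
      ∀ z, ‖z‖ ≤ 8 * ρ → ‖k z‖ * ‖f 0‖ ≤ A * Real.exp (8 * B * ρ) * ‖k 0‖ := by
  have hsph : ∀ z : ℂ, ‖z‖ = 8 * ρ → (7 * ρ) ^ N * ‖k z‖ ≤ A * Real.exp (8 * B * ρ) := by
    intro z hz
    have h1 : (7 * ρ) ^ N ≤ ‖∏ i, (z - s i)‖ := by
      rw [norm_prod]
      calc (7 * ρ) ^ N = ∏ _i : Fin N, 7 * ρ := by simp
        _ ≤ _ := Finset.prod_le_prod (fun _ _ => by positivity) (fun i _ => by
          have := norm_sub_norm_le z (s i)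
          have := hs i
          linarith)
    calc (7 * ρ) ^ N * ‖k z‖ ≤ ‖∏ i, (z - s i)‖ * ‖k z‖ := by gcongr
      _ = ‖f z‖ := by rw [hfk, norm_mul]
      _ ≤ _ := hf z
      _ = _ := by rw [hz]; ring_nf
  have hball : ∀ z : ℂ, ‖z‖ ≤ 8 * ρ → (7 * ρ) ^ N * ‖k z‖ ≤ A * Real.exp (8 * B * ρ) := by
    intro z hz
    have h1 := norm_le_of_forall_mem_frontier_norm_le (f := k) (U := Metric.ball 0 (8 * ρ))
      (C := A * Real.exp (8 * B * ρ) / (7 * ρ) ^ N) Metric.isBounded_ball hk.diffContOnCl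
      (fun w hw => by
        rw [frontier_ball _ (by positivity)] at hw
        rw [le_div_iff₀ (by positivity), mul_comm]
        exact hsph w (by simpa using hw)) (z := z) (by
          rw [closure_ball _ (by positivity)]; simpa using hz)
    rwa [le_div_iff₀ (by positivity), mul_comm] at h1
  have hf0 : ‖f 0‖ ≤ ρ ^ N * ‖k 0‖ := by
    rw [hfk, norm_mul, norm_prod]
    gcongr
    calc ∏ i, ‖0 - s i‖ ≤ ∏ _i : Fin N, ρ :=
          Finset.prod_le_prod (fun _ _ => norm_nonneg _) (fun i _ => by simpa using hs i)
      _ = _ := by simp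
  have hρN : (7 * ρ) ^ N = 7 ^ N * ρ ^ N := mul_pow _ _ _
  constructor
  · have h7 : Real.exp N ≤ 7 ^ N := by
      rw [← Real.exp_one_pow]
      gcongr
      linarith [Real.exp_one_lt_d9]
    calc Real.exp N * ‖f 0‖ ≤ 7 ^ N * (ρ ^ N * ‖k 0‖) := by gcongr
      _ = (7 * ρ) ^ N * ‖k 0‖ := by rw [hρN]; ring
      _ ≤ _ := hball 0 (by simp; positivity)
  · intro z hz
    have h1 : ρ ^ N ≤ (7 * ρ) ^ N := by gcongr; linarith
    calc ‖k z‖ * ‖f 0‖ ≤ ‖k z‖ * ((7 * ρ) ^ N * ‖k 0‖) := by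
          gcongr; exact hf0.trans (by gcongr)
      _ = ((7 * ρ) ^ N * ‖k z‖) * ‖k 0‖ := by ring
      _ ≤ _ := mul_le_mul_of_nonneg_right (hball z hz) (norm_nonneg _)

/-- An entire function of exponential type with `f 0 ≠ 0` is, for each disc, a product of linear
factors and an entire function without zeros in that disc. -/
theorem exists_factorization {f : ℂ → ℂ} {A B ρ : ℝ} (hd : Differentiable ℂ f) (hρ : 0 < ρ)
    (hf : ∀ z, ‖f z‖ ≤ A * Real.exp (B * ‖z‖)) (hf0 : f 0 ≠ 0) :
    ∃ (N : ℕ) (s : Fin N → ℂ) (k : ℂ → ℂ), (∀ i, ‖s i‖ ≤ ρ) ∧ Differentiable ℂ k ∧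
      (∀ z, f z = (∏ i, (z - s i)) * k z) ∧ ∀ z, ‖z‖ ≤ ρ → k z ≠ 0 := by
  by_contra! hcon
  have hall : ∀ N : ℕ, ∃ (s : Fin N → ℂ) (k : ℂ → ℂ), (∀ i, ‖s i‖ ≤ ρ) ∧ Differentiable ℂ k ∧
      ∀ z, f z = (∏ i, (z - s i)) * k z := by
    intro N
    induction N with
    | zero => exact ⟨Fin.elim0, f, fun i => i.elim0, hd, by simp⟩
    | succ N ih =>
      obtain ⟨s, k, hs, hk, hfk⟩ := ih
      obtain ⟨w, hw, hkw⟩ := hcon N s k hs hk hfk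
      refine ⟨Fin.cons w s, dslope k w, fun i => ?_, ?_, fun z => ?_⟩
      · refine Fin.cases ?_ ?_ i
        · simpa using hw
        · simpa using hs
      · rw [← differentiableOn_univ, differentiableOn_dslope Filter.univ_mem]
        exact hk.differentiableOn
      · have h1 := sub_smul_dslope k w z
        rw [hkw, sub_zero, smul_eq_mul] at h1
        rw [Fin.prod_univ_succ, hfk z, ← h1]
        simp
        ring
  have hf0' : 0 < ‖f 0‖ := norm_pos_iff.2 hf0
  obtain ⟨N, hN⟩ := exists_nat_gt (A * Real.exp (8 * B * ρ) / ‖f 0‖)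
  obtain ⟨s, k, hs, hk, hfk⟩ := hall N
  have h1 := (cofactor_bounds hρ hf hs hk hfk).1
  rw [div_lt_iff₀ hf0'] at hN
  have h2 : (N : ℝ) ≤ Real.exp N := by linarith [Real.add_one_le_exp (N : ℝ)]
  have h3 : (N : ℝ) * ‖f 0‖ ≤ Real.exp N * ‖f 0‖ := by gcongr
  linarith

/-- Logarithmic derivative estimate: away from few exceptional points, all derivatives of an entire
function of exponential type are polynomially bounded relative to the function. -/
theorem exists_iteratedDeriv_bound {f : ℂ → ℂ} {A B : ℝ} (hd : Differentiable ℂ f)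
    (hB : 0 ≤ B) (hf : ∀ z, ‖f z‖ ≤ A * Real.exp (B * ‖z‖)) (hf0 : f 0 ≠ 0) :
    ∃ D : ℝ, 1 ≤ D ∧ ∀ R : ℝ, 1 ≤ R → ∃ S : Finset ℂ, (S.card : ℝ) ≤ D * R ∧
      ∀ z : ℂ, ‖z‖ ≤ 2 * R → ∀ δ : ℝ, 0 < δ → δ ≤ 1 → (∀ s ∈ S, δ ≤ ‖z - s‖) →
        f z ≠ 0 ∧ ∀ j, ‖iteratedDeriv j f z‖ ≤
          j.factorial * Real.exp 7 * (2 * D * R / δ) ^ j * ‖f z‖ := by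
  classical
  have hf0' : 0 < ‖f 0‖ := norm_pos_iff.2 hf0
  have hApos : 0 < A := by
    have := hf 0
    simp only [norm_zero, mul_zero, Real.exp_zero, mul_one] at this
    linarith
  set D : ℝ := |Real.log (A / ‖f 0‖)| + 1 + 32 * B with hD
  have hD1 : 1 ≤ D := by
    have := abs_nonneg (Real.log (A / ‖f 0‖))
    linarith
  refine ⟨D, hD1, fun R hR => ?_⟩
  have hR0 : 0 < R := by linarith
  have hAD : A * Real.exp (8 * B * (4 * R)) ≤ Real.exp (D * R) * ‖f 0‖ := by
    have h1 : A = Real.exp (Real.log (A / ‖f 0‖)) * ‖f 0‖ := by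
      rw [Real.exp_log (by positivity)]
      field_simp
    have h2 : Real.log (A / ‖f 0‖) + 8 * B * (4 * R) ≤ D * R := by
      have h3 := le_abs_self (Real.log (A / ‖f 0‖))
      have h4 := abs_nonneg (Real.log (A / ‖f 0‖))
      rw [hD]
      nlinarith
    calc A * Real.exp (8 * B * (4 * R))
        = Real.exp (Real.log (A / ‖f 0‖) + 8 * B * (4 * R)) * ‖f 0‖ := by
          rw [Real.exp_add]; nth_rewrite 1 [h1]; ring
      _ ≤ _ := by gcongr
  obtain ⟨N, s, k, hs, hk, hfk, hk0⟩ :=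
    exists_factorization (ρ := 4 * R) hd (by positivity) hf hf0
  obtain ⟨hN, hkb⟩ := cofactor_bounds (by positivity) hf hs hk hfk
  have hND : (N : ℝ) ≤ D * R :=
    Real.exp_le_exp.1 (le_of_mul_le_mul_right (hN.trans hAD) hf0')
  have hkb' : ∀ z ∈ Metric.ball (0 : ℂ) (4 * R), ‖k z‖ ≤ Real.exp (D * R) * ‖k 0‖ := by
    intro z hz
    have h1 := hkb z (by
      have : ‖z‖ < 4 * R := by simpa using hz
      linarith)
    refine le_of_mul_le_mul_right (h1.trans ?_) hf0'
    calc _ ≤ Real.exp (D * R) * ‖f 0‖ * ‖k 0‖ := by gcongr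
      _ = _ := by ring
  refine ⟨Finset.univ.image s, ?_, ?_⟩
  · refine le_trans ?_ hND
    exact_mod_cast Finset.card_image_le.trans (by simp)
  · intro z hz δ hδ hδ1 hsep
    have hsep' : ∀ i, δ ≤ ‖z - s i‖ := fun i => hsep _ (by simp)
    constructor
    · rw [hfk]
      refine mul_ne_zero (Finset.prod_ne_zero_iff.2 fun i _ hi => ?_) (hk0 z (by linarith))
      have := hsep' i
      rw [hi, norm_zero] at this
      linarith
    intro j
    set ε := δ / (2 * D * R) with hε
    have hε0 : 0 < ε := by positivity
    have hDR : 1 ≤ D * R := by nlinarith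
    have hDε : D * ε * R ≤ 1 / 2 * R := by
      have : D * ε * R = δ / 2 := by rw [hε]; field_simp
      nlinarith
    have hDε' : D * ε ≤ 1 / 2 := le_of_mul_le_mul_right hDε hR0
    have hεR : ε < R := by nlinarith
    have hnear : ∀ ζ ∈ Metric.sphere z ε, ‖f ζ‖ ≤ Real.exp 7 * ‖f z‖ := by
      intro ζ hζ
      have hζ' : ‖ζ - z‖ = ε := by simpa [dist_eq_norm] using hζ
      have h1 := norm_le_exp_mul_norm_of_ne_zero hR0 (by positivity : 0 < D * R) hk
        (fun w hw => hk0 w (by simpa using (Metric.mem_ball.1 hw).le)) hkb' hz (by rwa [hζ'])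
      have h2 : Real.exp (12 * (D * R) / R * ‖ζ - z‖) ≤ Real.exp 6 := by
        apply Real.exp_le_exp.2
        rw [hζ']
        have : 12 * (D * R) / R * ε = 12 * (D * ε) := by field_simp
        linarith
      have h3 : ∏ i, ‖ζ - s i‖ ≤ Real.exp 1 * ∏ i, ‖z - s i‖ := by
        calc ∏ i, ‖ζ - s i‖ ≤ ∏ i, (Real.exp (1 / (2 * D * R)) * ‖z - s i‖) := by
              refine Finset.prod_le_prod (fun _ _ => norm_nonneg _) fun i _ => ?_
              have h4 : ‖ζ - s i‖ ≤ ‖ζ - z‖ + ‖z - s i‖ := norm_sub_le_norm_sub_add_norm_sub _ _ _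
              have h5 : ε ≤ 1 / (2 * D * R) * ‖z - s i‖ := by
                rw [hε, div_mul_eq_mul_div, one_mul]
                gcongr
                exact hsep' i
              have h6 : (1 / (2 * D * R) + 1) * ‖z - s i‖ ≤
                  Real.exp (1 / (2 * D * R)) * ‖z - s i‖ := by
                gcongr
                exact Real.add_one_le_exp _
              linarith
          _ = Real.exp (N * (1 / (2 * D * R))) * ∏ i, ‖z - s i‖ := by
              rw [Finset.prod_mul_distrib, Real.exp_nat_mul]
              simp
          _ ≤ _ := by
              gcongr
              rw [mul_one_div, div_le_one (by positivity)]
              nlinarith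
      rw [hfk ζ, hfk z, norm_mul, norm_mul, norm_prod, norm_prod]
      calc (∏ i, ‖ζ - s i‖) * ‖k ζ‖
          ≤ (Real.exp 1 * ∏ i, ‖z - s i‖) * (Real.exp 6 * ‖k z‖) := by
            gcongr
            exact h1.trans (by gcongr)
        _ = Real.exp (1 + 6) * ((∏ i, ‖z - s i‖) * ‖k z‖) := by rw [Real.exp_add]; ring
        _ = _ := by norm_num
    refine (norm_iteratedDeriv_le_of_forall_mem_sphere_norm_le j hε0 hd.diffContOnCl hnear).trans
      (le_of_eq ?_)
    have h8 : (2 * D * R / δ) = ε⁻¹ := by rw [hε, inv_div]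
    rw [h8, inv_pow]
    ring

/-- Two entire functions of exponential type have polynomially bounded logarithmic derivatives of
all orders on common circles of arbitrarily large radius. -/
theorem exists_circle_iteratedDeriv_bound {f g : ℂ → ℂ} {A B : ℝ} (hd : Differentiable ℂ f)
    (hdg : Differentiable ℂ g) (hB : 0 ≤ B)
    (hf : ∀ z, ‖f z‖ ≤ A * Real.exp (B * ‖z‖)) (hg : ∀ z, ‖g z‖ ≤ A * Real.exp (B * ‖z‖))
    (hf0 : f 0 ≠ 0) (hg0 : g 0 ≠ 0) :
    ∃ C : ℝ, 1 ≤ C ∧ ∀ R : ℝ, 1 ≤ R → ∃ r, R ≤ r ∧ ∀ z : ℂ, ‖z‖ = r → f z ≠ 0 ∧ g z ≠ 0 ∧ ∀ j,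
      ‖iteratedDeriv j f z‖ ≤ j.factorial * Real.exp 7 * (C * R ^ 2) ^ j * ‖f z‖ ∧
      ‖iteratedDeriv j g z‖ ≤ j.factorial * Real.exp 7 * (C * R ^ 2) ^ j * ‖g z‖ := by
  classical
  obtain ⟨D₁, hD₁, h₁⟩ := exists_iteratedDeriv_bound hd hB hf hf0
  obtain ⟨D₂, hD₂, h₂⟩ := exists_iteratedDeriv_bound hdg hB hg hg0
  set D := D₁ + D₂ with hD
  refine ⟨8 * D * D, by nlinarith, fun R hR => ?_⟩
  obtain ⟨S₁, hS₁, h₁⟩ := h₁ R hR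
  obtain ⟨S₂, hS₂, h₂⟩ := h₂ R hR
  set S := S₁ ∪ S₂ with hS
  set M := S.card with hM
  have hMD : (M : ℝ) ≤ D * R := by
    have : (M : ℝ) ≤ S₁.card + S₂.card := by exact_mod_cast Finset.card_union_le S₁ S₂
    rw [hD, add_mul]
    linarith
  set δ : ℝ := 1 / (2 * (M + 1)) with hδ
  have hδ0 : 0 < δ := by positivity
  have hM0 : (0 : ℝ) ≤ M := by positivity
  have hδ1 : δ ≤ 1 := by
    rw [hδ, div_le_one (by positivity)]
    linarith
  obtain ⟨i, hi, hsep⟩ : ∃ i ∈ Finset.range (M + 1), ∀ s ∈ S, δ ≤ |R + i * (2 * δ) - ‖s‖| := by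
    by_contra! hcon
    choose! u huS hu using hcon
    obtain ⟨x, hx, y, hy, hxy, he⟩ := Finset.exists_ne_map_eq_of_card_lt_of_maps_to
      (s := Finset.range (M + 1)) (t := S) (f := u) (by simp [hM]) (fun i hi => huS i hi)
    have h3 := hu x hx
    have h4 := hu y hy
    rw [he] at h3
    have h5 : |((x : ℝ) - y)| * (2 * δ) < 2 * δ := by
      rw [← abs_of_pos (by positivity : 0 < 2 * δ), ← abs_mul, abs_of_pos (by positivity : 0 < 2 * δ)]
      rw [abs_lt] at *
      constructor <;> linarith
    have h6 : (1 : ℝ) ≤ |((x : ℝ) - y)| := by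
      have : (1 : ℤ) ≤ |((x : ℤ) - y)| := Int.one_le_abs (by omega)
      exact_mod_cast this
    nlinarith
  have hiM : (i : ℝ) ≤ M := by
    have := Finset.mem_range.1 hi
    exact_mod_cast Nat.lt_succ_iff.1 this
  have hδM : (M : ℝ) * (2 * δ) ≤ 1 := by
    rw [hδ]
    rw [show (M : ℝ) * (2 * (1 / (2 * (M + 1)))) = M / (M + 1) by field_simp]
    rw [div_le_one (by positivity)]
    linarith
  refine ⟨R + i * (2 * δ), by nlinarith, fun z hz => ?_⟩
  have hz2 : ‖z‖ ≤ 2 * R := by rw [hz]; nlinarith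
  have hsepz : ∀ s ∈ S, δ ≤ ‖z - s‖ := fun s hs =>
    (hsep s hs).trans (by rw [← hz]; exact abs_norm_sub_norm_le _ _)
  obtain ⟨hfz, hfj⟩ := h₁ z hz2 δ hδ0 hδ1 fun s hs => hsepz s (Finset.mem_union_left _ hs)
  obtain ⟨hgz, hgj⟩ := h₂ z hz2 δ hδ0 hδ1 fun s hs => hsepz s (Finset.mem_union_right _ hs)
  have hδi : 1 / δ ≤ 4 * D * R := by
    rw [hδ, one_div_one_div]
    nlinarith
  have hbd : ∀ E : ℝ, 1 ≤ E → E ≤ D → 2 * E * R / δ ≤ 8 * D * D * R ^ 2 := by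
    intro E hE hED
    calc 2 * E * R / δ = 2 * E * R * (1 / δ) := by ring
      _ ≤ 2 * D * R * (4 * D * R) := by gcongr
      _ = _ := by ring
  refine ⟨hfz, hgz, fun j => ⟨(hfj j).trans ?_, (hgj j).trans ?_⟩⟩
  · gcongr
    exact hbd D₁ hD₁ (by linarith)
  · gcongr
    exact hbd D₂ hD₂ (by linarith)

/-- If some derivative of an entire function is dominated by the function up to an exponential,
then the function has exponential type. -/
theorem exists_exp_bound_of_iteratedDeriv_le {f : ℂ → ℂ} (hd : Differentiable ℂ f) {l : ℕ}
    (hl : 1 ≤ l) {C b : ℝ} (hC : 1 ≤ C) (hb : 0 ≤ b)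
    (h : ∀ z, ‖iteratedDeriv l f z‖ ≤ C * (‖f z‖ + Real.exp (b * ‖z‖))) :
    ∃ A : ℝ, 0 ≤ A ∧ ∀ z, ‖f z‖ ≤ A * Real.exp ((b + C) * ‖z‖) := by
  set U₀ : Fin l → ℂ := fun j => iteratedDeriv j f 0 with hU₀
  refine ⟨‖U₀‖ + 1, by positivity, fun z => ?_⟩
  obtain ⟨w, hw, hzw⟩ : ∃ w : ℂ, ‖w‖ = 1 ∧ z = (‖z‖ : ℂ) * w := by
    rcases eq_or_ne z 0 with rfl | hz
    · exact ⟨1, by simp, by simp⟩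
    · have : (‖z‖ : ℂ) ≠ 0 := by simpa using hz
      exact ⟨z / ‖z‖, by simp [hz], by field_simp⟩
  set T := ‖z‖ with hT
  have hT0 : 0 ≤ T := norm_nonneg z
  let U : ℝ → Fin l → ℂ := fun t j => iteratedDeriv j f (t * w)
  let U' : ℝ → Fin l → ℂ := fun t j => iteratedDeriv (j + 1) f (t * w) * w
  have hU : ∀ t, HasDerivAt U (U' t) t := by
    intro t
    rw [hasDerivAt_pi]
    intro j
    have h1 : HasDerivAt (fun t : ℝ => (t : ℂ) * w) w t := by
      simpa using (HasDerivAt.ofReal_comp (hasDerivAt_id t)).mul_const w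
    have h2 : HasDerivAt (iteratedDeriv j f) (iteratedDeriv (j + 1) f (t * w)) (t * w) := by
      rw [iteratedDeriv_succ]
      exact ((hd.contDiff (n := ⊤)).differentiable_iteratedDeriv j (by exact_mod_cast WithTop.coe_lt_top _) _).hasDerivAt
    exact h2.comp t h1
  have hbound : ∀ t ∈ Set.Ico 0 T, ‖U' t‖ ≤ C * ‖U t‖ + C * Real.exp (b * T) := by
    intro t ht
    refine (pi_norm_le_iff_of_nonneg (by positivity)).2 fun j => ?_
    have hnt : ‖(t : ℂ) * w‖ = t := by simp [hw, abs_of_nonneg ht.1]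
    have hcomp : ∀ i : Fin l, ‖iteratedDeriv i f (t * w)‖ ≤ ‖U t‖ := fun i => norm_le_pi_norm (U t) i
    have hU0 : ‖f (t * w)‖ ≤ ‖U t‖ := by simpa using hcomp ⟨0, hl⟩
    have hE : 0 < Real.exp (b * T) := Real.exp_pos _
    simp only [U', norm_mul, hw, mul_one]
    rcases Nat.lt_or_ge (j + 1) l with hj | hj
    · have := hcomp ⟨j + 1, hj⟩
      simp only at this
      nlinarith [norm_nonneg (U t)]
    · have hjl : (j : ℕ) + 1 = l := le_antisymm j.2 hj
      rw [hjl, ← mul_add]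
      refine (h _).trans ?_
      rw [hnt]
      gcongr
      exact ht.2.le
  have hG := norm_le_gronwallBound_of_norm_deriv_right_le (f := U) (f' := U') (δ := ‖U₀‖) (a := 0)
    (b := T) (fun t _ => (hU t).continuousAt.continuousWithinAt)
    (fun t _ => (hU t).hasDerivWithinAt) (by simp [U, hU₀]) hbound T ⟨hT0, le_rfl⟩
  rw [gronwallBound_of_K_ne_0 (by positivity), sub_zero, mul_div_cancel_left₀ _ (by positivity)] at hG
  have h0 : ‖f z‖ ≤ ‖U T‖ := by
    have := norm_le_pi_norm (U T) ⟨0, hl⟩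
    simpa [U, ← hzw] using this
  have h3 : Real.exp (C * T) ≤ Real.exp ((b + C) * T) := by
    apply Real.exp_le_exp.2
    nlinarith
  have h4 : Real.exp ((b + C) * T) = Real.exp (b * T) * Real.exp (C * T) := by
    rw [← Real.exp_add]; ring_nf
  have h5 : 0 < Real.exp (b * T) := Real.exp_pos _
  calc ‖f z‖ ≤ ‖U₀‖ * Real.exp (C * T) + Real.exp (b * T) * (Real.exp (C * T) - 1) := h0.trans hG
    _ ≤ ‖U₀‖ * Real.exp ((b + C) * T) + Real.exp ((b + C) * T) := by
      rw [mul_sub, ← h4]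
      have : ‖U₀‖ * Real.exp (C * T) ≤ ‖U₀‖ * Real.exp ((b + C) * T) := by gcongr
      linarith
    _ = _ := by ring

/-- An entire solution of the binomial equation has exponential type, together with the derivative
that occurs in the equation. -/
theorem exists_exp_bound_of_binomial {f : ℂ → ℂ} (hd : Differentiable ℂ f) {l n : ℕ}
    (hl : 1 ≤ l) (hn : n ≠ 0) {p₁ p₂ a a₁ a₂ : ℂ} (ha : a ≠ 0)
    (heq : ∀ z, f z ^ n + a * (iteratedDeriv l f z) ^ n
      = p₁ * exp (a₁ * z) + p₂ * exp (a₂ * z)) :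
    ∃ A B : ℝ, 0 ≤ B ∧ (∀ z, ‖f z‖ ≤ A * Real.exp (B * ‖z‖)) ∧
      ∀ z, ‖iteratedDeriv l f z‖ ≤ A * Real.exp (B * ‖z‖) := by
  set b : ℝ := ‖a₁‖ + ‖a₂‖ with hb
  set P : ℝ := 1 + ‖p₁‖ + ‖p₂‖ with hP
  set c : ℝ := 1 + ‖a‖⁻¹ with hc
  have hP1 : 1 ≤ P := by rw [hP]; linarith [norm_nonneg p₁, norm_nonneg p₂]
  have hc1 : 1 ≤ c := by rw [hc]; linarith [inv_nonneg.2 (norm_nonneg a)]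
  have ha' : 0 < ‖a‖ := norm_pos_iff.2 ha
  have hb0 : 0 ≤ b := by positivity
  have hexp : ∀ (α z : ℂ), ‖α‖ ≤ b → ‖exp (α * z)‖ ≤ Real.exp (b * ‖z‖) := by
    intro α z hα
    rw [norm_exp]
    apply Real.exp_le_exp.2
    calc (α * z).re ≤ ‖α * z‖ := re_le_norm _
      _ = ‖α‖ * ‖z‖ := norm_mul _ _
      _ ≤ _ := by gcongr
  have hg : ∀ z, ‖iteratedDeriv l f z‖ ≤ (c * P) * (‖f z‖ + Real.exp (b * ‖z‖)) := by
    intro z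
    set E := Real.exp (b * ‖z‖) with hE
    have hE1 : 1 ≤ E := Real.one_le_exp (by positivity)
    have h1 : ‖p₁ * exp (a₁ * z) + p₂ * exp (a₂ * z)‖ ≤ P * E := by
      calc _ ≤ ‖p₁‖ * ‖exp (a₁ * z)‖ + ‖p₂‖ * ‖exp (a₂ * z)‖ := by
            simpa using norm_add_le (p₁ * exp (a₁ * z)) (p₂ * exp (a₂ * z))
        _ ≤ ‖p₁‖ * E + ‖p₂‖ * E := by
            gcongr
            · exact hexp _ _ (by rw [hb]; linarith [norm_nonneg a₂])
            · exact hexp _ _ (by rw [hb]; linarith [norm_nonneg a₁])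
        _ ≤ _ := by rw [hP]; nlinarith
    have h2 : ‖a‖ * ‖iteratedDeriv l f z‖ ^ n ≤ ‖f z‖ ^ n + (P * E) ^ n := by
      have h3 : a * iteratedDeriv l f z ^ n =
          (p₁ * exp (a₁ * z) + p₂ * exp (a₂ * z)) - f z ^ n := by rw [← heq z]; ring
      have h4 : P * E ≤ (P * E) ^ n := le_self_pow₀ (by nlinarith) hn
      calc ‖a‖ * ‖iteratedDeriv l f z‖ ^ n = ‖a * iteratedDeriv l f z ^ n‖ := by simp
        _ ≤ ‖p₁ * exp (a₁ * z) + p₂ * exp (a₂ * z)‖ + ‖f z ^ n‖ := by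
          rw [h3]; exact norm_sub_le _ _
        _ ≤ _ := by rw [norm_pow]; linarith
    have h5 : ‖iteratedDeriv l f z‖ ^ n ≤ (c * (‖f z‖ + P * E)) ^ n := by
      have h6 : ‖f z‖ ^ n + (P * E) ^ n ≤ (‖f z‖ + P * E) ^ n :=
        pow_add_pow_le (by positivity) (by positivity) hn
      have h7 : ‖a‖⁻¹ ≤ c ^ n := by
        have : c ≤ c ^ n := le_self_pow₀ hc1 hn
        linarith
      calc ‖iteratedDeriv l f z‖ ^ n = ‖a‖⁻¹ * (‖a‖ * ‖iteratedDeriv l f z‖ ^ n) := by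
            field_simp
        _ ≤ c ^ n * (‖f z‖ + P * E) ^ n := by
            gcongr
            exact h2.trans h6
        _ = _ := (mul_pow _ _ _).symm
    have h8 := le_of_pow_le_pow_left₀ hn (by positivity) h5
    refine h8.trans ?_
    rw [mul_assoc]
    gcongr
    nlinarith [norm_nonneg (f z)]
  have hcP : 1 ≤ c * P := by nlinarith
  obtain ⟨A, hA, hf⟩ := exists_exp_bound_of_iteratedDeriv_le hd hl hcP hb0 hg
  set B := b + c * P with hB
  have hB0 : 0 ≤ B := by positivity
  refine ⟨(c * P) * (A + 1), B, hB0, fun z => (hf z).trans ?_, fun z => (hg z).trans ?_⟩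
  · gcongr
    nlinarith
  · rw [mul_assoc (c * P)]
    gcongr
    have : Real.exp (b * ‖z‖) ≤ Real.exp (B * ‖z‖) := by
      gcongr
      rw [hB]; linarith
    linarith [hf z]

/-- If a product of two entire functions vanishes identically, so does one of the factors. -/
theorem entire_eq_zero_or_eq_zero_of_mul_eq_zero {u v : ℂ → ℂ} (hu : Differentiable ℂ u)
    (hv : Differentiable ℂ v) (h : ∀ z, u z * v z = 0) : (∀ z, u z = 0) ∨ ∀ z, v z = 0 := by
  have := AnalyticOnNhd.eq_zero_or_eq_zero_of_mul_eq_zero (U := Set.univ)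
    (fun z _ => hu.analyticAt z) (fun z _ => hv.analyticAt z) (fun z _ => h z) isPreconnected_univ
  simpa using this

/-- The coefficient of `u ^ (n - 2)` when the differential operator `(D - α) (D - β)` is applied to
`u ^ n`. -/
noncomputable def powOperator (n : ℕ) (α β : ℂ) (u : ℂ → ℂ) (z : ℂ) : ℂ :=
  n * (n - 1) * deriv u z ^ 2 + n * u z * iteratedDeriv 2 u z - (α + β) * n * u z * deriv u z
    + α * β * u z ^ 2

theorem hasDerivAt_deriv_of_entire {u : ℂ → ℂ} (hu : Differentiable ℂ u) (z : ℂ) :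
    HasDerivAt (deriv u) (iteratedDeriv 2 u z) z := by
  rw [iteratedDeriv_succ, iteratedDeriv_one]
  exact (hu.deriv z).hasDerivAt

theorem differentiable_powOperator (n : ℕ) (α β : ℂ) {u : ℂ → ℂ} (hu : Differentiable ℂ u) :
    Differentiable ℂ (powOperator n α β u) := by
  have h1 := hu.deriv
  have h2 : Differentiable ℂ (iteratedDeriv 2 u) := by
    rw [iteratedDeriv_succ, iteratedDeriv_one]
    exact h1.deriv
  unfold powOperator
  fun_prop

theorem hasDerivAt_pow_entire {u : ℂ → ℂ} (hu : Differentiable ℂ u) (m : ℕ) (z : ℂ) :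
    HasDerivAt (fun z => u z ^ (m + 2)) ((m + 2 : ℂ) * u z ^ (m + 1) * deriv u z) z := by
  simpa using (hu z).hasDerivAt.fun_pow (m + 2)

theorem hasDerivAt_deriv_pow_entire {u : ℂ → ℂ} (hu : Differentiable ℂ u) (m : ℕ) (z : ℂ) :
    HasDerivAt (fun z => (m + 2 : ℂ) * u z ^ (m + 1) * deriv u z)
      (u z ^ m * ((m + 2 : ℂ) * (m + 1) * deriv u z ^ 2 + (m + 2) * u z * iteratedDeriv 2 u z)) z := by
  refine ((((hu z).hasDerivAt.fun_pow (m + 1)).const_mul (m + 2 : ℂ)).mul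
    (hasDerivAt_deriv_of_entire hu z)).congr_deriv ?_
  simp
  ring

theorem hasDerivAt_const_mul_exp (p α z : ℂ) :
    HasDerivAt (fun z => p * exp (α * z)) (p * exp (α * z) * α) z := by
  have h := ((hasDerivAt_id z).const_mul α).cexp.const_mul p
  refine h.congr_deriv ?_
  simp
  ring

theorem eq_const_mul_exp {u : ℂ → ℂ} {α : ℂ} (h : ∀ z, HasDerivAt u (α * u z) z) (z : ℂ) :
    u z = u 0 * exp (α * z) := by
  have hder : ∀ z, HasDerivAt (fun z => u z * exp (-α * z)) 0 z := by
    intro z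
    refine ((h z).mul (((hasDerivAt_id z).const_mul (-α)).cexp)).congr_deriv ?_
    simp
    ring
  have hc := is_const_of_deriv_eq_zero (fun z => (hder z).differentiableAt)
    (fun z => (hder z).deriv) z 0
  simp only [mul_zero, exp_zero, mul_one] at hc
  rw [← hc, mul_assoc, ← exp_add]
  simp

theorem infinite_zeros_exp_add_exp {p₁ p₂ a₁ a₂ : ℂ} (hp₁ : p₁ ≠ 0) (hp₂ : p₂ ≠ 0)
    (h : a₁ ≠ a₂) : {z : ℂ | p₁ * exp (a₁ * z) + p₂ * exp (a₂ * z) = 0}.Infinite := by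
  have hs : a₁ - a₂ ≠ 0 := sub_ne_zero.2 h
  refine Set.infinite_of_injective_forall_mem
    (f := fun k : ℤ => (log (-p₂ / p₁) + k * (2 * Real.pi * I)) / (a₁ - a₂)) ?_ ?_
  · intro i j hij
    have h2 := mul_right_cancel₀ two_pi_I_ne_zero (add_left_cancel ((div_left_inj' hs).1 hij))
    exact_mod_cast h2
  · intro k
    set z := (log (-p₂ / p₁) + k * (2 * Real.pi * I)) / (a₁ - a₂) with hz
    have h1 : a₁ * z = (log (-p₂ / p₁) + k * (2 * Real.pi * I)) + a₂ * z := by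
      rw [hz]; field_simp; ring
    have h2 : exp (a₁ * z) = -p₂ / p₁ * exp (a₂ * z) := by
      rw [h1, exp_add, exp_add, exp_log (by simp [hp₁, hp₂]), exp_int_mul_two_pi_mul_I, mul_one]
    show p₁ * exp (a₁ * z) + p₂ * exp (a₂ * z) = 0
    rw [h2]
    field_simp
    ring

/-- Entire functions some power of which is annihilated by `(D - α) (D - β)` are exponentials. -/
theorem deriv_eq_of_powOperator_eq_zero {u : ℂ → ℂ} (hu : Differentiable ℂ u) {m : ℕ} {α β : ℂ}
    (hαβ : α ≠ β) (hu0 : ¬ ∀ z, u z = 0) (hP : ∀ z, powOperator (m + 2) α β u z = 0) :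
    ∃ c : ℂ, ∀ z, deriv u z = c * u z := by
  have hm : (m + 2 : ℂ) ≠ 0 := by exact_mod_cast (by omega : m + 2 ≠ 0)
  let F : ℂ → ℂ := fun z => u z ^ (m + 2)
  let F' : ℂ → ℂ := fun z => (m + 2 : ℂ) * u z ^ (m + 1) * deriv u z
  have hF := hasDerivAt_pow_entire hu m
  have hF' := hasDerivAt_deriv_pow_entire hu m
  have hD : ∀ γ δ : ℂ, γ + δ = α + β → γ * δ = α * β → ∀ z,
      F' z - γ * F z = (F' 0 - γ * F 0) * exp (δ * z) := by
    intro γ δ h1 h2 z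
    refine eq_const_mul_exp (u := fun z => F' z - γ * F z) (fun z => ?_) z
    refine ((hF' z).sub ((hF z).const_mul γ)).congr_deriv ?_
    have h := hP z
    simp only [powOperator, ← h1, ← h2] at h
    push_cast at h
    simp only [F, F']
    linear_combination (u z ^ m) * h
  have hα := hD α β rfl rfl
  have hβ := hD β α (add_comm _ _) (mul_comm _ _)
  have hend : ∀ γ : ℂ, (∀ z, F' z - γ * F z = 0) →
      ∃ c : ℂ, ∀ z, deriv u z = c * u z := by
    intro γ h
    have hd : Differentiable ℂ (fun z => (m + 2 : ℂ) * deriv u z - γ * u z) := by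
      have := hu.deriv
      fun_prop
    rcases entire_eq_zero_or_eq_zero_of_mul_eq_zero (hu.pow (m + 1)) hd (fun z => by
      have := h z
      simp only [F, F'] at this
      simp only [Pi.pow_apply]
      linear_combination this) with h1 | h1
    · exact absurd (fun z => eq_zero_of_pow_eq_zero (h1 z)) hu0
    · exact ⟨γ / (m + 2), fun z => by
        field_simp
        linear_combination h1 z⟩
  by_cases hc : F' 0 - α * F 0 = 0
  · exact hend α fun z => by rw [hα, hc, zero_mul]
  by_cases hd : F' 0 - β * F 0 = 0
  · exact hend β fun z => by rw [hβ, hd, zero_mul]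
  exfalso
  obtain ⟨z, hz⟩ := (infinite_zeros_exp_add_exp hc (neg_ne_zero.2 hd) hαβ.symm).nonempty
  have hz : (F' 0 - α * F 0) * exp (β * z) + -(F' 0 - β * F 0) * exp (α * z) = 0 := hz
  have h0 : F z = 0 := by
    have h1 : (β - α) * F z = 0 := by
      linear_combination hα z - hβ z + hz
    exact (mul_eq_zero.1 h1).resolve_left (sub_ne_zero.2 hαβ.symm)
  have hu0 : u z = 0 := eq_zero_of_pow_eq_zero h0
  refine mul_ne_zero hc (exp_ne_zero (β * z)) ?_
  rw [← hα z]
  simp [F, F', hu0]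

theorem iteratedDeriv_eq_of_deriv_eq {u : ℂ → ℂ} {c : ℂ}
    (h : ∀ z, deriv u z = c * u z) (l : ℕ) (z : ℂ) : iteratedDeriv l u z = c ^ l * u z := by
  induction l generalizing z with
  | zero => simp
  | succ l ih =>
    rw [iteratedDeriv_succ, funext ih, deriv_const_mul_field, h]
    ring

section Binomial

variable {f g : ℂ → ℂ} {m : ℕ} {p₁ p₂ a a₁ a₂ : ℂ}

theorem binomial_deriv (hf : Differentiable ℂ f) (hg : Differentiable ℂ g)
    (heq : ∀ z, f z ^ (m + 2) + a * g z ^ (m + 2) = p₁ * exp (a₁ * z) + p₂ * exp (a₂ * z))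
    (z : ℂ) :
    (m + 2 : ℂ) * f z ^ (m + 1) * deriv f z + a * ((m + 2 : ℂ) * g z ^ (m + 1) * deriv g z) =
      p₁ * exp (a₁ * z) * a₁ + p₂ * exp (a₂ * z) * a₂ := by
  have h1 := (hasDerivAt_pow_entire hf m z).fun_add ((hasDerivAt_pow_entire hg m z).const_mul a)
  rw [funext heq] at h1
  exact h1.unique ((hasDerivAt_const_mul_exp p₁ a₁ z).fun_add (hasDerivAt_const_mul_exp p₂ a₂ z))

theorem binomial_powOperator (hf : Differentiable ℂ f) (hg : Differentiable ℂ g)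
    (heq : ∀ z, f z ^ (m + 2) + a * g z ^ (m + 2) = p₁ * exp (a₁ * z) + p₂ * exp (a₂ * z))
    (z : ℂ) :
    f z ^ m * powOperator (m + 2) a₁ a₂ f z + a * (g z ^ m * powOperator (m + 2) a₁ a₂ g z) = 0 := by
  have h1 := (hasDerivAt_deriv_pow_entire hf m z).fun_add
    ((hasDerivAt_deriv_pow_entire hg m z).const_mul a)
  rw [funext (binomial_deriv hf hg heq)] at h1
  have h2 := h1.unique (((hasDerivAt_const_mul_exp p₁ a₁ z).mul_const a₁).fun_add
    ((hasDerivAt_const_mul_exp p₂ a₂ z).mul_const a₂))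
  simp only [powOperator]
  push_cast
  linear_combination h2 - (a₁ + a₂) * binomial_deriv hf hg heq z + a₁ * a₂ * heq z

theorem exp_add_exp_simple (hp₁ : p₁ ≠ 0) (ha₁₂ : a₁ ≠ a₂) {z : ℂ}
    (h0 : p₁ * exp (a₁ * z) + p₂ * exp (a₂ * z) = 0)
    (h1 : p₁ * exp (a₁ * z) * a₁ + p₂ * exp (a₂ * z) * a₂ = 0) : False := by
  refine mul_ne_zero (mul_ne_zero hp₁ (exp_ne_zero (a₁ * z))) (sub_ne_zero.2 ha₁₂) ?_
  linear_combination h1 - a₂ * h0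

theorem binomial_no_common_zero (hf : Differentiable ℂ f) (hg : Differentiable ℂ g)
    (hp₁ : p₁ ≠ 0) (ha₁₂ : a₁ ≠ a₂)
    (heq : ∀ z, f z ^ (m + 2) + a * g z ^ (m + 2) = p₁ * exp (a₁ * z) + p₂ * exp (a₂ * z))
    {z : ℂ} (hfz : f z = 0) (hgz : g z = 0) : False := by
  refine exp_add_exp_simple (z := z) (p₂ := p₂) hp₁ ha₁₂ ?_ ?_
  · rw [← heq]; simp [hfz, hgz]
  · rw [← binomial_deriv hf hg heq]; simp [hfz, hgz]

theorem binomial_not_proportional (hf : Differentiable ℂ f) (hg : Differentiable ℂ g)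
    (hp₁ : p₁ ≠ 0) (hp₂ : p₂ ≠ 0) (ha₁₂ : a₁ ≠ a₂)
    (heq : ∀ z, f z ^ (m + 2) + a * g z ^ (m + 2) = p₁ * exp (a₁ * z) + p₂ * exp (a₂ * z))
    {c : ℂ} (hc : ∀ z, g z = c * f z) : False := by
  obtain ⟨z, hz⟩ := (infinite_zeros_exp_add_exp hp₁ hp₂ ha₁₂).nonempty
  have hz : p₁ * exp (a₁ * z) + p₂ * exp (a₂ * z) = 0 := hz
  have h1 : (1 + a * c ^ (m + 2)) * f z ^ (m + 2) = 0 := by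
    rw [← hz, ← heq, hc]; ring
  rcases mul_eq_zero.1 h1 with h2 | h2
  · refine exp_add_exp_simple (z := z) hp₁ ha₁₂ hz ?_
    have h3 : deriv g z = c * deriv f z := by rw [funext hc, deriv_const_mul_field]
    rw [← binomial_deriv hf hg heq, h3, hc]
    linear_combination ((m + 2 : ℂ) * f z ^ (m + 1) * deriv f z) * h2
  · have h3 : f z = 0 := eq_zero_of_pow_eq_zero h2
    exact binomial_no_common_zero hf hg hp₁ ha₁₂ heq h3 (by rw [hc, h3, mul_zero])

/-- Since `f` and `g` have no common zeros, `g ^ m` divides the operator applied to `f`, and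
`f ^ m` divides the operator applied to `g`, with the same quotient up to a constant. -/
theorem exists_binomial_quotient (hf : Differentiable ℂ f) (hg : Differentiable ℂ g)
    (hp₁ : p₁ ≠ 0) (ha₁₂ : a₁ ≠ a₂)
    (heq : ∀ z, f z ^ (m + 2) + a * g z ^ (m + 2) = p₁ * exp (a₁ * z) + p₂ * exp (a₂ * z)) :
    ∃ h : ℂ → ℂ, Differentiable ℂ h ∧ (∀ z, powOperator (m + 2) a₁ a₂ f z = g z ^ m * h z) ∧
      ∀ z, a * powOperator (m + 2) a₁ a₂ g z = -(f z ^ m * h z) := by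
  classical
  have key := binomial_powOperator hf hg heq
  have hPf := differentiable_powOperator (m + 2) a₁ a₂ hf
  have hPg := differentiable_powOperator (m + 2) a₁ a₂ hg
  set Pf := powOperator (m + 2) a₁ a₂ f
  set Pg := powOperator (m + 2) a₁ a₂ g
  let h : ℂ → ℂ := fun z => if g z ≠ 0 then Pf z / g z ^ m else -(a * Pg z) / f z ^ m
  have h_of_g : ∀ z, g z ≠ 0 → h z = Pf z / g z ^ m := fun z hz => if_pos hz
  have h_of_f : ∀ z, f z ≠ 0 → h z = -(a * Pg z) / f z ^ m := by
    intro z hz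
    by_cases hgz : g z = 0
    · exact if_neg (by simpa using hgz)
    · rw [h_of_g z hgz, div_eq_div_iff (pow_ne_zero _ hgz) (pow_ne_zero _ hz)]
      linear_combination key z
  have hone : ∀ z, g z = 0 → f z ≠ 0 := fun z hgz hfz =>
    binomial_no_common_zero hf hg hp₁ ha₁₂ heq hfz hgz
  refine ⟨h, fun z => ?_, fun z => ?_, fun z => ?_⟩
  · by_cases hgz : g z = 0
    · have hfz := hone z hgz
      have hev : h =ᶠ[nhds z] fun z => -(a * Pg z) / f z ^ m :=
        (hf.continuous.continuousAt.eventually_ne hfz).mono h_of_f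
      refine DifferentiableAt.congr_of_eventuallyEq ?_ hev
      exact ((hPg z).const_mul a).neg.div ((hf z).pow m) (pow_ne_zero _ hfz)
    · have hev : h =ᶠ[nhds z] fun z => Pf z / g z ^ m :=
        (hg.continuous.continuousAt.eventually_ne hgz).mono h_of_g
      refine DifferentiableAt.congr_of_eventuallyEq ?_ hev
      exact (hPf z).div ((hg z).pow m) (pow_ne_zero _ hgz)
  · by_cases hgz : g z = 0
    · have hfz := hone z hgz
      rw [h_of_f z hfz]
      have h1 := pow_ne_zero m hfz
      field_simp
      linear_combination key z
    · rw [h_of_g z hgz]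
      have h1 := pow_ne_zero m hgz
      field_simp
  · by_cases hfz : f z = 0
    · have hgz : g z ≠ 0 := fun hgz => hone z hgz hfz
      rw [h_of_g z hgz]
      have h1 := pow_ne_zero m hgz
      field_simp
      linear_combination key z
    · rw [h_of_f z hfz]
      have h1 := pow_ne_zero m hfz
      field_simp

end Binomial

theorem norm_powOperator_le (n : ℕ) (α β : ℂ) {u : ℂ → ℂ} {z : ℂ} {X : ℝ} (hX : 1 ≤ X) {x y : ℝ}
    (hx : 0 ≤ x)
    (h1 : ‖deriv u z‖ ≤ x * X * ‖u z‖) (h2 : ‖iteratedDeriv 2 u z‖ ≤ y * X ^ 2 * ‖u z‖) :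
    ‖powOperator n α β u z‖ ≤
      (‖(n * (n - 1) : ℂ)‖ * x ^ 2 + n * y + ‖(α + β) * n‖ * x + ‖α * β‖) * X ^ 2 * ‖u z‖ ^ 2 := by
  have hXX : X ≤ X ^ 2 := by nlinarith
  have h1X : 1 ≤ X ^ 2 := by nlinarith
  have hu := norm_nonneg (u z)
  have t1 : ‖(n * (n - 1) * deriv u z ^ 2 : ℂ)‖ ≤
      ‖(n * (n - 1) : ℂ)‖ * x ^ 2 * X ^ 2 * ‖u z‖ ^ 2 := by
    rw [norm_mul, norm_pow]
    calc _ ≤ ‖(n * (n - 1) : ℂ)‖ * (x * X * ‖u z‖) ^ 2 := by gcongr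
      _ = _ := by ring
  have t2 : ‖n * u z * iteratedDeriv 2 u z‖ ≤ n * y * X ^ 2 * ‖u z‖ ^ 2 := by
    rw [norm_mul, norm_mul, norm_natCast]
    calc _ ≤ n * ‖u z‖ * (y * X ^ 2 * ‖u z‖) := by gcongr
      _ = _ := by ring
  have t3 : ‖(α + β) * n * u z * deriv u z‖ ≤ ‖(α + β) * n‖ * x * X ^ 2 * ‖u z‖ ^ 2 := by
    rw [norm_mul, norm_mul]
    calc _ ≤ ‖(α + β) * n‖ * ‖u z‖ * (x * X ^ 2 * ‖u z‖) := by
          gcongr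
          exact h1.trans (by gcongr)
      _ = _ := by ring
  have t4 : ‖α * β * u z ^ 2‖ ≤ ‖α * β‖ * X ^ 2 * ‖u z‖ ^ 2 := by
    rw [norm_mul, norm_pow]
    gcongr
    exact le_mul_of_one_le_right (norm_nonneg _) h1X
  unfold powOperator
  refine (norm_add_le _ _).trans ?_
  have s1 := norm_sub_le (n * (n - 1) * deriv u z ^ 2 + n * u z * iteratedDeriv 2 u z)
    ((α + β) * n * u z * deriv u z)
  have s2 := norm_add_le (n * (n - 1) * deriv u z ^ 2 : ℂ) (n * u z * iteratedDeriv 2 u z)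
  linarith

/-- The main case: there is no solution with `f` and its derivative nonvanishing at the origin. -/
theorem no_binomial_solution_of_ne_zero {f g : ℂ → ℂ} {k l : ℕ} {p₁ p₂ a a₁ a₂ : ℂ}
    (hl : 1 ≤ l) (hf : Differentiable ℂ f) (hg : Differentiable ℂ g) (hgf : g = iteratedDeriv l f)
    (hp₁ : p₁ ≠ 0) (hp₂ : p₂ ≠ 0) (ha : a ≠ 0) (ha₁₂ : a₁ ≠ a₂) (hf0 : f 0 ≠ 0) (hg0 : g 0 ≠ 0)
    (heq : ∀ z, f z ^ (k + 3 + 2) + a * g z ^ (k + 3 + 2) =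
      p₁ * exp (a₁ * z) + p₂ * exp (a₂ * z)) : False := by
  obtain ⟨A, B, hB, hfA, hgA⟩ := exists_exp_bound_of_binomial (n := k + 3 + 2) hf hl (by omega) ha
    (by simpa only [hgf] using heq)
  rw [← hgf] at hgA
  obtain ⟨C, hC, hcirc⟩ := exists_circle_iteratedDeriv_bound hf hg hB hfA hgA hf0 hg0
  obtain ⟨h, hh, hhf, hhg⟩ := exists_binomial_quotient hf hg hp₁ ha₁₂ heq
  by_cases hz : ∀ z, h z = 0
  · obtain ⟨c, hc⟩ := deriv_eq_of_powOperator_eq_zero (α := a₁) (β := a₂) (m := k + 3) hf ha₁₂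
      (fun h0 => hf0 (h0 0)) (fun z => by rw [hhf, hz, mul_zero])
    exact binomial_not_proportional hf hg hp₁ hp₂ ha₁₂ heq (c := c ^ l)
      fun z => by rw [hgf]; exact iteratedDeriv_eq_of_deriv_eq hc l z
  let H : ℂ → ℂ := fun z => h z ^ 2 * (f z * g z) ^ (k + 1)
  let Q : ℂ → ℂ := fun z => h z ^ 2 * (f z ^ k * g z ^ (k + 2))
  have hH : Differentiable ℂ H := by fun_prop
  have hQ : Differentiable ℂ Q := by fun_prop
  have hHQ : ∀ z, H z * g z = Q z * f z := fun z => by simp only [H, Q]; ring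
  have hHne : ¬ ∀ z, H z = 0 := by
    intro h0
    rcases entire_eq_zero_or_eq_zero_of_mul_eq_zero (hh.pow 2) ((hf.mul hg).pow (k + 1)) h0
      with h1 | h1
    · exact hz fun z => eq_zero_of_pow_eq_zero (h1 z)
    · exact mul_ne_zero hf0 hg0 (eq_zero_of_pow_eq_zero (h1 0))
  obtain ⟨K, hK, hPK⟩ : ∃ K : ℝ, 0 ≤ K ∧ ∀ X : ℝ, 1 ≤ X → ∀ (u : ℂ → ℂ) (z : ℂ),
      (∀ j, ‖iteratedDeriv j u z‖ ≤ j.factorial * Real.exp 7 * X ^ j * ‖u z‖) →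
      ‖powOperator (k + 3 + 2) a₁ a₂ u z‖ ≤ K * X ^ 2 * ‖u z‖ ^ 2 := by
    refine ⟨_, ?_, fun X hX u z hu => norm_powOperator_le (k + 3 + 2) a₁ a₂ hX
      (x := Real.exp 7) (y := 2 * Real.exp 7) (by positivity) ?_ ?_⟩
    · positivity
    · simpa using hu 1
    · simpa using hu 2
  have hbound : ∀ R : ℝ, 1 ≤ R → ∃ r, R ≤ r ∧ ∀ z : ℂ, ‖z‖ = r →
      ‖H z‖ ≤ ‖a‖ * K ^ 2 * C ^ 4 * R ^ 8 ∧
      ‖Q z‖ ≤ ‖a‖ * K ^ 2 * C ^ 4 * (l.factorial * Real.exp 7 * C ^ l) * R ^ (8 + 2 * l) := by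
    intro R hR
    obtain ⟨r, hr, hb⟩ := hcirc R hR
    refine ⟨r, hr, fun z hzr => ?_⟩
    obtain ⟨hfz, hgz, hj⟩ := hb z hzr
    have hX : 1 ≤ C * R ^ 2 := by nlinarith
    have hPf := hPK _ hX f z fun j => (hj j).1
    have hPg := hPK _ hX g z fun j => (hj j).2
    have hf' : 0 < ‖f z‖ := norm_pos_iff.2 hfz
    have hg' : 0 < ‖g z‖ := norm_pos_iff.2 hgz
    have hHb : ‖H z‖ ≤ ‖a‖ * K ^ 2 * C ^ 4 * R ^ 8 := by
      have h1 : H z * (f z * g z) ^ 2 =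
          -(powOperator (k + 3 + 2) a₁ a₂ f z * (a * powOperator (k + 3 + 2) a₁ a₂ g z)) := by
        rw [hhf, hhg]; simp only [H]; ring
      have h2 : ‖H z‖ * (‖f z‖ * ‖g z‖) ^ 2 ≤
          ‖a‖ * K ^ 2 * C ^ 4 * R ^ 8 * (‖f z‖ * ‖g z‖) ^ 2 := by
        calc ‖H z‖ * (‖f z‖ * ‖g z‖) ^ 2 = ‖H z * (f z * g z) ^ 2‖ := by simp
          _ = ‖powOperator (k + 3 + 2) a₁ a₂ f z‖ *
              (‖a‖ * ‖powOperator (k + 3 + 2) a₁ a₂ g z‖) := by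
            rw [h1, norm_neg, norm_mul, norm_mul]
          _ ≤ (K * (C * R ^ 2) ^ 2 * ‖f z‖ ^ 2) *
              (‖a‖ * (K * (C * R ^ 2) ^ 2 * ‖g z‖ ^ 2)) := by gcongr
          _ = _ := by ring
      exact le_of_mul_le_mul_right h2 (by positivity)
    refine ⟨hHb, ?_⟩
    have h3 : ‖Q z‖ * ‖f z‖ ≤
        ‖a‖ * K ^ 2 * C ^ 4 * (l.factorial * Real.exp 7 * C ^ l) * R ^ (8 + 2 * l) * ‖f z‖ := by
      have h4 := (hj l).1
      rw [← hgf] at h4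
      calc ‖Q z‖ * ‖f z‖ = ‖H z‖ * ‖g z‖ := by rw [← norm_mul, ← norm_mul, hHQ]
        _ ≤ (‖a‖ * K ^ 2 * C ^ 4 * R ^ 8) *
            (l.factorial * Real.exp 7 * (C * R ^ 2) ^ l * ‖f z‖) := by gcongr
        _ = _ := by rw [mul_pow, ← pow_mul, pow_add]; ring
    exact le_of_mul_le_mul_right h3 hf'
  obtain ⟨pH, hpH⟩ := exists_polynomial_of_circle_bound hH _ 8 fun R hR => by
    obtain ⟨r, hr, hb⟩ := hbound R hR
    exact ⟨r, hr, fun z hzr => (hb z hzr).1⟩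
  obtain ⟨pQ, hpQ⟩ := exists_polynomial_of_circle_bound hQ _ (8 + 2 * l) fun R hR => by
    obtain ⟨r, hr, hb⟩ := hbound R hR
    exact ⟨r, hr, fun z hzr => (hb z hzr).2⟩
  have hmul : ∀ z, H z ^ (k + 3 + 2) * (p₁ * exp (a₁ * z) + p₂ * exp (a₂ * z)) =
      (H z ^ (k + 3 + 2) + a * Q z ^ (k + 3 + 2)) * f z ^ (k + 3 + 2) := by
    intro z
    have h1 : H z ^ (k + 3 + 2) * g z ^ (k + 3 + 2) = Q z ^ (k + 3 + 2) * f z ^ (k + 3 + 2) := by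
      rw [← mul_pow, ← mul_pow, hHQ]
    rw [← heq]
    linear_combination a * h1
  have hpoly : pH ^ (k + 3 + 2) + Polynomial.C a * pQ ^ (k + 3 + 2) = 0 := by
    refine Polynomial.eq_zero_of_infinite_isRoot _
      ((infinite_zeros_exp_add_exp hp₁ hp₂ ha₁₂).mono fun z hz0 => ?_)
    have hz0 : p₁ * exp (a₁ * z) + p₂ * exp (a₂ * z) = 0 := hz0
    have hfz : f z ≠ 0 := by
      intro hfz
      have h1 := heq z
      rw [hz0, hfz, zero_pow (by omega), zero_add] at h1
      exact binomial_no_common_zero hf hg hp₁ ha₁₂ heq hfz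
        (eq_zero_of_pow_eq_zero ((mul_eq_zero.1 h1).resolve_left ha))
    have h2 := hmul z
    rw [hz0, mul_zero] at h2
    have h3 := (mul_eq_zero.1 h2.symm).resolve_right (pow_ne_zero _ hfz)
    simpa [Polynomial.IsRoot, ← hpH, ← hpQ] using h3
  have hexp : Differentiable ℂ fun z => p₁ * exp (a₁ * z) + p₂ * exp (a₂ * z) := by fun_prop
  rcases entire_eq_zero_or_eq_zero_of_mul_eq_zero (hH.pow (k + 3 + 2)) hexp (fun z => by
    have h1 := congrArg (Polynomial.eval z) hpoly
    simp only [Polynomial.eval_add, Polynomial.eval_mul, Polynomial.eval_pow, Polynomial.eval_C,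
      Polynomial.eval_zero, ← hpH, ← hpQ] at h1
    rw [Pi.pow_apply, hmul, h1, zero_mul]) with h1 | h1
  · exact hHne fun z => eq_zero_of_pow_eq_zero (h1 z)
  · refine exp_add_exp_simple (z := 0) hp₁ ha₁₂ (h1 0) ?_
    have h2 := (hasDerivAt_const_mul_exp p₁ a₁ 0).fun_add (hasDerivAt_const_mul_exp p₂ a₂ 0)
    rw [funext h1] at h2
    exact (h2.unique (hasDerivAt_const 0 0))

theorem stmt_4 (l n : ℕ) (hl : 1 ≤ l) (hn : 4 < n)
    (p₁ p₂ a a₁ a₂ : ℂ) (hp₁ : p₁ ≠ 0) (hp₂ : p₂ ≠ 0) (ha : a ≠ 0)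
    (ha₁ : a₁ ≠ 0) (ha₂ : a₂ ≠ 0) (ha₁₂ : a₁ ≠ a₂) :
    ¬ ∃ f : ℂ → ℂ, Differentiable ℂ f ∧
      ∀ z : ℂ, f z ^ n + a * (iteratedDeriv l f z) ^ n
        = p₁ * Complex.exp (a₁ * z) + p₂ * Complex.exp (a₂ * z) := by
  rintro ⟨f, hf, heq⟩
  obtain ⟨k, rfl⟩ : ∃ k, n = k + 3 + 2 := ⟨n - 5, by omega⟩
  have hg : Differentiable ℂ (iteratedDeriv l f) :=
    (hf.contDiff (n := ⊤)).differentiable_iteratedDeriv l (by exact_mod_cast WithTop.coe_lt_top _)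
  obtain ⟨w, hw⟩ : ∃ w, f w * iteratedDeriv l f w ≠ 0 := by
    by_contra! hcon
    rcases entire_eq_zero_or_eq_zero_of_mul_eq_zero hf hg hcon with h | h
    · refine binomial_not_proportional (c := 0) hf hg hp₁ hp₂ ha₁₂ heq fun z => ?_
      have h0 : f = fun _ => 0 := funext h
      rw [zero_mul, h0, iteratedDeriv_const]
      simp
    · exact binomial_not_proportional (c := 0) hf hg hp₁ hp₂ ha₁₂ heq fun z => by
        rw [h, zero_mul]
  refine no_binomial_solution_of_ne_zero (k := k) (f := fun z => f (z + w))
    (g := fun z => iteratedDeriv l f (z + w)) (p₁ := p₁ * exp (a₁ * w)) (p₂ := p₂ * exp (a₂ * w))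
    (a₁ := a₁) (a₂ := a₂) hl (by fun_prop) (hg.comp (by fun_prop))
    (iteratedDeriv_comp_add_const l f w).symm (mul_ne_zero hp₁ (exp_ne_zero _))
    (mul_ne_zero hp₂ (exp_ne_zero _)) ha ha₁₂ ?_ ?_ (fun z => ?_)
  · simpa using left_ne_zero_of_mul hw
  · simpa using right_ne_zero_of_mul hw
  · rw [heq, mul_add, mul_add, exp_add, exp_add]
    ring
end

section
/- Let a, b, p₁, p₂ be nonzero complex constants satisfying 9ab² ≠ −4. Then the equation f(z)² + a·(f'(z))² = p₁·e^{bz} + p₂·e^{−bz} (for all z ∈ ℂ) has an entire solution f if and only if ab² + 1 = 0 or ab² − 4 = 0. Moreover: (i) if ab² + 1 = 0, then every entire solution has the form f(z) = t₁e^{bz} + t₂e^{−bz} + r where the constants satisfy r⁴ = −p₁p₂, 2t₁r = p₁, 2t₂r = p₂; (ii) if ab² − 4 = 0, then every entire solution has the form f(z) = l₁e^{(b/2)z} + l₂e^{−(b/2)z} where l₁² = p₁/2 and l₂² = p₂/2. -/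
open Complex

/-- A holomorphic function pinched between `exp (-M)` and `exp M` on a disc of radius `r` has
logarithmic derivative at most `8 * M / r` at the centre. -/
lemma norm_deriv_div_le_of_pinched {D : ℂ → ℂ} {c : ℂ} {r M : ℝ} (hr : 0 < r) (hM : 0 < M)
    (hd : DifferentiableOn ℂ D (Metric.ball c r))
    (hub : ∀ w ∈ Metric.ball c r, ‖D w‖ ≤ Real.exp M)
    (hlb : ∀ w ∈ Metric.ball c r, Real.exp (-M) ≤ ‖D w‖) :
    ‖deriv D c / D c‖ ≤ 8 * M / r := by
  have hne : ∀ w ∈ Metric.ball c r, D w ≠ 0 := fun w hw =>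
    norm_pos_iff.1 ((Real.exp_pos _).trans_le (hlb w hw))
  have hc : c ∈ Metric.ball c r := Metric.mem_ball_self hr
  obtain ⟨g, hg⟩ := ((hd.deriv Metric.isOpen_ball).div hd hne).isExactOn_ball
  have hDd : ∀ w ∈ Metric.ball c r, HasDerivAt D (deriv D w) w := fun w hw =>
    (hd.differentiableAt (Metric.isOpen_ball.mem_nhds hw)).hasDerivAt
  have hder : ∀ w ∈ Metric.ball c r,
      HasDerivAt (fun w => D w * exp (-(g w - g c))) 0 w := fun w hw => by
    have h := (hDd w hw).mul (((hg w hw).sub_const (g c)).neg.cexp)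
    refine h.congr_deriv ?_
    have := hne w hw
    simp only [Pi.div_apply]
    field_simp
    ring
  have hconst : ∀ w ∈ Metric.ball c r, D w * exp (-(g w - g c)) = D c := fun w hw => by
    have := Metric.isOpen_ball.is_const_of_deriv_eq_zero
      (convex_ball c r).isPreconnected (fun w hw => (hder w hw).differentiableAt.differentiableWithinAt)
      (fun w hw => (hder w hw).deriv) hw hc
    simpa using this
  have hre : ∀ w ∈ Metric.ball c r, (g w - g c).re ≤ 2 * M := fun w hw => by
    have h1 := congrArg norm (hconst w hw)
    rw [norm_mul, norm_exp, neg_re] at h1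
    have h2 : Real.exp (-M) ≤ Real.exp M * Real.exp (-(g w - g c).re) :=
      calc Real.exp (-M) ≤ ‖D c‖ := hlb c hc
        _ = _ := h1.symm
        _ ≤ _ := by gcongr; exact hub w hw
    rw [← Real.exp_add, Real.exp_le_exp] at h2
    linarith
  have hmaps : ∀ w ∈ Metric.ball (0 : ℂ) r, c + w ∈ Metric.ball c r := fun w hw => by
    simpa [dist_eq_norm] using hw
  have hF : ∀ w ∈ Metric.ball (0 : ℂ) r, HasDerivAt (fun w => g (c + w) - g c)
      (deriv D (c + w) / D (c + w)) w := fun w hw =>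
    ((hg _ (hmaps w hw)).comp_const_add c w).sub_const _
  have hbound : ∀ w ∈ Metric.sphere (0 : ℂ) (r / 2), ‖g (c + w) - g c‖ ≤ 4 * M := fun w hw => by
    have hw' : ‖w‖ = r / 2 := by simpa using hw
    have hwb : w ∈ Metric.ball (0 : ℂ) r := by simp [hw', hr]
    have := borelCaratheodory_zero (f := fun w => g (c + w) - g c) (M := 2 * M) (by positivity)
      (fun w hw => (hF w hw).differentiableAt.differentiableWithinAt)
      (fun w hw => hre _ (hmaps w hw)) hr hwb (by simp)
    refine this.trans (le_of_eq ?_)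
    rw [hw']; field_simp; ring
  have hcl : DiffContOnCl ℂ (fun w => g (c + w) - g c) (Metric.ball 0 (r / 2)) := by
    refine DifferentiableOn.diffContOnCl_ball (U := Metric.ball 0 r) (fun w hw =>
      (hF w hw).differentiableAt.differentiableWithinAt)
      (Metric.closedBall_subset_ball (by linarith))
  have := norm_deriv_le_of_forall_mem_sphere_norm_le (by positivity) hcl hbound
  rw [(hF 0 (by simpa using hr)).deriv] at this
  simp only [add_zero] at this
  refine this.trans (le_of_eq ?_)
  field_simp; ring

lemma norm_deriv_deriv_div_le_of_pinched {D : ℂ → ℂ} {c : ℂ} {r M : ℝ} (hr : 0 < r) (hM : 0 < M)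
    (hd : DifferentiableOn ℂ D (Metric.ball c r))
    (hub : ∀ w ∈ Metric.ball c r, ‖D w‖ ≤ Real.exp M)
    (hlb : ∀ w ∈ Metric.ball c r, Real.exp (-M) ≤ ‖D w‖) :
    ‖deriv (deriv D) c / D c‖ ≤ 64 * (M + M ^ 2) / r ^ 2 := by
  have hne : ∀ w ∈ Metric.ball c r, D w ≠ 0 := fun w hw =>
    norm_pos_iff.1 ((Real.exp_pos _).trans_le (hlb w hw))
  have hc : c ∈ Metric.ball c r := Metric.mem_ball_self hr
  have hd' := hd.deriv Metric.isOpen_ball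
  have hL : DifferentiableOn ℂ (fun w => deriv D w / D w) (Metric.ball c r) := hd'.div hd hne
  have hsphere : ∀ w ∈ Metric.sphere c (r / 4), ‖deriv D w / D w‖ ≤ 16 * M / r := fun w hw => by
    have hsub : Metric.ball w (r / 2) ⊆ Metric.ball c r := Metric.ball_subset_ball' (by
      rw [Metric.mem_sphere.1 hw]; linarith)
    refine (norm_deriv_div_le_of_pinched (half_pos hr) hM (hd.mono hsub)
      (fun w hw => hub w (hsub hw)) (fun w hw => hlb w (hsub hw))).trans (le_of_eq ?_)
    field_simp; ring
  have h1 := norm_deriv_le_of_forall_mem_sphere_norm_le (by positivity)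
    (hL.diffContOnCl_ball (Metric.closedBall_subset_ball (by linarith))) hsphere
  have h2 := norm_deriv_div_le_of_pinched hr hM hd hub hlb
  have hnhds := Metric.isOpen_ball.mem_nhds hc
  have heq : deriv (deriv D) c / D c
      = deriv (fun w => deriv D w / D w) c + (deriv D c / D c) ^ 2 := by
    rw [deriv_fun_div (hd'.differentiableAt hnhds) (hd.differentiableAt hnhds) (hne c hc)]
    have := hne c hc
    field_simp; ring
  rw [heq]
  calc _ ≤ ‖deriv (fun w => deriv D w / D w) c‖ + ‖deriv D c / D c‖ ^ 2 := by
        rw [← norm_pow]; exact norm_add_le _ _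
    _ ≤ 16 * M / r / (r / 4) + (8 * M / r) ^ 2 := by gcongr
    _ = _ := by field_simp; ring

/-- Holomorphic division: `N / D` is entire when every zero of `D` is simple and a zero of `N`. -/
lemma exists_differentiable_mul_eq {D N : ℂ → ℂ} (hD : Differentiable ℂ D)
    (hN : Differentiable ℂ N) (hsimple : ∀ z, D z = 0 → deriv D z ≠ 0)
    (hzero : ∀ z, D z = 0 → N z = 0) :
    ∃ φ : ℂ → ℂ, Differentiable ℂ φ ∧ ∀ z, N z = φ z * D z := by
  classical
  refine ⟨fun z => if D z = 0 then deriv N z / deriv D z else N z / D z, fun c => ?_, fun z => ?_⟩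
  · by_cases hc : D c = 0
    · have hdsl : ∀ {F : ℂ → ℂ}, Differentiable ℂ F → DifferentiableAt ℂ (dslope F c) c :=
        fun hF => ((differentiableOn_dslope Filter.univ_mem).2 hF.differentiableOn).differentiableAt
          Filter.univ_mem
      have hne : dslope D c c ≠ 0 := by rw [dslope_same]; exact hsimple c hc
      have hev := (hdsl hD).continuousAt.eventually_ne hne
      refine ((hdsl hN).div (hdsl hD) hne).congr_of_eventuallyEq ?_
      filter_upwards [hev] with z hz
      by_cases hzc : z = c
      · subst hzc; simp [hc]
      · have h1 : D z = (z - c) * dslope D c z := by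
          have := sub_smul_dslope D c z; rw [smul_eq_mul, hc, sub_zero] at this; exact this.symm
        have h2 : N z = (z - c) * dslope N c z := by
          have := sub_smul_dslope N c z
          rw [smul_eq_mul, hzero c hc, sub_zero] at this; exact this.symm
        have h3 : z - c ≠ 0 := sub_ne_zero.2 hzc
        have h4 : D z ≠ 0 := by rw [h1]; exact mul_ne_zero h3 hz
        simp only [h4, if_false, Pi.div_apply]
        rw [h1, h2, mul_div_mul_left _ _ h3]
    · refine ((hN c).div (hD c) hc).congr_of_eventuallyEq ?_
      filter_upwards [(hD c).continuousAt.eventually_ne hc] with z hz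
      simp [hz]
  · by_cases hz : D z = 0
    · simp [hz, hzero z hz]
    · simp [hz]

/-- An entire function of at most quadratic growth that is bounded on a real ray is constant. -/
lemma exists_eq_const_of_quadratic_growth {φ : ℂ → ℂ} (hφ : Differentiable ℂ φ) {K B R : ℝ}
    (hK : ∀ z, ‖φ z‖ ≤ K * (1 + ‖z‖) ^ 2) (hB : ∀ x : ℝ, R ≤ x → ‖φ x‖ ≤ B) :
    ∃ μ, ∀ z, φ z = μ := by
  have hK0 : 0 ≤ K := by simpa using (norm_nonneg _).trans (hK 0)
  have hzero : ∀ n, 3 ≤ n → iteratedDeriv n φ 0 = 0 := fun n hn => by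
    rw [← norm_le_zero_iff]
    have hlim : Filter.Tendsto (fun r : ℝ => n.factorial * (4 * K) * r⁻¹) Filter.atTop
        (nhds (n.factorial * (4 * K) * 0)) := tendsto_inv_atTop_zero.const_mul _
    rw [mul_zero] at hlim
    refine ge_of_tendsto hlim ?_
    filter_upwards [Filter.eventually_ge_atTop 1] with r hr
    have h := norm_iteratedDeriv_le_of_forall_mem_sphere_norm_le (c := 0) (R := r)
      (C := 4 * K * r ^ 2) n (by linarith) hφ.diffContOnCl (fun z hz => by
        have hz' : ‖z‖ = r := by simpa using hz
        refine (hK z).trans ?_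
        rw [hz']; nlinarith [mul_nonneg hK0 (sub_nonneg.2 hr), mul_nonneg hK0 (sq_nonneg (r - 1))])
    refine h.trans ?_
    have h3 : r ^ 3 ≤ r ^ n := pow_le_pow_right₀ hr hn
    rw [div_le_iff₀ (by positivity)]
    calc n.factorial * (4 * K * r ^ 2) = n.factorial * (4 * K) * r⁻¹ * r ^ 3 := by
          field_simp
      _ ≤ _ := by gcongr
  have hform : ∃ c₀ c₁ c₂ : ℂ, ∀ z, φ z = c₀ + c₁ * z + c₂ * z ^ 2 := by
    refine ⟨φ 0, iteratedDeriv 1 φ 0, 2⁻¹ * iteratedDeriv 2 φ 0, fun z => ?_⟩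
    rw [← taylorSeries_eq_of_entire' 0 z hφ, tsum_eq_sum (s := Finset.range 3)]
    · simp [Finset.sum_range_succ, Nat.factorial]
    · intro n hn
      rw [hzero n (by simpa using hn)]; simp
  obtain ⟨c₀, c₁, c₂, h⟩ := hform
  have unbounded : ∀ (c : ℂ) (B : ℝ), (∀ x : ℝ, max R 1 ≤ x → ‖c‖ * x ≤ B) → c = 0 :=
    fun c B hc => by
      by_contra hne
      have hpos := norm_pos_iff.2 hne
      have := hc (max (max R 1) ((B + 1) / ‖c‖)) (le_max_left _ _)
      have h2 : B + 1 ≤ ‖c‖ * max (max R 1) ((B + 1) / ‖c‖) := by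
        calc B + 1 = ‖c‖ * ((B + 1) / ‖c‖) := by field_simp
          _ ≤ _ := by gcongr; exact le_max_right _ _
      linarith
  have hc₂ : c₂ = 0 := by
    refine unbounded c₂ (2 * B) fun x hx => ?_
    have hR : R ≤ x := (le_max_left _ _).trans hx
    have h1 : 1 ≤ x := (le_max_right _ _).trans hx
    have e : (2 : ℂ) * (c₂ * x ^ 2) = φ (x : ℝ) - 2 * φ ((2 * x : ℝ)) + φ ((3 * x : ℝ)) := by
      simp only [h]; push_cast; ring
    have : 2 * (‖c₂‖ * x ^ 2) ≤ B + 2 * B + B := by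
      calc 2 * (‖c₂‖ * x ^ 2) = ‖(2 : ℂ) * (c₂ * x ^ 2)‖ := by
            simp
        _ ≤ B + 2 * B + B := by
            rw [e]
            refine (norm_add_le _ _).trans (add_le_add ((norm_sub_le _ _).trans (add_le_add
              (hB x hR) ?_)) (hB _ (by linarith)))
            rw [norm_mul]; simp only [norm_ofNat]
            linarith [hB (2 * x) (by linarith)]
    nlinarith [mul_nonneg (norm_nonneg c₂) (mul_nonneg (zero_le_one.trans h1) (sub_nonneg.2 h1))]
  have hc₁ : c₁ = 0 := by
    refine unbounded c₁ (2 * B) fun x hx => ?_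
    have hR : R ≤ x := (le_max_left _ _).trans hx
    have h1 : 1 ≤ x := (le_max_right _ _).trans hx
    have e : c₁ * x = φ ((2 * x : ℝ)) - φ (x : ℝ) := by
      simp only [h, hc₂]; push_cast; ring
    calc ‖c₁‖ * x = ‖c₁ * x‖ := by simp [abs_of_nonneg (zero_le_one.trans h1)]
      _ ≤ B + B := by
          rw [e]
          exact (norm_sub_le _ _).trans (add_le_add (hB _ (by linarith)) (hB x hR))
      _ = _ := by ring
  exact ⟨c₀, fun z => by simp [h, hc₁, hc₂]⟩

/-- `f` has at most exponential growth. -/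
def ExpBounded (f : ℂ → ℂ) : Prop :=
  ∃ C : ℝ, 0 < C ∧ ∀ z, ‖f z‖ ≤ Real.exp (C * (1 + ‖z‖))

lemma ExpBounded.const_mul {f : ℂ → ℂ} (hf : ExpBounded f) (c : ℂ) :
    ExpBounded fun z => c * f z := by
  obtain ⟨C, hC, h⟩ := hf
  refine ⟨‖c‖ + C, by positivity, fun z => ?_⟩
  rw [norm_mul, add_mul, Real.exp_add]
  gcongr
  · nlinarith [Real.add_one_le_exp (‖c‖ * (1 + ‖z‖)), norm_nonneg c, norm_nonneg z,
      mul_nonneg (norm_nonneg c) (norm_nonneg z)]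
  · exact h z

lemma ExpBounded.add {f g : ℂ → ℂ} (hf : ExpBounded f) (hg : ExpBounded g) :
    ExpBounded fun z => f z + g z := by
  obtain ⟨C, hC, h⟩ := hf
  obtain ⟨C', hC', h'⟩ := hg
  refine ⟨C + C' + 1, by positivity, fun z => ?_⟩
  have hz := norm_nonneg z
  have h1 : ‖f z‖ ≤ Real.exp ((C + C') * (1 + ‖z‖)) :=
    (h z).trans (Real.exp_le_exp.2 (by gcongr; linarith))
  have h2 : ‖g z‖ ≤ Real.exp ((C + C') * (1 + ‖z‖)) :=
    (h' z).trans (Real.exp_le_exp.2 (by gcongr; linarith))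
  rw [add_mul _ 1, Real.exp_add]
  have h3 : 2 ≤ Real.exp (1 * (1 + ‖z‖)) := by linarith [Real.add_one_le_exp (1 * (1 + ‖z‖))]
  calc _ ≤ ‖f z‖ + ‖g z‖ := norm_add_le _ _
    _ ≤ Real.exp ((C + C') * (1 + ‖z‖)) * 2 := by linarith
    _ ≤ _ := by gcongr

lemma ExpBounded.deriv {f : ℂ → ℂ} (hf : ExpBounded f) (hd : Differentiable ℂ f) :
    ExpBounded (deriv f) := by
  obtain ⟨C, hC, h⟩ := hf
  refine ⟨2 * C, by positivity, fun z => ?_⟩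
  have := norm_deriv_le_of_forall_mem_sphere_norm_le (c := z) (R := 1)
    (C := Real.exp (2 * C * (1 + ‖z‖))) one_pos hd.diffContOnCl (fun w hw => by
      refine (h w).trans (Real.exp_le_exp.2 ?_)
      have h1 : ‖w‖ ≤ ‖z‖ + 1 := by
        have := norm_le_norm_add_norm_sub' w z
        rwa [mem_sphere_iff_norm.1 hw] at this
      nlinarith [mul_nonneg hC.le (norm_nonneg z)])
  simpa using this

lemma ExpBounded.of_norm_deriv_le {g : ℂ → ℂ} (hg : Differentiable ℂ g) {K B : ℝ} (hK : 0 < K)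
    (hB : 0 ≤ B) (h : ∀ z, ‖_root_.deriv g z‖ ≤ K * ‖g z‖ + B * Real.exp ‖z‖) : ExpBounded g := by
  refine ⟨‖g 0‖ + B / K + K + 1, by positivity, fun z => ?_⟩
  have key : ‖g z‖ ≤ (‖g 0‖ + B / K) * Real.exp ((K + 1) * ‖z‖) := by
    rcases eq_or_ne z 0 with rfl | hz
    · simp; positivity
    have hz' := norm_pos_iff.2 hz
    have hder : ∀ x : ℝ, HasDerivAt (fun t : ℝ => g (t * z)) (_root_.deriv g (x * z) * z) x :=
      fun x => by
        have h1 : HasDerivAt (fun t : ℝ => (t : ℂ) * z) z x := by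
          simpa using (hasDerivAt_id x).ofReal_comp.mul_const z
        exact (hg (x * z)).hasDerivAt.comp x h1
    have := norm_le_gronwallBound_of_norm_deriv_right_le (f := fun t : ℝ => g (t * z))
      (f' := fun x => _root_.deriv g (x * z) * z) (δ := ‖g 0‖) (K := K * ‖z‖)
      (ε := B * Real.exp ‖z‖ * ‖z‖) (a := 0) (b := 1)
      (fun x _ => (hder x).continuousAt.continuousWithinAt)
      (fun x _ => (hder x).hasDerivWithinAt) (by simp)
      (fun x hx => by
        have hxz : ‖(x : ℂ) * z‖ ≤ ‖z‖ := by
          rw [norm_mul, norm_real, Real.norm_of_nonneg hx.1]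
          nlinarith [hx.2]
        rw [norm_mul]
        calc _ ≤ (K * ‖g (x * z)‖ + B * Real.exp ‖(x : ℂ) * z‖) * ‖z‖ := by
              gcongr; exact h _
          _ ≤ (K * ‖g (x * z)‖ + B * Real.exp ‖z‖) * ‖z‖ := by gcongr
          _ = _ := by ring) 1 (by simp)
    rw [gronwallBound_of_K_ne_0 (by positivity)] at this
    simp only [ofReal_one, one_mul, sub_zero, mul_one] at this
    refine this.trans ?_
    have e : B * Real.exp ‖z‖ * ‖z‖ / (K * ‖z‖) = B / K * Real.exp ‖z‖ := by field_simp
    have h1 : 1 ≤ Real.exp ‖z‖ := Real.one_le_exp hz'.le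
    rw [e, add_mul K, Real.exp_add, one_mul, add_mul]
    refine add_le_add ?_ ?_
    · exact mul_le_mul_of_nonneg_left (le_mul_of_one_le_right (Real.exp_pos _).le h1)
        (norm_nonneg _)
    · calc _ ≤ B / K * Real.exp ‖z‖ * Real.exp (K * ‖z‖) := by gcongr; linarith
        _ = _ := by ring
  refine key.trans ?_
  have h2 : ‖g 0‖ + B / K ≤ Real.exp (‖g 0‖ + B / K) := by
    linarith [Real.add_one_le_exp (‖g 0‖ + B / K)]
  calc _ ≤ Real.exp (‖g 0‖ + B / K) * Real.exp ((K + 1) * ‖z‖) := by gcongr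
    _ ≤ _ := by
      rw [← Real.exp_add, Real.exp_le_exp]
      have : 0 ≤ (‖g 0‖ + B / K) * ‖z‖ := by positivity
      nlinarith

lemma ExpBounded.of_sq_add_mul_deriv_sq {g : ℂ → ℂ} (hg : Differentiable ℂ g) {A : ℂ}
    (hA : A ≠ 0) {Q : ℝ} (h : ∀ z, ‖g z ^ 2 + A * _root_.deriv g z ^ 2‖ ≤ Q * Real.exp ‖z‖) :
    ExpBounded g := by
  have hQ : 0 ≤ Q := by simpa using (norm_nonneg _).trans (h 0)
  set S := Real.sqrt ‖A‖
  have hS : 0 < S := Real.sqrt_pos.2 (norm_pos_iff.2 hA)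
  have hS2 : S ^ 2 = ‖A‖ := Real.sq_sqrt (norm_nonneg A)
  refine .of_norm_deriv_le hg (K := S⁻¹) (B := S⁻¹ * (1 + Q)) (by positivity) (by positivity)
    fun z => ?_
  have h1 : ‖A‖ * ‖_root_.deriv g z‖ ^ 2 ≤ ‖g z‖ ^ 2 + Q * Real.exp ‖z‖ := by
    have := norm_sub_le (g z ^ 2 + A * _root_.deriv g z ^ 2) (g z ^ 2)
    rw [add_sub_cancel_left, norm_mul, norm_pow, norm_pow] at this
    linarith [h z]
  have h2 : (1 : ℝ) ≤ Real.exp ‖z‖ := Real.one_le_exp (norm_nonneg z)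
  have h3 : S * ‖_root_.deriv g z‖ ≤ ‖g z‖ + (1 + Q) * Real.exp ‖z‖ := by
    refine le_of_sq_le_sq ?_ (by positivity)
    have h4 : Q * Real.exp ‖z‖ ≤ ((1 + Q) * Real.exp ‖z‖) ^ 2 := by
      have : Q * Real.exp ‖z‖ ≤ (1 + Q) * Real.exp ‖z‖ := by gcongr; linarith
      have : 1 ≤ (1 + Q) * Real.exp ‖z‖ := by nlinarith
      nlinarith
    have h5 : 0 ≤ ‖g z‖ * ((1 + Q) * Real.exp ‖z‖) := by positivity
    rw [mul_pow, hS2]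
    nlinarith
  calc ‖_root_.deriv g z‖ = S⁻¹ * (S * ‖_root_.deriv g z‖) := by field_simp
    _ ≤ S⁻¹ * (‖g z‖ + (1 + Q) * Real.exp ‖z‖) := by gcongr
    _ = _ := by ring

lemma half_le_norm_sinh_of_re {w : ℂ} (h : 1 / 2 ≤ |w.re|) : 1 / 2 ≤ ‖sinh w‖ := by
  have h1 : |Real.sinh w.re| ≤ ‖sinh w‖ := by
    have h2 := abs_norm_sub_norm_le (exp w) (exp (-w))
    rw [norm_exp, norm_exp, neg_re] at h2
    rw [sinh, norm_div, Real.sinh_eq, abs_div]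
    simp only [norm_ofNat, Nat.abs_ofNat]
    gcongr
  refine le_trans ?_ h1
  rw [Real.abs_sinh]
  exact h.trans (Real.self_le_sinh_iff.2 (abs_nonneg _))

lemma half_le_norm_sinh_of_im {w : ℂ} (k : ℤ) (h : |w.im - (k + 1 / 2) * Real.pi| ≤ 1 / 2) :
    1 / 2 ≤ ‖sinh w‖ := by
  set δ := w.im - (k + 1 / 2) * Real.pi with hδ
  have hcos : 7 / 8 ≤ Real.cos δ := by
    have := Real.one_sub_sq_div_two_le_cos (x := δ)
    have : δ ^ 2 ≤ (1 / 2) ^ 2 := sq_le_sq' (by linarith [(abs_le.1 h).1]) (abs_le.1 h).2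
    linarith
  have hsin : |Real.sin w.im| = |Real.cos δ| := by
    have e : w.im = δ + Real.pi / 2 + k * Real.pi := by rw [hδ]; ring
    rw [e, Real.sin_add_int_mul_pi, Real.sin_add_pi_div_two, abs_mul, abs_zpow]
    simp
  have him : (sinh w).im = Real.cosh w.re * Real.sin w.im := by
    conv_lhs => rw [← re_add_im w, sinh_add, sinh_mul_I, cosh_mul_I]
    simp [sin_ofReal_re, cosh_ofReal_re]
  have h1 := abs_im_le_norm (sinh w)
  rw [him, abs_mul, hsin, abs_of_pos (Real.cosh_pos _), abs_of_pos (by linarith)] at h1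
  nlinarith [Real.one_le_cosh w.re]

/-- A quadratic bound off the open strip `|re z| < 1` and on the horizontal lines
`im z = (k + 1/2) * π` extends to the whole plane by the maximum modulus principle. -/
lemma quadratic_growth_of_grid {φ : ℂ → ℂ} (hφ : Differentiable ℂ φ) {K : ℝ}
    (h : ∀ z : ℂ, (1 ≤ |z.re| ∨ ∃ k : ℤ, z.im = (k + 1 / 2) * Real.pi) →
      ‖φ z‖ ≤ K * (1 + ‖z‖) ^ 2) (z : ℂ) :
    ‖φ z‖ ≤ 49 * K * (1 + ‖z‖) ^ 2 := by
  have hK : 0 ≤ K := by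
    by_contra hneg
    have h1 := (norm_nonneg _).trans (h 1 (by simp))
    norm_num at h1
    exact hneg h1
  by_cases hre : 1 ≤ |z.re|
  · refine (h z (.inl hre)).trans ?_
    gcongr
    linarith
  push Not at hre
  have hpi := Real.pi_pos
  set k := ⌊z.im / Real.pi - 1 / 2⌋
  have hk1 : (k + 1 / 2) * Real.pi ≤ z.im := by
    have := Int.floor_le (z.im / Real.pi - 1 / 2)
    rw [← le_div_iff₀ hpi]; linarith
  have hk2 : z.im ≤ ((k + 1 : ℤ) + 1 / 2) * Real.pi := by
    have := (Int.lt_floor_add_one (z.im / Real.pi - 1 / 2)).le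
    rw [← div_le_iff₀ hpi]; push_cast; linarith
  have hlt : (k + 1 / 2) * Real.pi < ((k + 1 : ℤ) + 1 / 2) * Real.pi := by
    push_cast; nlinarith
  set U := Set.Ioo (-1 : ℝ) 1 ×ℂ Set.Ioo ((k + 1 / 2) * Real.pi) (((k + 1 : ℤ) + 1 / 2) * Real.pi)
  have hU : Bornology.IsBounded U :=
    (Metric.isBounded_Ioo _ _).reProdIm (Metric.isBounded_Ioo _ _)
  have hcl : closure U = Set.Icc (-1 : ℝ) 1 ×ℂ
      Set.Icc ((k + 1 / 2) * Real.pi) (((k + 1 : ℤ) + 1 / 2) * Real.pi) := by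
    rw [closure_reProdIm, closure_Ioo (by norm_num), closure_Ioo hlt.ne]
  have hz : z ∈ closure U := by
    rw [hcl]; exact ⟨⟨(abs_lt.1 hre).1.le, (abs_lt.1 hre).2.le⟩, hk1, hk2⟩
  refine norm_le_of_forall_mem_frontier_norm_le hU hφ.diffContOnCl (fun w hw => ?_) hz
  have hwcl : w ∈ closure U := frontier_subset_closure hw
  have hgood : 1 ≤ |w.re| ∨ ∃ k : ℤ, w.im = (k + 1 / 2) * Real.pi := by
    rw [frontier_reProdIm, frontier_Ioo hlt,
      frontier_Ioo (by norm_num : (-1 : ℝ) < 1)] at hw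
    rcases hw with ⟨-, hw | hw⟩ | ⟨hw | hw, -⟩
    · exact .inr ⟨k, hw⟩
    · exact .inr ⟨k + 1, hw⟩
    · left; rw [show w.re = -1 from hw]; simp
    · left; rw [show w.re = 1 from hw]; simp
  rw [hcl] at hwcl
  obtain ⟨⟨h1, h2⟩, h3, h4⟩ := hwcl
  have hdist : ‖w‖ ≤ ‖z‖ + 6 := by
    have e1 := norm_le_norm_add_norm_sub' w z
    have e2 := norm_le_abs_re_add_abs_im (w - z)
    have e3 : |(w - z).re| ≤ 2 := by
      rw [sub_re, abs_le]; constructor <;> linarith [(abs_lt.1 hre).1, (abs_lt.1 hre).2]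
    have e4 : |(w - z).im| ≤ 4 := by
      have := Real.pi_lt_four
      push_cast at hk2 h4
      change w.im ≤ _ at h4
      change _ ≤ w.im at h3
      rw [sub_im, abs_le]; constructor <;> linarith
    linarith
  calc ‖φ w‖ ≤ K * (1 + ‖w‖) ^ 2 := h w hgood
    _ ≤ K * (7 * (1 + ‖z‖)) ^ 2 := by gcongr; linarith [norm_nonneg z]
    _ = _ := by ring

/-- If `D * E = q * sinh` with `D`, `E` of exponential growth and `D''` divisible by `D`, then
the quotient `D'' / D` is constant. -/
lemma exists_const_of_deriv_deriv_eq_mul {D E φ : ℂ → ℂ} {q : ℂ} (hq : q ≠ 0)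
    (hD : Differentiable ℂ D) (hDb : ExpBounded D) (hEb : ExpBounded E)
    (hDE : ∀ z, D z * E z = q * sinh z) (hφ : Differentiable ℂ φ)
    (hφD : ∀ z, deriv (deriv D) z = φ z * D z) : ∃ μ, ∀ z, φ z = μ := by
  obtain ⟨C₁, hC₁, h₁⟩ := hDb
  obtain ⟨C₂, hC₂, h₂⟩ := hEb.const_mul (2 / q)
  set C := C₁ + C₂
  have hC : 0 < C := by positivity
  have hub : ∀ w, ‖D w‖ ≤ Real.exp (C * (1 + ‖w‖)) := fun w =>
    (h₁ w).trans (Real.exp_le_exp.2 (by gcongr; simp [C, hC₂.le]))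
  have hlb : ∀ w, 1 / 2 ≤ ‖sinh w‖ → Real.exp (-(C * (1 + ‖w‖))) ≤ ‖D w‖ := fun w hw => by
    have e : D w * (2 / q * E w) = 2 * sinh w := by
      have := hDE w
      field_simp
      linear_combination this
    have e' := congrArg norm e
    rw [norm_mul (D w), norm_mul 2, norm_ofNat] at e'
    have h3 : ‖2 / q * E w‖ ≤ Real.exp (C * (1 + ‖w‖)) :=
      (h₂ w).trans (Real.exp_le_exp.2 (by gcongr; simp [C, hC₁.le]))
    have h4 : 1 ≤ ‖D w‖ * Real.exp (C * (1 + ‖w‖)) :=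
      calc 1 ≤ 2 * ‖sinh w‖ := by linarith
        _ = _ := e'.symm
        _ ≤ _ := by gcongr
    rw [Real.exp_neg, inv_le_iff_one_le_mul₀ (Real.exp_pos _)]
    exact h4
  have key : ∀ (z : ℂ) (r : ℝ), 0 < r → (∀ w ∈ Metric.ball z r, 1 / 2 ≤ ‖sinh w‖) →
      ∀ M, C * (1 + ‖z‖ + r) ≤ M → ‖φ z‖ ≤ 64 * (M + M ^ 2) / r ^ 2 := fun z r hr hs M hM => by
    have hM0 : 0 < M := lt_of_lt_of_le (by positivity) hM
    have hw : ∀ w ∈ Metric.ball z r, C * (1 + ‖w‖) ≤ M := fun w hw => by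
      refine le_trans ?_ hM
      have h1 := norm_le_norm_add_norm_sub' w z
      have h2 := (mem_ball_iff_norm.1 hw).le
      exact mul_le_mul_of_nonneg_left (by linarith) hC.le
    have hlb' : ∀ w ∈ Metric.ball z r, Real.exp (-M) ≤ ‖D w‖ := fun w hw' =>
      (Real.exp_le_exp.2 (neg_le_neg (hw w hw'))).trans (hlb w (hs w hw'))
    have := norm_deriv_deriv_div_le_of_pinched hr hM0 hD.differentiableOn
      (fun w hw' => (hub w).trans (Real.exp_le_exp.2 (hw w hw'))) hlb'
    have hne : D z ≠ 0 := norm_pos_iff.1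
      ((Real.exp_pos _).trans_le (hlb' z (Metric.mem_ball_self hr)))
    rwa [hφD, mul_div_cancel_right₀ _ hne] at this
  refine exists_eq_const_of_quadratic_growth hφ (K := 49 * (256 * (2 * C + 4 * C ^ 2))) (R := 2)
    (B := 256 * (2 * C + 4 * C ^ 2)) (quadratic_growth_of_grid hφ fun z hz => ?_) fun x hx => ?_
  · refine (key z (1 / 2) (by norm_num) (fun w hw => ?_) (2 * C * (1 + ‖z‖))
      (by nlinarith [mul_nonneg hC.le (norm_nonneg z)])).trans ?_
    · have hw' := (mem_ball_iff_norm.1 hw).le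
      rcases hz with hz | ⟨k, hk⟩
      · apply half_le_norm_sinh_of_re
        have h1 := (abs_re_le_norm (w - z)).trans hw'
        rw [sub_re] at h1
        have h2 := abs_sub_abs_le_abs_sub z.re w.re
        rw [abs_sub_comm] at h2
        linarith
      · apply half_le_norm_sinh_of_im k
        rw [← hk, ← sub_im]
        exact (abs_im_le_norm _).trans hw'
    · have : 1 + ‖z‖ ≤ (1 + ‖z‖) ^ 2 := by nlinarith [norm_nonneg z]
      have := mul_le_mul_of_nonneg_left this (by positivity : 0 ≤ 512 * C)
      rw [div_le_iff₀ (by positivity)]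
      nlinarith
  · have hx0 : 0 < x := by linarith
    have hnx : ‖(x : ℂ)‖ = x := by simp [hx0.le]
    refine (key x (x / 2) (by positivity) (fun w hw => ?_) (2 * C * x)
      (by rw [hnx]; nlinarith)).trans ?_
    · apply half_le_norm_sinh_of_re
      have h1 := (abs_re_le_norm (w - x)).trans (mem_ball_iff_norm.1 hw).le
      rw [sub_re, ofReal_re, abs_le] at h1
      refine le_trans ?_ (le_abs_self _)
      linarith [h1.1]
    · rw [div_le_iff₀ (by positivity)]
      have : x ≤ x ^ 2 := by nlinarith
      have := mul_le_mul_of_nonneg_left this (by positivity : 0 ≤ 128 * C)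
      nlinarith

lemma hasDerivAt_unique_of_forall_eq {F G : ℂ → ℂ} {a b z : ℂ} (h : ∀ z, F z = G z)
    (hF : HasDerivAt F a z) (hG : HasDerivAt G b z) : a = b :=
  hF.unique (by rwa [funext h])

lemma exists_const_of_hasDerivAt_zero {F : ℂ → ℂ} (h : ∀ z, HasDerivAt F 0 z) :
    ∃ c, ∀ z, F z = c :=
  ⟨F 0, fun z => is_const_of_deriv_eq_zero (fun z => (h z).differentiableAt)
    (fun z => (h z).deriv) z 0⟩

/-- The general solution of `u'' = k ^ 2 * u`. -/
lemma exists_eq_exp_add_exp {u u₁ : ℂ → ℂ} {k : ℂ} (hk : k ≠ 0)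
    (h : ∀ z, HasDerivAt u (u₁ z) z) (h₁ : ∀ z, HasDerivAt u₁ (k ^ 2 * u z) z) :
    ∃ α β : ℂ, ∀ z, u z = α * exp (k * z) + β * exp (-(k * z)) := by
  have hexp : ∀ z, HasDerivAt (fun z => exp (k * z)) (exp (k * z) * k) z := fun z => by
    simpa using ((hasDerivAt_id z).const_mul k).cexp
  have hexp' : ∀ z, HasDerivAt (fun z => exp (-(k * z))) (exp (-(k * z)) * (-k)) z := fun z => by
    simpa using ((hasDerivAt_id z).const_mul k).neg.cexp
  obtain ⟨α, hα⟩ := exists_const_of_hasDerivAt_zero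
    (F := fun z => (u₁ z + k * u z) * exp (-(k * z))) fun z =>
      (((h₁ z).add ((h z).const_mul k)).mul (hexp' z)).congr_deriv (by simp only [Pi.add_apply]; ring)
  obtain ⟨β, hβ⟩ := exists_const_of_hasDerivAt_zero
    (F := fun z => (u₁ z - k * u z) * exp (k * z)) fun z =>
      (((h₁ z).sub ((h z).const_mul k)).mul (hexp z)).congr_deriv (by simp only [Pi.sub_apply]; ring)
  refine ⟨α / (2 * k), -β / (2 * k), fun z => ?_⟩
  have he : exp (k * z) * exp (-(k * z)) = 1 := by rw [← exp_add]; simp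
  rw [← hα z, ← hβ z]
  field_simp
  linear_combination (-(2 * k * u z)) * he

lemma eq_zero_of_exp_combination {α β γ : ℂ}
    (h : ∀ z, α + β * exp z + γ * exp (-z) = 0) : α = 0 ∧ β = 0 ∧ γ = 0 := by
  have h0 := h 0
  have h1 := h (Real.pi * I)
  have h2 := h (Real.pi / 2 * I)
  have e : exp (-(Real.pi / 2 * I)) = -I := by
    rw [← neg_mul, exp_mul_I]; simp
  rw [exp_neg, exp_pi_mul_I] at h1
  rw [e, exp_pi_div_two_mul_I] at h2
  simp only [neg_zero, exp_zero] at h0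
  norm_num at h1
  have hα : α = 0 := by linear_combination (h0 + h1) / 2
  have hβ : β = 0 := by
    linear_combination h0 / 2 - I * h2 / 2 - hα / 2 + I * hα / 2 + (β - γ) / 2 * I_sq
  exact ⟨hα, hβ, by linear_combination h0 - hα - hβ⟩

/-- Along an entire solution of `g ^ 2 + A * g' ^ 2 = 2 * q * cosh`, the third derivative is a
constant multiple of the first, unless `9 * A = -4`. -/
lemma exists_const_third_deriv {g : ℂ → ℂ} {A q : ℂ} (hg : Differentiable ℂ g) (hA : A ≠ 0)
    (hA' : 9 * A ≠ -4) (hq : q ≠ 0)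
    (h : ∀ z, g z ^ 2 + A * deriv g z ^ 2 = 2 * q * cosh z) :
    ∃ μ, ∀ z, deriv (deriv (deriv g)) z = μ * deriv g z := by
  have hg₁ : Differentiable ℂ (deriv g) := hg.deriv
  have hg₂ : Differentiable ℂ (deriv (deriv g)) := hg₁.deriv
  have hg₃ : Differentiable ℂ (deriv (deriv (deriv g))) := hg₂.deriv
  have e₁ : ∀ z, deriv g z * (g z + A * deriv (deriv g) z) = q * sinh z := fun z => by
    have := hasDerivAt_unique_of_forall_eq h
      (((hg z).hasDerivAt.fun_pow 2).add (((hg₁ z).hasDerivAt.fun_pow 2).const_mul A))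
      ((hasDerivAt_cosh z).const_mul (2 * q))
    push_cast at this
    linear_combination this / 2
  have hE : ∀ z, HasDerivAt (fun z => g z + A * deriv (deriv g) z)
      (deriv g z + A * deriv (deriv (deriv g)) z) z := fun z =>
    (hg z).hasDerivAt.add ((hg₂ z).hasDerivAt.const_mul A)
  have e₂ : ∀ z, deriv (deriv g) z * (g z + A * deriv (deriv g) z)
      + deriv g z * (deriv g z + A * deriv (deriv (deriv g)) z) = q * cosh z := fun z =>
    hasDerivAt_unique_of_forall_eq e₁ ((hg₁ z).hasDerivAt.mul (hE z))
      ((hasDerivAt_sinh z).const_mul q)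
  have e₃ : ∀ z, deriv (deriv (deriv g)) z * (g z + A * deriv (deriv g) z)
      + deriv (deriv g) z * (deriv g z + A * deriv (deriv (deriv g)) z)
      + (deriv (deriv g) z * (deriv g z + A * deriv (deriv (deriv g)) z)
        + deriv g z * (deriv (deriv g) z + A * deriv (deriv (deriv (deriv g))) z))
      = q * sinh z := fun z =>
    hasDerivAt_unique_of_forall_eq e₂ (((hg₂ z).hasDerivAt.mul (hE z)).add
      ((hg₁ z).hasDerivAt.mul ((hg₁ z).hasDerivAt.add ((hg₃ z).hasDerivAt.const_mul A))))
      ((hasDerivAt_cosh z).const_mul q)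
  have hcosh : ∀ z, deriv g z = 0 → q * cosh z ≠ 0 := fun z hz => by
    refine mul_ne_zero hq fun hc => ?_
    have hs : sinh z = 0 := by
      have := e₁ z
      rw [hz, zero_mul] at this
      exact (mul_eq_zero.1 this.symm).resolve_left hq
    have := cosh_sq_sub_sinh_sq z
    rw [hc, hs] at this
    norm_num at this
  have hsimple : ∀ z, deriv g z = 0 → deriv (deriv g) z ≠ 0 := fun z hz h2 => by
    have := e₂ z
    rw [hz, h2] at this
    exact hcosh z hz (by linear_combination -this)
  have hzero : ∀ z, deriv g z = 0 → deriv (deriv (deriv g)) z = 0 := fun z hz => by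
    have h0 := h z
    have h1 := e₁ z
    have h2 := e₂ z
    have h3 := e₃ z
    have hs2 := hsimple z hz
    rw [hz] at h0 h1 h2 h3
    have h4 : deriv (deriv (deriv g)) z * (g z + 3 * A * deriv (deriv g) z) = 0 := by
      linear_combination h3 - h1
    refine (mul_eq_zero.1 h4).resolve_right fun h5 => hA' ?_
    have h6 : g z = -3 * A * deriv (deriv g) z := by linear_combination h5
    rw [h6] at h0 h2
    have h7 : A * deriv (deriv g) z ^ 2 * (9 * A + 4) = 0 := by linear_combination h0 - 2 * h2
    have := (mul_eq_zero.1 h7).resolve_left (mul_ne_zero hA (pow_ne_zero 2 hs2))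
    linear_combination this
  obtain ⟨φ, hφ, hφD⟩ := exists_differentiable_mul_eq hg₁ hg₃ hsimple hzero
  have hgb : ExpBounded g := by
    refine .of_sq_add_mul_deriv_sq hg hA (Q := ‖2 * q‖) fun z => ?_
    rw [h z, norm_mul]
    gcongr
    rw [cosh, norm_div, norm_ofNat, div_le_iff₀ two_pos]
    have h1 := norm_exp_le_exp_norm z
    have h2 := norm_exp_le_exp_norm (-z)
    rw [norm_neg] at h2
    linarith [norm_add_le (exp z) (exp (-z))]
  have hg₁b := hgb.deriv hg
  obtain ⟨μ, hμ⟩ := exists_const_of_deriv_deriv_eq_mul hq hg₁ hg₁b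
    (hgb.add ((hg₁b.deriv hg₁).const_mul A)) e₁ hφ hφD
  exact ⟨μ, fun z => by rw [hφD, hμ]⟩

/-- The entire solutions of the normalized equation `g ^ 2 + A * g' ^ 2 = 2 * q * cosh`. -/
lemma solutions_of_normalized {g : ℂ → ℂ} {A q : ℂ} (hg : Differentiable ℂ g) (hA : A ≠ 0)
    (hA' : 9 * A ≠ -4) (hq : q ≠ 0)
    (h : ∀ z, g z ^ 2 + A * deriv g z ^ 2 = 2 * q * cosh z) :
    (A = -1 ∧ ∃ t₁ t₂ r : ℂ, r ^ 2 + 4 * t₁ * t₂ = 0 ∧ 2 * t₁ * r = q ∧ 2 * t₂ * r = q ∧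
      ∀ z, g z = t₁ * exp z + t₂ * exp (-z) + r) ∨
    (A = 4 ∧ ∃ l₁ l₂ : ℂ, l₁ ^ 2 = q / 2 ∧ l₂ ^ 2 = q / 2 ∧
      ∀ z, g z = l₁ * exp (1 / 2 * z) + l₂ * exp (-(1 / 2 * z))) := by
  obtain ⟨μ, hμ⟩ := exists_const_third_deriv hg hA hA' hq h
  have hg₁ : Differentiable ℂ (deriv g) := hg.deriv
  have hg₂ : Differentiable ℂ (deriv (deriv g)) := hg₁.deriv
  have d₀ : ∀ z, HasDerivAt g (deriv g z) z := fun z => (hg z).hasDerivAt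
  have d₁ : ∀ z, HasDerivAt (deriv g) (deriv (deriv g) z) z := fun z => (hg₁ z).hasDerivAt
  have d₂ : ∀ z, HasDerivAt (deriv (deriv g)) (μ * deriv g z) z := fun z => by
    rw [← hμ]; exact (hg₂ z).hasDerivAt
  have e₁ : ∀ z, deriv g z * (g z + A * deriv (deriv g) z) = q * sinh z := fun z => by
    have := hasDerivAt_unique_of_forall_eq h
      (((d₀ z).fun_pow 2).add (((d₁ z).fun_pow 2).const_mul A))
      ((hasDerivAt_cosh z).const_mul (2 * q))
    push_cast at this
    linear_combination this / 2
  have e₂ : ∀ z, deriv (deriv g) z * (g z + A * deriv (deriv g) z)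
      + deriv g z * (deriv g z + A * (μ * deriv g z)) = q * cosh z := fun z =>
    hasDerivAt_unique_of_forall_eq e₁ ((d₁ z).mul ((d₀ z).add ((d₂ z).const_mul A)))
      ((hasDerivAt_sinh z).const_mul q)
  have e₃ : ∀ z, deriv g z * ((μ - 1) * g z + (3 + 4 * A * μ - A) * deriv (deriv g) z) = 0 :=
    fun z => by
      have := hasDerivAt_unique_of_forall_eq e₂
        (((d₂ z).mul ((d₀ z).add ((d₂ z).const_mul A))).add
          ((d₁ z).mul ((d₁ z).add (((d₁ z).const_mul μ).const_mul A))))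
        ((hasDerivAt_cosh z).const_mul q)
      simp only [Pi.add_apply] at this
      linear_combination this - e₁ z
  have hz₀ : deriv g (Real.pi / 2 * I) * (g (Real.pi / 2 * I) +
      A * deriv (deriv g) (Real.pi / 2 * I)) ≠ 0 := by
    rw [e₁, sinh_mul_I]
    simpa using hq
  have e₄ : ∀ z, (μ - 1) * g z + (3 + 4 * A * μ - A) * deriv (deriv g) z = 0 := by
    have an : ∀ {F : ℂ → ℂ}, Differentiable ℂ F → AnalyticOnNhd ℂ F Set.univ := fun hF z _ =>
      hF.analyticAt z
    rcases (an hg₁).eq_zero_or_eq_zero_of_mul_eq_zero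
      (an ((hg.const_mul (μ - 1)).add (hg₂.const_mul (3 + 4 * A * μ - A))))
      (fun z _ => e₃ z) isPreconnected_univ with h1 | h1
    · exact absurd (h1 _ (Set.mem_univ _)) (left_ne_zero_of_mul hz₀)
    · exact fun z => h1 z (Set.mem_univ z)
  by_cases hν : 3 + 4 * A * μ - A = 0
  · left
    have hμ1 : μ = 1 := by
      by_contra hne
      have hg0 : ∀ z, g z = 0 := fun z => by
        have := e₄ z
        rw [hν, zero_mul, add_zero] at this
        exact (mul_eq_zero.1 this).resolve_left (sub_ne_zero.2 hne)
      have : deriv g = 0 := by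
        rw [show g = fun _ => 0 from funext hg0]; simp; rfl
      exact hz₀ (by rw [this]; simp)
    have hA1 : A = -1 := by rw [hμ1] at hν; linear_combination hν / 3
    refine ⟨hA1, ?_⟩
    obtain ⟨c, hc⟩ := exists_const_of_hasDerivAt_zero (F := fun z => deriv (deriv g) z - g z)
      fun z => ((d₂ z).sub (d₀ z)).congr_deriv (by rw [hμ1]; ring)
    obtain ⟨t₁, t₂, ht⟩ := exists_eq_exp_add_exp (u := fun z => g z + c) (u₁ := deriv g)
      one_ne_zero (fun z => (d₀ z).add_const c)
      fun z => (d₁ z).congr_deriv (by linear_combination hc z)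
    simp only [one_mul] at ht
    have hform : ∀ z, g z = t₁ * exp z + t₂ * exp (-z) + -c := fun z => by
      linear_combination ht z
    have hform' : ∀ z, deriv g z = t₁ * exp z + t₂ * (exp (-z) * -1) := fun z =>
      hasDerivAt_unique_of_forall_eq hform (d₀ z)
        ((((hasDerivAt_exp z).const_mul t₁).add ((hasDerivAt_neg z).cexp.const_mul t₂)).add_const _)
    obtain ⟨h1, h2, h3⟩ := eq_zero_of_exp_combination (α := (-c) ^ 2 + 4 * t₁ * t₂)
      (β := 2 * t₁ * (-c) - q) (γ := 2 * t₂ * (-c) - q) fun z => by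
        have he : exp z * exp (-z) = 1 := by rw [← exp_add]; simp
        have := h z
        rw [hform, hform', hA1, cosh] at this
        linear_combination this - 4 * t₁ * t₂ * he
    exact ⟨t₁, t₂, -c, h1, sub_eq_zero.1 h2, sub_eq_zero.1 h3, hform⟩
  · right
    obtain ⟨ν, hνdef⟩ : ∃ ν, (3 + 4 * A * μ - A) * ν = 1 - μ :=
      ⟨(1 - μ) / (3 + 4 * A * μ - A), by field_simp⟩
    have h2 : ∀ z, deriv (deriv g) z = ν * g z := fun z => by
      apply mul_left_cancel₀ hν
      linear_combination e₄ z - g z * hνdef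
    have hνμ : ν = μ := by
      have := hasDerivAt_unique_of_forall_eq h2 (d₂ (Real.pi / 2 * I))
        ((d₀ (Real.pi / 2 * I)).const_mul ν)
      exact (mul_right_cancel₀ (left_ne_zero_of_mul hz₀) this).symm
    subst hνμ
    have hfac : (4 * ν - 1) * (A * ν + 1) = 0 := by linear_combination hνdef
    have hν4 : ν = (1 / 2) ^ 2 := by
      rcases mul_eq_zero.1 hfac with h3 | h3
      · linear_combination h3 / 4
      · refine absurd ?_ (right_ne_zero_of_mul hz₀)
        rw [h2]; linear_combination g (Real.pi / 2 * I) * h3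
    obtain ⟨l₁, l₂, hform⟩ := exists_eq_exp_add_exp (u := g) (u₁ := deriv g) (k := 1 / 2)
      (by norm_num) d₀ fun z => (d₁ z).congr_deriv (by rw [h2, hν4])
    have hhalf : ∀ z : ℂ, HasDerivAt (fun z : ℂ => 1 / 2 * z) (1 / 2) z := fun z => by
      simpa using (hasDerivAt_id z).const_mul (1 / 2 : ℂ)
    have hform' : ∀ z, deriv g z
        = l₁ * (exp (1 / 2 * z) * (1 / 2)) + l₂ * (exp (-(1 / 2 * z)) * -(1 / 2)) := fun z =>
      hasDerivAt_unique_of_forall_eq hform (d₀ z)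
        (((hhalf z).cexp.const_mul l₁).add ((hhalf z).neg.cexp.const_mul l₂))
    obtain ⟨h3, h4, h5⟩ := eq_zero_of_exp_combination (α := 2 * l₁ * l₂ * (1 - A / 4))
      (β := (1 + A / 4) * l₁ ^ 2 - q) (γ := (1 + A / 4) * l₂ ^ 2 - q) fun z => by
        have he : exp (1 / 2 * z) * exp (-(1 / 2 * z)) = 1 := by rw [← exp_add]; simp
        have he1 : exp z = exp (1 / 2 * z) ^ 2 := by
          rw [← exp_nat_mul]; congr 1; push_cast; ring
        have he2 : exp (-z) = exp (-(1 / 2 * z)) ^ 2 := by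
          rw [← exp_nat_mul]; congr 1; push_cast; ring
        have := h z
        rw [hform, hform', cosh, he1, he2] at this
        rw [he1, he2]
        linear_combination this - 2 * l₁ * l₂ * (1 - A / 4) * he
    have hl₁ : l₁ ≠ 0 := by rintro rfl; exact hq (by linear_combination -h4)
    have hl₂ : l₂ ≠ 0 := by rintro rfl; exact hq (by linear_combination -h5)
    have hA4 : A = 4 := by
      have := (mul_eq_zero.1 h3).resolve_left (mul_ne_zero (mul_ne_zero two_ne_zero hl₁) hl₂)
      linear_combination -4 * this
    subst hA4
    exact ⟨rfl, l₁, l₂, by linear_combination h4 / 2, by linear_combination h5 / 2, hform⟩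

/-- The entire solutions of `f ^ 2 + a * f' ^ 2 = p₁ * exp (b * z) + p₂ * exp (-b * z)`. -/
lemma solutions_of_fermat_type {a b p₁ p₂ : ℂ} (ha : a ≠ 0) (hb : b ≠ 0) (hp₁ : p₁ ≠ 0)
    (hp₂ : p₂ ≠ 0) (hab : 9 * a * b ^ 2 ≠ -4) {f : ℂ → ℂ} (hf : Differentiable ℂ f)
    (h : ∀ z : ℂ, f z ^ 2 + a * (deriv f z) ^ 2 = p₁ * exp (b * z) + p₂ * exp (-b * z)) :
    (a * b ^ 2 + 1 = 0 ∧ ∃ t₁ t₂ r : ℂ, r ^ 4 = -(p₁ * p₂) ∧ 2 * t₁ * r = p₁ ∧ 2 * t₂ * r = p₂ ∧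
      ∀ z : ℂ, f z = t₁ * exp (b * z) + t₂ * exp (-b * z) + r) ∨
    (a * b ^ 2 - 4 = 0 ∧ ∃ l₁ l₂ : ℂ, l₁ ^ 2 = p₁ / 2 ∧ l₂ ^ 2 = p₂ / 2 ∧
      ∀ z : ℂ, f z = l₁ * exp (b / 2 * z) + l₂ * exp (-(b / 2) * z)) := by
  set d : ℂ := log (p₂ / p₁) / 4
  have hd : exp d ^ 4 = p₂ / p₁ := by
    rw [← exp_nat_mul, ← exp_log (div_ne_zero hp₂ hp₁)]; congr 1; simp only [d]; push_cast; ring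
  set s := exp d
  have hs : s ≠ 0 := exp_ne_zero d
  have hp : p₂ = p₁ * s ^ 4 := by rw [hd]; field_simp
  have hs2 : exp (2 * d) = s ^ 2 := by rw [← exp_nat_mul]; norm_num
  have hlin : ∀ z, HasDerivAt (fun z => (z + 2 * d) / b) (1 / b) z := fun z =>
    ((hasDerivAt_id z).add_const _).div_const b
  have hg : ∀ z, HasDerivAt (fun z => f ((z + 2 * d) / b)) (deriv f ((z + 2 * d) / b) * (1 / b)) z :=
    fun z => (hf _).hasDerivAt.comp z (hlin z)
  have hfg : ∀ z, f z = f ((b * z - 2 * d + 2 * d) / b) := fun z => by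
    congr 1; field_simp; ring
  have key := solutions_of_normalized (g := fun z => f ((z + 2 * d) / b)) (A := a * b ^ 2)
    (q := p₁ * s ^ 2) (fun z => (hg z).differentiableAt) (mul_ne_zero ha (pow_ne_zero 2 hb))
    (by rwa [← mul_assoc]) (mul_ne_zero hp₁ (pow_ne_zero 2 hs)) fun z => by
      rw [(hg z).deriv]
      have h1 := h ((z + 2 * d) / b)
      have e1 : exp (b * ((z + 2 * d) / b)) = exp z * s ^ 2 := by
        rw [← hs2, ← exp_add]; congr 1; field_simp
      have e2 : exp (-b * ((z + 2 * d) / b)) = exp (-z) / s ^ 2 := by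
        rw [← hs2, ← exp_sub]; congr 1; field_simp; ring
      rw [e1, e2, hp] at h1
      rw [cosh]
      field_simp at h1 ⊢
      linear_combination h1
  rcases key with ⟨hA, t₁, t₂, r, h1, h2, h3, h4⟩ | ⟨hA, l₁, l₂, h1, h2, h4⟩
  · refine .inl ⟨by rw [hA]; ring, t₁ / s ^ 2, t₂ * s ^ 2, r, ?_, ?_, ?_, fun z => ?_⟩
    · rw [hp]
      linear_combination r ^ 2 * h1 - 2 * t₂ * r * h2 - p₁ * s ^ 2 * h3
    · field_simp
      linear_combination h2
    · rw [hp]; linear_combination s ^ 2 * h3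
    · rw [hfg z, h4, exp_sub, show -(b * z - 2 * d) = -b * z + 2 * d by ring, exp_add, hs2]
      ring
  · refine .inr ⟨by rw [hA]; ring, l₁ / s, l₂ * s, ?_, ?_, fun z => ?_⟩
    · field_simp
      linear_combination 2 * h1
    · rw [hp]; linear_combination s ^ 2 * h2
    · rw [hfg z, h4, show 1 / 2 * (b * z - 2 * d) = b / 2 * z - d by ring, exp_sub,
        show -(b / 2 * z - d) = -(b / 2) * z + d by ring, exp_add]
      ring


theorem stmt_7 (a b p₁ p₂ : ℂ) (ha : a ≠ 0) (hb : b ≠ 0) (hp₁ : p₁ ≠ 0) (hp₂ : p₂ ≠ 0)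
    (hab : 9 * a * b ^ 2 ≠ -4) :
    ((∃ f : ℂ → ℂ, Differentiable ℂ f ∧
        ∀ z : ℂ, f z ^ 2 + a * (deriv f z) ^ 2
          = p₁ * Complex.exp (b * z) + p₂ * Complex.exp (-b * z)) ↔
      (a * b ^ 2 + 1 = 0 ∨ a * b ^ 2 - 4 = 0)) ∧
    (a * b ^ 2 + 1 = 0 → ∀ f : ℂ → ℂ, Differentiable ℂ f →
      (∀ z : ℂ, f z ^ 2 + a * (deriv f z) ^ 2
          = p₁ * Complex.exp (b * z) + p₂ * Complex.exp (-b * z)) →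
      ∃ t₁ t₂ r : ℂ, r ^ 4 = -(p₁ * p₂) ∧ 2 * t₁ * r = p₁ ∧ 2 * t₂ * r = p₂ ∧
        ∀ z : ℂ, f z = t₁ * Complex.exp (b * z) + t₂ * Complex.exp (-b * z) + r) ∧
    (a * b ^ 2 - 4 = 0 → ∀ f : ℂ → ℂ, Differentiable ℂ f →
      (∀ z : ℂ, f z ^ 2 + a * (deriv f z) ^ 2
          = p₁ * Complex.exp (b * z) + p₂ * Complex.exp (-b * z)) →
      ∃ l₁ l₂ : ℂ, l₁ ^ 2 = p₁ / 2 ∧ l₂ ^ 2 = p₂ / 2 ∧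
        ∀ z : ℂ, f z = l₁ * Complex.exp (b / 2 * z) + l₂ * Complex.exp (-(b / 2) * z)) := by
  have hder : ∀ c z : ℂ, HasDerivAt (fun z => exp (c * z)) (exp (c * z) * c) z := fun c z => by
    simpa using ((hasDerivAt_id z).const_mul c).cexp
  refine ⟨⟨?_, ?_⟩, fun hA f hf h => ?_, fun hA f hf h => ?_⟩
  · rintro ⟨f, hf, h⟩
    exact (solutions_of_fermat_type ha hb hp₁ hp₂ hab hf h).imp And.left And.left
  · rintro (hA | hA)
    · obtain ⟨r, hr⟩ := IsAlgClosed.exists_pow_nat_eq (-(p₁ * p₂)) (n := 4) (by norm_num)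
      have hr0 : r ≠ 0 := by
        rintro rfl
        exact mul_ne_zero hp₁ hp₂ (by linear_combination hr)
      have hd : ∀ z, HasDerivAt
          (fun z => p₁ / (2 * r) * exp (b * z) + p₂ / (2 * r) * exp (-b * z) + r)
          (p₁ / (2 * r) * (exp (b * z) * b) + p₂ / (2 * r) * (exp (-b * z) * -b)) z := fun z =>
        (((hder b z).const_mul _).add ((hder (-b) z).const_mul _)).add_const r
      refine ⟨_, fun z => (hd z).differentiableAt, fun z => ?_⟩
      rw [(hd z).deriv]
      have he : exp (b * z) * exp (-b * z) = 1 := by rw [← exp_add]; simp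
      generalize exp (b * z) = u, exp (-b * z) = v at he ⊢
      field_simp
      linear_combination (p₁ * u - p₂ * v) ^ 2 * hA
        + 4 * p₁ * p₂ * he + 4 * hr
    · obtain ⟨l₁, hl₁⟩ := IsAlgClosed.exists_pow_nat_eq (p₁ / 2) (n := 2) (by norm_num)
      obtain ⟨l₂, hl₂⟩ := IsAlgClosed.exists_pow_nat_eq (p₂ / 2) (n := 2) (by norm_num)
      have hd : ∀ z, HasDerivAt
          (fun z => l₁ * exp (b / 2 * z) + l₂ * exp (-(b / 2) * z))
          (l₁ * (exp (b / 2 * z) * (b / 2)) + l₂ * (exp (-(b / 2) * z) * -(b / 2))) z := fun z =>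
        ((hder _ z).const_mul _).add ((hder _ z).const_mul _)
      refine ⟨_, fun z => (hd z).differentiableAt, fun z => ?_⟩
      rw [(hd z).deriv]
      have he1 : exp (b * z) = exp (b / 2 * z) ^ 2 := by
        rw [← exp_nat_mul]; congr 1; push_cast; ring
      have he2 : exp (-b * z) = exp (-(b / 2) * z) ^ 2 := by
        rw [← exp_nat_mul]; congr 1; push_cast; ring
      rw [he1, he2]
      linear_combination (l₁ * exp (b / 2 * z) - l₂ * exp (-(b / 2) * z)) ^ 2 / 4 * hA
        + 2 * exp (b / 2 * z) ^ 2 * hl₁ + 2 * exp (-(b / 2) * z) ^ 2 * hl₂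
  · rcases solutions_of_fermat_type ha hb hp₁ hp₂ hab hf h with ⟨-, h'⟩ | ⟨h', -⟩
    · exact h'
    · exact absurd (hA.trans h'.symm) fun h => by
        have : (5 : ℂ) = 0 := by linear_combination h
        norm_num at this
  · rcases solutions_of_fermat_type ha hb hp₁ hp₂ hab hf h with ⟨h', -⟩ | ⟨-, h'⟩
    · exact absurd (h'.trans hA.symm) fun h => by
        have : (5 : ℂ) = 0 := by linear_combination h
        norm_num at this
    · exact h'
end
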